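/- arXiv:1511.06895 — 4 statements merged into one kernel-verified Lean document; each statement's English description precedes it below -/
import Mathlib

section
/- Let R > 0 and let μ = e^{-U(x)} dx be a probability measure on ℝⁿ with U smooth and Hess U(x) ≥ R·Id for all x. Then for every bounded smooth real-valued function g on ℝⁿ with bounded derivatives, ∫_{ℝⁿ} g² dμ − (∫_{ℝⁿ} g dμ)² ≤ (1/R) ∫_{ℝⁿ} ‖∇g‖² dμ (the Poincaré inequality for uniformly log-concave measures). -/
open MeasureTheory Real
open scoped ENNReal

theorem volume_add_volume_le_of_isCompact {K L C : Set ℝ} (hK : IsCompact K) (hL : IsCompact L)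
    (hKne : K.Nonempty) (hLne : L.Nonempty)
    (hC : ∀ x ∈ K, ∀ y ∈ L, 2⁻¹ * (x + y) ∈ C) :
    volume K + volume L ≤ 2 * volume C := by
  obtain ⟨k, hk, hkmax⟩ := hK.exists_isGreatest hKne
  obtain ⟨l, hl, hlmin⟩ := hL.exists_isLeast hLne
  have hD : volume ((fun z : ℝ => 2⁻¹ * z) ⁻¹' C) = 2 * volume C := by
    rw [Real.volume_preimage_mul_left (by norm_num)]
    norm_num
  have hK' : volume ((fun z => z + (-l)) ⁻¹' K) = volume K := measure_preimage_add_right _ _ _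
  have hL' : volume ((fun z => z + (-k)) ⁻¹' L) = volume L := measure_preimage_add_right _ _ _
  have hLm : MeasurableSet ((fun z => z + (-k)) ⁻¹' L) :=
    (measurable_add_const _) hL.measurableSet
  have hdisj : AEDisjoint volume ((fun z => z + (-l)) ⁻¹' K) ((fun z => z + (-k)) ⁻¹' L) := by
    refine measure_mono_null (t := {k + l}) ?_ (by simp)
    rintro z ⟨hz₁, hz₂⟩
    have h₁ := hkmax hz₁
    have h₂ := hlmin hz₂
    simp only [Set.mem_singleton_iff]
    linarith
  rw [← hD, ← hK', ← hL', ← measure_union₀ hLm.nullMeasurableSet hdisj]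
  refine measure_mono ?_
  rintro z (hz | hz)
  · simpa using hC _ hz _ hl
  · simpa using hC _ hk _ hz

/-- The one-dimensional Brunn–Minkowski inequality for midpoints. -/
theorem volume_add_volume_le_of_midpoint_mem {A B C : Set ℝ} (hA : MeasurableSet A)
    (hB : MeasurableSet B) (hAne : A.Nonempty) (hBne : B.Nonempty)
    (hC : ∀ x ∈ A, ∀ y ∈ B, 2⁻¹ * (x + y) ∈ C) :
    volume A + volume B ≤ 2 * volume C := by
  obtain ⟨a, ha⟩ := hAne
  obtain ⟨b, hb⟩ := hBne
  rw [hA.measure_eq_iSup_isCompact, hB.measure_eq_iSup_isCompact]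
  simp only [iSup_and']
  refine ENNReal.biSup_add_biSup_le' ⟨∅, by simp⟩ ⟨∅, by simp⟩ ?_
  rintro K ⟨hKA, hK⟩ L ⟨hLB, hL⟩
  have hKa : insert a K ⊆ A := Set.insert_subset ha hKA
  have hLb : insert b L ⊆ B := Set.insert_subset hb hLB
  exact (add_le_add (measure_mono (Set.subset_insert a K))
    (measure_mono (Set.subset_insert b L))).trans
    (volume_add_volume_le_of_isCompact (hK.insert a) (hL.insert b) (Set.insert_nonempty _ _)
      (Set.insert_nonempty _ _) fun x hx y hy => hC x (hKa hx) y (hLb hy))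

/-- The additive form of the one-dimensional Prékopa–Leindler inequality, for functions with
supremum one. -/
theorem lintegral_add_lintegral_le_of_isLUB_one {f g h : ℝ → ℝ}
    (hf : Measurable f) (hg : Measurable g) (hh : Measurable h)
    (hf0 : 0 ≤ f) (hg0 : 0 ≤ g) (hh0 : 0 ≤ h)
    (hf1 : IsLUB (Set.range f) 1) (hg1 : IsLUB (Set.range g) 1)
    (hfg : ∀ x y, f x * g y ≤ h (2⁻¹ * (x + y)) ^ 2) :
    (∫⁻ x, .ofReal (f x)) + ∫⁻ x, .ofReal (g x) ≤ 2 * ∫⁻ x, .ofReal (h x) := by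
  have level : ∀ {f : ℝ → ℝ}, Measurable f → 0 ≤ f → ∫⁻ x, .ofReal (f x) =
      ∫⁻ t in Set.Ioi 0, volume {x | t < f x} := fun hf hf0 =>
    lintegral_eq_lintegral_meas_lt _ (Filter.Eventually.of_forall hf0) hf.aemeasurable
  have meas : ∀ f : ℝ → ℝ, Measurable fun t : ℝ => volume {x | t < f x} := fun f =>
    Antitone.measurable fun s t hst => measure_mono fun x hx => lt_of_le_of_lt hst hx
  rw [level hf hf0, level hg hg0, level hh hh0, ← lintegral_add_left (meas f),
    ← lintegral_const_mul _ (meas h)]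
  refine setLIntegral_mono' measurableSet_Ioi fun t (ht : 0 < t) => ?_
  rcases lt_or_ge t 1 with ht1 | ht1
  · obtain ⟨_, ⟨x, rfl⟩, hx, -⟩ := hf1.exists_between ht1
    obtain ⟨_, ⟨y, rfl⟩, hy, -⟩ := hg1.exists_between ht1
    refine volume_add_volume_le_of_midpoint_mem (measurableSet_lt measurable_const hf)
      (measurableSet_lt measurable_const hg) ⟨x, hx⟩ ⟨y, hy⟩
      fun x (hx : t < f x) y (hy : t < g y) => ?_
    refine lt_of_pow_lt_pow_left₀ 2 (hh0 _) (lt_of_lt_of_le ?_ (hfg x y))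
    rw [sq]
    exact mul_lt_mul'' hx hy ht.le ht.le
  · have empty : ∀ {f : ℝ → ℝ}, IsLUB (Set.range f) 1 → {x | t < f x} = ∅ := fun hf =>
      Set.eq_empty_of_forall_notMem fun x (hx : t < _) =>
        not_lt_of_ge ((hf.1 ⟨x, rfl⟩).trans ht1) hx
    simp [empty hf1, empty hg1]

theorem ENNReal.mul_le_sq_of_add_le_two_mul {a b c : ℝ≥0∞} (h : a + b ≤ 2 * c) : a * b ≤ c ^ 2 := by
  rcases eq_or_ne c ∞ with rfl | hc
  · simp
  have hab : a + b ≠ ∞ := ne_top_of_le_ne_top (by finiteness) h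
  lift c to NNReal using hc
  lift a to NNReal using (ENNReal.add_ne_top.1 hab).1
  lift b to NNReal using (ENNReal.add_ne_top.1 hab).2
  norm_cast at *
  rw [← NNReal.coe_le_coe] at *
  push_cast at *
  nlinarith [sq_nonneg ((a : ℝ) - b), a.2, b.2, c.2]

theorem lintegral_mul_lintegral_le_sq_of_bddAbove {f g h : ℝ → ℝ}
    (hf : Measurable f) (hg : Measurable g) (hh : Measurable h)
    (hf0 : 0 ≤ f) (hg0 : 0 ≤ g) (hh0 : 0 ≤ h)
    (hfb : BddAbove (Set.range f)) (hgb : BddAbove (Set.range g))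
    (hfg : ∀ x y, f x * g y ≤ h (2⁻¹ * (x + y)) ^ 2) :
    (∫⁻ x, .ofReal (f x)) * ∫⁻ x, .ofReal (g x) ≤ (∫⁻ x, .ofReal (h x)) ^ 2 := by
  have hfs := isLUB_csSup (Set.range_nonempty f) hfb
  have hgs := isLUB_csSup (Set.range_nonempty g) hgb
  set a := sSup (Set.range f)
  set b := sSup (Set.range g)
  have ha0 : 0 ≤ a := (hf0 0).trans (hfs.1 ⟨0, rfl⟩)
  have hb0 : 0 ≤ b := (hg0 0).trans (hgs.1 ⟨0, rfl⟩)
  rcases ha0.eq_or_lt with ha | ha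
  · have : f = 0 := funext fun x => le_antisymm ((hfs.1 ⟨x, rfl⟩).trans ha.ge) (hf0 x)
    simp [this]
  rcases hb0.eq_or_lt with hb | hb
  · have : g = 0 := funext fun x => le_antisymm ((hgs.1 ⟨x, rfl⟩).trans hb.ge) (hg0 x)
    simp [this]
  have lub : ∀ {f : ℝ → ℝ} {a : ℝ}, 0 < a → IsLUB (Set.range f) a →
      IsLUB (Set.range fun x => a⁻¹ * f x) 1 := by
    intro f a ha hfa
    constructor
    · rintro _ ⟨x, rfl⟩
      have := hfa.1 ⟨x, rfl⟩
      simp only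
      rw [inv_mul_le_iff₀ ha]
      simpa using this
    · intro u hu
      have : a ≤ a * u := hfa.2 (by
        rintro _ ⟨x, rfl⟩
        have := hu ⟨x, rfl⟩
        simp only at this
        rwa [inv_mul_le_iff₀ ha] at this)
      exact (le_mul_iff_one_le_right ha).1 this
  have hc : 0 < √(a * b) := Real.sqrt_pos.2 (mul_pos ha hb)
  have hc2 : √(a * b) ^ 2 = a * b := Real.sq_sqrt (mul_pos ha hb).le
  have key := ENNReal.mul_le_sq_of_add_le_two_mul <| lintegral_add_lintegral_le_of_isLUB_one
    (f := fun x => a⁻¹ * f x) (g := fun x => b⁻¹ * g x) (h := fun x => (√(a * b))⁻¹ * h x)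
    (hf.const_mul _) (hg.const_mul _) (hh.const_mul _)
    (fun x => mul_nonneg (by positivity) (hf0 x)) (fun x => mul_nonneg (by positivity) (hg0 x))
    (fun x => mul_nonneg (by positivity) (hh0 x)) (lub ha hfs) (lub hb hgs) (fun x y => by
      rw [mul_pow, inv_pow, hc2]
      calc a⁻¹ * f x * (b⁻¹ * g y) = (a * b)⁻¹ * (f x * g y) := by field_simp
        _ ≤ _ := mul_le_mul_of_nonneg_left (hfg x y) (by positivity))
  have scale : ∀ {f : ℝ → ℝ} {a : ℝ}, 0 < a → Measurable f → ∫⁻ x, .ofReal (f x) =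
      .ofReal a * ∫⁻ x, .ofReal (a⁻¹ * f x) := by
    intro f a ha hf
    rw [← lintegral_const_mul _ (hf.const_mul _).ennreal_ofReal]
    congr with x
    rw [← ENNReal.ofReal_mul ha.le, mul_inv_cancel_left₀ ha.ne']
  rw [scale ha hf, scale hb hg, scale hc hh, mul_pow, ← ENNReal.ofReal_pow hc.le, hc2,
    ENNReal.ofReal_mul ha.le, mul_mul_mul_comm]
  gcongr

/-- The Prékopa–Leindler inequality for midpoints on the real line. -/
theorem lintegral_mul_lintegral_le_sq_real {f g h : ℝ → ℝ≥0∞}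
    (hf : Measurable f) (hg : Measurable g) (hh : Measurable h)
    (hfg : ∀ x y, f x * g y ≤ h (2⁻¹ * (x + y)) ^ 2) :
    (∫⁻ x, f x) * ∫⁻ x, g x ≤ (∫⁻ x, h x) ^ 2 := by
  have trunc : ∀ {f : ℝ → ℝ≥0∞}, Measurable f →
      ∫⁻ x, f x = ⨆ N : ℕ, ∫⁻ x, min (f x) N := by
    intro f hf
    rw [← lintegral_iSup (fun N => hf.min measurable_const)
      (fun M N hMN x => min_le_min le_rfl (by exact_mod_cast hMN))]
    congr with x
    rw [← inf_iSup_eq, ENNReal.iSup_natCast, inf_top_eq]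
  have ofReal : ∀ (f : ℝ → ℝ≥0∞) (N : ℕ) (x : ℝ),
      ENNReal.ofReal (min (f x) N).toReal = min (f x) N := fun f N x =>
    ENNReal.ofReal_toReal (ne_top_of_le_ne_top (ENNReal.natCast_ne_top N) (min_le_right _ _))
  have bdd : ∀ (f : ℝ → ℝ≥0∞) (N : ℕ), BddAbove (Set.range fun x => (min (f x) N).toReal) := by
    rintro f N
    refine ⟨N, ?_⟩
    rintro _ ⟨x, rfl⟩
    exact ENNReal.toReal_le_of_le_ofReal (by positivity) (by simp)
  have bound : ∀ M N : ℕ, (∫⁻ x, min (f x) M) * ∫⁻ x, min (g x) N ≤ (∫⁻ x, h x) ^ 2 := by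
    intro M N
    have key := lintegral_mul_lintegral_le_sq_of_bddAbove
      (f := fun x => (min (f x) M).toReal) (g := fun x => (min (g x) N).toReal)
      (h := fun x => (min (h x) (max M N : ℕ)).toReal)
      (hf.min measurable_const).ennreal_toReal (hg.min measurable_const).ennreal_toReal
      (hh.min measurable_const).ennreal_toReal
      (fun _ => ENNReal.toReal_nonneg) (fun _ => ENNReal.toReal_nonneg)
      (fun _ => ENNReal.toReal_nonneg) (bdd f M) (bdd g N) (fun x y => by
        rw [← ENNReal.toReal_mul, ← ENNReal.toReal_pow]
        refine ENNReal.toReal_mono (ENNReal.pow_ne_top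
          (ne_top_of_le_ne_top (ENNReal.natCast_ne_top _) (min_le_right _ _))) ?_
        rcases le_total (h (2⁻¹ * (x + y))) (max M N : ℕ) with hle | hle
        · rw [min_eq_left hle]
          exact (mul_le_mul' (min_le_left _ _) (min_le_left _ _)).trans (hfg x y)
        · rw [min_eq_right hle, sq]
          exact mul_le_mul' ((min_le_right _ _).trans (by simp))
            ((min_le_right _ _).trans (by simp)))
    simp only [ofReal] at key
    refine key.trans ?_
    gcongr
    exact min_le_left _ _
  rw [trunc hf, trunc hg, ENNReal.iSup_mul]
  refine iSup_le fun M => ?_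
  rw [ENNReal.mul_iSup]
  exact iSup_le fun N => bound M N

/-- The Prékopa–Leindler inequality for midpoints on `Fin n → ℝ`. -/
theorem lintegral_mul_lintegral_le_sq_pi {n : ℕ} {f g h : (Fin n → ℝ) → ℝ≥0∞}
    (hf : Measurable f) (hg : Measurable g) (hh : Measurable h)
    (hfg : ∀ x y, f x * g y ≤ h ((2⁻¹ : ℝ) • (x + y)) ^ 2) :
    (∫⁻ x, f x) * ∫⁻ x, g x ≤ (∫⁻ x, h x) ^ 2 := by
  induction n with
  | zero =>
    have := hfg 0 0
    simp only [volume_pi, Measure.pi_of_empty (x := (0 : Fin 0 → ℝ)), lintegral_dirac]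
    simpa using this
  | succ n ih =>
    have cons : Measurable fun p : ℝ × (Fin n → ℝ) => (Fin.cons p.1 p.2 : Fin (n + 1) → ℝ) := by
      refine measurable_pi_lambda _ fun i => ?_
      refine Fin.cases ?_ (fun j => ?_) i
      · simpa using measurable_fst
      · simpa using! (measurable_pi_apply j).comp measurable_snd
    have fubini : ∀ {f : (Fin (n + 1) → ℝ) → ℝ≥0∞}, Measurable f →
        ∫⁻ x, f x = ∫⁻ s : ℝ, ∫⁻ y : Fin n → ℝ, f (Fin.cons s y) := by
      intro f hf
      have e := (volume_preserving_piFinSuccAbove (fun _ : Fin (n + 1) => ℝ) 0).symm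
      rw [← e.lintegral_comp hf]
      refine (lintegral_prod _ (hf.comp e.measurable).aemeasurable).trans ?_
      simp [MeasurableEquiv.piFinSuccAbove, Fin.insertNthEquiv]
    rw [fubini hf, fubini hg, fubini hh]
    refine lintegral_mul_lintegral_le_sq_real (hf.comp cons).lintegral_prod_right'
      (hg.comp cons).lintegral_prod_right' (hh.comp cons).lintegral_prod_right' fun s t => ?_
    refine ih (hf.comp (cons.comp measurable_prodMk_left))
      (hg.comp (cons.comp measurable_prodMk_left)) (hh.comp (cons.comp measurable_prodMk_left))
      fun x y => ?_
    convert hfg (Fin.cons s x) (Fin.cons t y) using 3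
    ext i
    refine Fin.cases ?_ (fun j => ?_) i <;> simp [mul_add]

/-- The Prékopa–Leindler inequality for midpoints on Euclidean space. -/
theorem lintegral_mul_lintegral_le_sq {n : ℕ} {f g h : EuclideanSpace ℝ (Fin n) → ℝ≥0∞}
    (hf : Measurable f) (hg : Measurable g) (hh : Measurable h)
    (hfg : ∀ x y, f x * g y ≤ h ((2⁻¹ : ℝ) • (x + y)) ^ 2) :
    (∫⁻ x, f x) * ∫⁻ x, g x ≤ (∫⁻ x, h x) ^ 2 := by
  have e := PiLp.volume_preserving_toLp (Fin n)
  rw [← e.lintegral_comp hf, ← e.lintegral_comp hg, ← e.lintegral_comp hh]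
  exact lintegral_mul_lintegral_le_sq_pi (hf.comp e.measurable) (hg.comp e.measurable)
    (hh.comp e.measurable) fun x y => hfg _ _

theorem Real.quadratic_sub_cube_le_exp {x : ℝ} (hx : |x| ≤ 1) :
    1 + x + x ^ 2 / 2 - |x| ^ 3 ≤ exp x := by
  have h := (abs_le.1 (Real.exp_bound hx (n := 3) (by norm_num))).1
  norm_num [Finset.sum_range_succ, Nat.factorial] at h
  have : 0 ≤ |x| ^ 3 := by positivity
  linarith

/-- Second-order expansion of the inequality `∫ e ^ (t g - t² d) * ∫ e ^ (-t g) ≤ 1` at `t = 0`. -/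
theorem integral_sq_sub_sq_integral_le_of_integral_exp_mul_le {Ω : Type*} [MeasurableSpace Ω]
    {μ : Measure Ω} [IsProbabilityMeasure μ] {g d : Ω → ℝ} (hg : Measurable g) (hd : Measurable d)
    {K : ℝ} (hgK : ∀ x, |g x| ≤ K) (hdK : ∀ x, |d x| ≤ K)
    (h : ∀ᶠ t in nhdsWithin (0 : ℝ) (Set.Ioi 0),
      (∫ x, exp (t * g x - t ^ 2 * d x) ∂μ) * ∫ x, exp (-(t * g x)) ∂μ ≤ 1) :
    ∫ x, g x ^ 2 ∂μ - (∫ x, g x ∂μ) ^ 2 ≤ ∫ x, d x ∂μ := by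
  have int : ∀ {f : Ω → ℝ}, Measurable f → ∀ C : ℝ, (∀ x, |f x| ≤ C) → Integrable f μ :=
    fun hf C hC => .of_bound hf.aestronglyMeasurable C (Filter.Eventually.of_forall hC)
  have hK0 : 0 ≤ K := by
    obtain ⟨x⟩ : Nonempty Ω := μ.nonempty_of_neZero
    exact (abs_nonneg _).trans (hgK x)
  have hgi := int hg K hgK
  have hdi := int hd K hdK
  have hg2i := int (hg.pow_const 2) (K ^ 2) fun x => by
    rw [abs_pow]; exact pow_le_pow_left₀ (abs_nonneg _) (hgK x) 2
  set A := ∫ x, g x ^ 2 ∂μ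
  set a := ∫ x, g x ∂μ
  set b := ∫ x, d x ∂μ
  set C := K ^ 2 + 8 * K ^ 3
  have hC0 : 0 ≤ C := by positivity
  have small : ∀ᶠ t in nhdsWithin (0 : ℝ) (Set.Ioi 0), 0 < t ∧ t ≤ 1 ∧ 2 * K * t ≤ 1 ∧
      0 ≤ 1 + t * (a + t * (A / 2 - b) - C * t ^ 2) ∧ 0 ≤ 1 + t * (-a + t * (A / 2) - C * t ^ 2) := by
    have ev : ∀ p : ℝ → ℝ, Continuous p → p 0 < 1 → ∀ᶠ t in nhdsWithin (0 : ℝ) (Set.Ioi 0), p t < 1 :=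
      fun p hp hp0 => nhdsWithin_le_nhds (hp.continuousAt.eventually_lt_const hp0)
    filter_upwards [self_mem_nhdsWithin, ev (fun t => t) (by fun_prop) (by simp),
      ev (fun t => 2 * K * t) (by fun_prop) (by simp),
      ev (fun t => -(t * (a + t * (A / 2 - b) - C * t ^ 2))) (by fun_prop) (by simp),
      ev (fun t => -(t * (-a + t * (A / 2) - C * t ^ 2))) (by fun_prop) (by simp)]
      with t ht0 h1 h2 h3 h4
    exact ⟨ht0, h1.le, h2.le, by linarith, by linarith⟩
  have expansion : ∀ᶠ t in nhdsWithin (0 : ℝ) (Set.Ioi 0),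
      A - b - 2 * C * t + (a + t * (A / 2 - b) - C * t ^ 2) * (-a + t * (A / 2) - C * t ^ 2) ≤ 0 := by
    filter_upwards [h, small] with t hle ⟨ht0, ht1, htK, hP, hQ⟩
    have hPle : 1 + t * (a + t * (A / 2 - b) - C * t ^ 2) ≤ ∫ x, exp (t * g x - t ^ 2 * d x) ∂μ := by
      have eq : ∫ x, (1 + t * g x + t ^ 2 / 2 * g x ^ 2 - t ^ 2 * d x - C * t ^ 3) ∂μ =
          1 + t * (a + t * (A / 2 - b) - C * t ^ 2) := by
        rw [integral_sub (by fun_prop) (by fun_prop), integral_sub (by fun_prop) (by fun_prop),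
          integral_add (by fun_prop) (by fun_prop), integral_add (by fun_prop) (by fun_prop)]
        simp only [integral_const_mul, integral_const, probReal_univ, smul_eq_mul]
        ring
      rw [← eq]
      have bd : ∀ x, |t * g x - t ^ 2 * d x| ≤ 2 * K * t := fun x => by
        have h1 := mul_le_mul_of_nonneg_left (hgK x) ht0.le
        have h2 := mul_le_mul_of_nonneg_left (hdK x) (sq_nonneg t)
        calc |t * g x - t ^ 2 * d x| ≤ |t * g x| + |t ^ 2 * d x| := abs_sub _ _
          _ = t * |g x| + t ^ 2 * |d x| := by
            rw [abs_mul, abs_mul, abs_of_pos ht0, abs_of_nonneg (sq_nonneg t)]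
          _ ≤ 2 * K * t := by nlinarith [mul_nonneg hK0 ht0.le]
      refine integral_mono (by fun_prop) (int (by fun_prop) (exp 1) fun x => ?_) fun x => ?_
      · rw [abs_of_pos (exp_pos _)]
        exact exp_le_exp.2 ((le_abs_self _).trans ((bd x).trans htK))
      · refine le_trans ?_ (Real.quadratic_sub_cube_le_exp ((bd x).trans htK))
        have h3 : |t * g x - t ^ 2 * d x| ^ 3 ≤ (2 * K * t) ^ 3 :=
          pow_le_pow_left₀ (abs_nonneg _) (bd x) 3
        have h4 : g x * d x ≤ K ^ 2 := by
          rw [sq]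
          exact (le_abs_self _).trans ((abs_mul _ _).trans_le
            (mul_le_mul (hgK x) (hdK x) (abs_nonneg _) hK0))
        have h5 := mul_le_mul_of_nonneg_left h4 (pow_nonneg ht0.le 3)
        have h6 : 0 ≤ t ^ 4 * d x ^ 2 := by positivity
        simp only [C]
        nlinarith
    have hQle : 1 + t * (-a + t * (A / 2) - C * t ^ 2) ≤ ∫ x, exp (-(t * g x)) ∂μ := by
      have eq : ∫ x, (1 - t * g x + t ^ 2 / 2 * g x ^ 2 - C * t ^ 3) ∂μ =
          1 + t * (-a + t * (A / 2) - C * t ^ 2) := by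
        rw [integral_sub (by fun_prop) (by fun_prop), integral_add (by fun_prop) (by fun_prop),
          integral_sub (by fun_prop) (by fun_prop)]
        simp only [integral_const_mul, integral_const, probReal_univ, smul_eq_mul]
        ring
      rw [← eq]
      have bd : ∀ x, |-(t * g x)| ≤ 2 * K * t := fun x => by
        rw [abs_neg, abs_mul, abs_of_pos ht0]
        nlinarith [mul_le_mul_of_nonneg_left (hgK x) ht0.le, mul_nonneg hK0 ht0.le]
      refine integral_mono (by fun_prop) (int (by fun_prop) (exp 1) fun x => ?_) fun x => ?_
      · rw [abs_of_pos (exp_pos _)]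
        exact exp_le_exp.2 ((le_abs_self _).trans ((bd x).trans htK))
      · refine le_trans ?_ (Real.quadratic_sub_cube_le_exp ((bd x).trans htK))
        have h3 : |-(t * g x)| ^ 3 ≤ (2 * K * t) ^ 3 := pow_le_pow_left₀ (abs_nonneg _) (bd x) 3
        have h4 : 0 ≤ K ^ 2 * t ^ 3 := by positivity
        simp only [C]
        nlinarith
    have hPQ := (mul_le_mul hPle hQle hQ (hP.trans hPle)).trans hle
    refine nonpos_of_mul_nonpos_right (a := t ^ 2) ?_ (by positivity)
    linarith
  have lim : Filter.Tendsto (fun t : ℝ => A - b - 2 * C * t +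
      (a + t * (A / 2 - b) - C * t ^ 2) * (-a + t * (A / 2) - C * t ^ 2))
      (nhdsWithin 0 (Set.Ioi 0)) (nhds (A - b - a ^ 2)) := by
    have : Continuous (fun t : ℝ => A - b - 2 * C * t +
      (a + t * (A / 2 - b) - C * t ^ 2) * (-a + t * (A / 2) - C * t ^ 2)) := by fun_prop
    refine (this.tendsto' 0 _ ?_).mono_left nhdsWithin_le_nhds
    ring
  have := le_of_tendsto lim expansion
  linarith

section Convexity

variable {E : Type*} [NormedAddCommGroup E] [InnerProductSpace ℝ E]

/-- The midpoint form of uniform convexity. -/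
theorem two_mul_add_le_of_le_fderiv_fderiv {R : ℝ} {U : E → ℝ} (hU : ContDiff ℝ 2 U)
    (hHess : ∀ x v, R * ‖v‖ ^ 2 ≤ fderiv ℝ (fderiv ℝ U) x v v) (x y : E) :
    2 * U ((2⁻¹ : ℝ) • (x + y)) + R / 4 * ‖y - x‖ ^ 2 ≤ U x + U y := by
  set m : E := (2⁻¹ : ℝ) • (x + y)
  set v : E := (2⁻¹ : ℝ) • (y - x)
  have hU' : Differentiable ℝ U := hU.differentiable (by norm_num)
  have hU'' : Differentiable ℝ (fderiv ℝ U) :=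
    (hU.fderiv_right (m := 1) (by norm_num)).differentiable (by norm_num)
  have hline : ∀ t : ℝ, HasDerivAt (fun t : ℝ => m + t • v) v t := fun t => by
    simpa using ((hasDerivAt_id t).smul_const v).const_add m
  have h₁ : ∀ t : ℝ, HasDerivAt (fun t : ℝ => U (m + t • v) - R * ‖v‖ ^ 2 / 2 * t ^ 2)
      (fderiv ℝ U (m + t • v) v - R * ‖v‖ ^ 2 * t) t := fun t => by
    have := ((hU' _).hasFDerivAt.comp_hasDerivAt t (hline t)).sub
      ((hasDerivAt_pow 2 t).const_mul (R * ‖v‖ ^ 2 / 2))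
    convert! this using 1
    norm_num
    ring
  have h₂ : ∀ t : ℝ, HasDerivAt (fun t : ℝ => fderiv ℝ U (m + t • v) v - R * ‖v‖ ^ 2 * t)
      (fderiv ℝ (fderiv ℝ U) (m + t • v) v v - R * ‖v‖ ^ 2) t := fun t => by
    have := (((hU'' _).hasFDerivAt.comp_hasDerivAt t (hline t)).clm_apply
      (hasDerivAt_const t v)).sub ((hasDerivAt_id t).const_mul (R * ‖v‖ ^ 2))
    convert! this using 1
    simp
  have hd₁ := funext fun t => (h₁ t).deriv
  have hconv : ConvexOn ℝ Set.univ (fun t : ℝ => U (m + t • v) - R * ‖v‖ ^ 2 / 2 * t ^ 2) := by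
    refine convexOn_of_deriv2_nonneg' convex_univ
      (fun t _ => (h₁ t).differentiableAt.differentiableWithinAt) ?_ fun t _ => ?_
    · rw [hd₁]
      exact fun t _ => (h₂ t).differentiableAt.differentiableWithinAt
    · rw [Function.iterate_succ, Function.iterate_one, Function.comp_apply, hd₁, (h₂ t).deriv]
      linarith [hHess (m + t • v) v]
  have key := hconv.2 (Set.mem_univ (-1)) (Set.mem_univ 1)
    (by norm_num : (0 : ℝ) ≤ 2⁻¹) (by norm_num : (0 : ℝ) ≤ 2⁻¹) (by norm_num)
  have hx : m + (-1 : ℝ) • v = x := by simp only [m, v]; module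
  have hy : m + (1 : ℝ) • v = y := by simp only [m, v]; module
  have hv : ‖v‖ ^ 2 = ‖y - x‖ ^ 2 / 4 := by
    simp only [v, norm_smul, mul_pow]
    norm_num
    ring
  simp only [hx, hy, hv, smul_eq_mul] at key
  norm_num at key
  linarith

theorem abs_sub_sub_fderiv_le_of_norm_fderiv_fderiv_le {g : E → ℝ} (hg : ContDiff ℝ 2 g) {M : ℝ}
    (hM : ∀ x, ‖fderiv ℝ (fderiv ℝ g) x‖ ≤ M) (x y : E) :
    |g y - g x - fderiv ℝ g x (y - x)| ≤ M * ‖y - x‖ ^ 2 := by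
  have hg' : Differentiable ℝ g := hg.differentiable (by norm_num)
  have hg'' : Differentiable ℝ (fderiv ℝ g) :=
    (hg.fderiv_right (m := 1) (by norm_num)).differentiable (by norm_num)
  have hM0 : 0 ≤ M := le_trans (by positivity) (hM x)
  have := (convex_segment x y).norm_image_sub_le_of_norm_fderiv_le' (𝕜 := ℝ) (f := g)
    (φ := fderiv ℝ g x) (C := M * ‖y - x‖) (fun z _ => hg' z) (fun z hz => by
      refine (convex_univ.norm_image_sub_le_of_norm_fderiv_le (𝕜 := ℝ) (fun w _ => hg'' w)
        (fun w _ => hM w) (Set.mem_univ x) (Set.mem_univ z)).trans ?_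
      gcongr
      obtain ⟨s, ⟨hs0, hs1⟩, rfl⟩ := segment_eq_image' ℝ x y ▸ hz
      rw [add_sub_cancel_left, norm_smul, Real.norm_of_nonneg hs0]
      exact mul_le_of_le_one_left (norm_nonneg _) hs1)
    (left_mem_segment ℝ x y) (right_mem_segment ℝ x y)
  rw [sq, ← mul_assoc]
  exact this

/-- The pointwise bound that makes `e ^ (g - ‖g'‖² / c - U)`, `e ^ (-g - U)`, `e ^ (-U)`
admissible in the Prékopa–Leindler inequality. -/
theorem sub_sq_div_sub_le_of_le_fderiv_fderiv {R : ℝ} {U : E → ℝ} (hU : ContDiff ℝ 2 U)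
    (hHess : ∀ x v, R * ‖v‖ ^ 2 ≤ fderiv ℝ (fderiv ℝ U) x v v) {g : E → ℝ} (hg : ContDiff ℝ 2 g)
    {M : ℝ} (hM : ∀ x, ‖fderiv ℝ (fderiv ℝ g) x‖ ≤ M) {t c : ℝ} (ht : 0 ≤ t) (hc : 0 < c)
    (htc : c + 4 * (t * M) ≤ R) (x y : E) :
    (t * g x - t ^ 2 * (‖fderiv ℝ g x‖ ^ 2 / c) - U x) + (-(t * g y) - U y) ≤
      2 * -U ((2⁻¹ : ℝ) • (x + y)) := by
  have h₁ := two_mul_add_le_of_le_fderiv_fderiv hU hHess x y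
  have h₂ := (abs_le.1 (abs_sub_sub_fderiv_le_of_norm_fderiv_fderiv_le hg hM x y)).1
  have h₃ := (abs_le.1 ((fderiv ℝ g x).le_opNorm (y - x))).1
  set r := ‖y - x‖
  set N := ‖fderiv ℝ g x‖
  have h₄ : t * (g x - g y) ≤ t * (N * r + M * r ^ 2) :=
    mul_le_mul_of_nonneg_left (by linarith) ht
  have h₅ : t * (N * r) ≤ c / 4 * r ^ 2 + t ^ 2 * (N ^ 2 / c) := by
    have : 0 ≤ (c * r / 2 - t * N) ^ 2 / c := by positivity
    have e : (c * r / 2 - t * N) ^ 2 / c = c / 4 * r ^ 2 + t ^ 2 * (N ^ 2 / c) - t * (N * r) := by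
      field_simp
      ring
    linarith
  have h₆ := mul_le_mul_of_nonneg_right htc (sq_nonneg r)
  linarith

end Convexity

/-- A form of Maurey's property (τ) for the measure with density `e ^ (-U)`. -/
theorem integral_exp_mul_integral_exp_le_one {n : ℕ} {U p q : EuclideanSpace ℝ (Fin n) → ℝ}
    (hU : Measurable U) (hp : Measurable p) (hq : Measurable q)
    [IsProbabilityMeasure (volume.withDensity fun x => ENNReal.ofReal (exp (-U x)))]
    (h : ∀ x y, (p x - U x) + (q y - U y) ≤ 2 * -U ((2⁻¹ : ℝ) • (x + y))) :
    (∫ x, exp (p x) ∂volume.withDensity fun x => ENNReal.ofReal (exp (-U x))) *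
      ∫ x, exp (q x) ∂volume.withDensity (fun x => ENNReal.ofReal (exp (-U x))) ≤ 1 := by
  have toReal : ∀ {p : EuclideanSpace ℝ (Fin n) → ℝ}, Measurable p →
      ∫ x, exp (p x) ∂volume.withDensity (fun x => ENNReal.ofReal (exp (-U x))) =
        (∫⁻ x, ENNReal.ofReal (exp (p x - U x))).toReal := by
    intro p hp
    rw [integral_eq_lintegral_of_nonneg_ae (Filter.Eventually.of_forall fun x => (exp_pos _).le)
      (by fun_prop), lintegral_withDensity_eq_lintegral_mul _ (by fun_prop) (by fun_prop)]
    congr with x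
    rw [Pi.mul_apply, ← ENNReal.ofReal_mul (exp_pos _).le, ← exp_add, neg_add_eq_sub]
  have total : ∫⁻ x, ENNReal.ofReal (exp (-U x)) = 1 := by
    have := measure_univ (μ := volume.withDensity fun x => ENNReal.ofReal (exp (-U x)))
    rwa [withDensity_apply _ MeasurableSet.univ, Measure.restrict_univ] at this
  rw [toReal hp, toReal hq, ← ENNReal.toReal_mul]
  refine ENNReal.toReal_le_of_le_ofReal zero_le_one ?_
  rw [ENNReal.ofReal_one, ← one_pow 2, ← total]
  refine lintegral_mul_lintegral_le_sq (by fun_prop) (by fun_prop) (by fun_prop) fun x y => ?_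
  rw [← ENNReal.ofReal_mul (exp_pos _).le, ← ENNReal.ofReal_pow (exp_pos _).le, ← exp_add,
    ← exp_nat_mul]
  exact ENNReal.ofReal_le_ofReal (exp_le_exp.2 (h x y))

/-- Poincaré inequality for uniformly log-concave measures:
for `dμ = e^{-U} dx` with `Hess U ≥ R·Id`,
`∫ g² dμ − (∫ g dμ)² ≤ (1/R) ∫ ‖∇g‖² dμ`. -/
theorem stmt_9 (n : ℕ) (R : ℝ) (hR : 0 < R)
    (U : EuclideanSpace ℝ (Fin n) → ℝ) (hU : ContDiff ℝ (⊤ : ℕ∞) U)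
    (hHess : ∀ x v : EuclideanSpace ℝ (Fin n), R * ‖v‖ ^ 2 ≤ fderiv ℝ (fderiv ℝ U) x v v)
    (μ : Measure (EuclideanSpace ℝ (Fin n)))
    (hμ : μ = volume.withDensity (fun x => ENNReal.ofReal (Real.exp (-U x))))
    (hprob : IsProbabilityMeasure μ)
    (g : EuclideanSpace ℝ (Fin n) → ℝ)
    (hg : ContDiff ℝ (⊤ : ℕ∞) g)
    (hgd : ∀ i : ℕ, ∃ C : ℝ, ∀ x, ‖iteratedFDeriv ℝ i g x‖ ≤ C) :
    ∫ x, (g x) ^ 2 ∂μ - (∫ x, g x ∂μ) ^ 2 ≤ (1 / R) * ∫ x, ‖fderiv ℝ g x‖ ^ 2 ∂μ := by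
  have hU2 : ContDiff ℝ 2 U := contDiff_infty.1 hU 2
  have hg2 : ContDiff ℝ 2 g := contDiff_infty.1 hg 2
  have hgm : Measurable g := hg.continuous.measurable
  have hg'm : Measurable fun x => ‖fderiv ℝ g x‖ ^ 2 :=
    ((hg2.continuous_fderiv (by norm_num)).norm.pow 2).measurable
  obtain ⟨C₀, hC₀⟩ := hgd 0
  obtain ⟨C₁, hC₁⟩ := hgd 1
  obtain ⟨C₂, hC₂⟩ := hgd 2
  simp only [norm_iteratedFDeriv_zero, Real.norm_eq_abs] at hC₀
  simp only [norm_iteratedFDeriv_one] at hC₁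
  simp only [← norm_iteratedFDeriv_fderiv (n := 1), norm_iteratedFDeriv_one] at hC₂
  have key : ∀ c : ℝ, 0 < c → c < R →
      ∫ x, (g x) ^ 2 ∂μ - (∫ x, g x ∂μ) ^ 2 ≤ (∫ x, ‖fderiv ℝ g x‖ ^ 2 ∂μ) / c := by
    intro c hc hcR
    rw [← integral_div]
    refine integral_sq_sub_sq_integral_le_of_integral_exp_mul_le hgm (hg'm.div_const c)
      (K := max C₀ (C₁ ^ 2 / c)) (fun x => (hC₀ x).trans (le_max_left _ _)) (fun x => ?_) ?_
    · rw [abs_of_nonneg (by positivity)]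
      refine le_trans ?_ (le_max_right _ _)
      gcongr
      exact hC₁ x
    · have small : ∀ᶠ t in nhdsWithin (0 : ℝ) (Set.Ioi 0), c + 4 * (t * C₂) < R :=
        nhdsWithin_le_nhds <| (Continuous.continuousAt (by fun_prop)).eventually_lt_const (by simpa)
      filter_upwards [self_mem_nhdsWithin, small] with t ht htc
      subst hμ
      exact integral_exp_mul_integral_exp_le_one hU.continuous.measurable (by fun_prop)
        (by fun_prop)
        (sub_sq_div_sub_le_of_le_fderiv_fderiv hU2 hHess hg2 hC₂ (le_of_lt ht) hc htc.le)
  have lim : Filter.Tendsto (fun c => (∫ x, ‖fderiv ℝ g x‖ ^ 2 ∂μ) / c) (nhdsWithin R (Set.Iio R))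
      (nhds ((∫ x, ‖fderiv ℝ g x‖ ^ 2 ∂μ) / R)) :=
    (tendsto_const_nhds.div Filter.tendsto_id hR.ne').mono_left nhdsWithin_le_nhds
  rw [one_div_mul_eq_div]
  refine ge_of_tendsto lim ?_
  filter_upwards [Ioo_mem_nhdsLT hR] with c hc using key c hc.1 hc.2
end

section
/- Let R > 0 and let μ = e^{-U(x)} dx be a probability measure on ℝⁿ with U smooth and Hess U(x) ≥ R·Id for all x, and let 1 ≤ p ≤ 2. Then for every bounded smooth real-valued function f on ℝⁿ with bounded derivatives, ∫_{ℝⁿ} |f|² dμ − (∫_{ℝⁿ} |f|^p dμ)^{2/p} ≤ ((2−p)/R) ∫_{ℝⁿ} ‖∇f‖² dμ (the Beckner–Sobolev inequality for uniformly log-concave measures). -/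
open MeasureTheory Real

/-- `G` is three times continuously differentiable, its first two derivatives are bounded by
`A₁` and `A₂`, and its second derivative is `A₃`-Lipschitz. -/
structure HasDerivBounds {E F : Type*} [NormedAddCommGroup E] [NormedSpace ℝ E]
    [NormedAddCommGroup F] [NormedSpace ℝ F] (A₁ A₂ A₃ : ℝ) (G : E → F) : Prop where
  contDiff : ContDiff ℝ 3 G
  first : ∀ x, ‖fderiv ℝ G x‖ ≤ A₁
  second : ∀ x, ‖fderiv ℝ (fderiv ℝ G) x‖ ≤ A₂
  lip : ∀ x y, ‖fderiv ℝ (fderiv ℝ G) x - fderiv ℝ (fderiv ℝ G) y‖ ≤ A₃ * ‖x - y‖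

lemma norm_convex_combination_le {ι V : Type*} [Fintype ι] [SeminormedAddCommGroup V]
    [NormedSpace ℝ V] {w : ι → ℝ} (hw : ∀ j, 0 ≤ w j) (hw1 : ∑ j, w j = 1) {v : ι → V} {A : ℝ}
    (hv : ∀ j, ‖v j‖ ≤ A) : ‖∑ j, w j • v j‖ ≤ A :=
  calc ‖∑ j, w j • v j‖ ≤ ∑ j, w j * A := norm_sum_le_of_le _ fun j _ => by
          rw [norm_smul, norm_of_nonneg (hw j)]
          exact mul_le_mul_of_nonneg_left (hv j) (hw j)
    _ = A := by rw [← Finset.sum_mul, hw1, one_mul]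

namespace HasDerivBounds

variable {E F : Type*} [NormedAddCommGroup E] [NormedSpace ℝ E]
  [NormedAddCommGroup F] [NormedSpace ℝ F] {A₁ A₂ A₃ : ℝ}

section General

variable {G : E → F}

lemma contDiff_fderiv (hG : HasDerivBounds A₁ A₂ A₃ G) : ContDiff ℝ 2 (fderiv ℝ G) :=
  hG.contDiff.fderiv_right (by norm_num)

lemma differentiable (hG : HasDerivBounds A₁ A₂ A₃ G) : Differentiable ℝ G :=
  hG.contDiff.differentiable (by norm_num)

lemma differentiable_fderiv (hG : HasDerivBounds A₁ A₂ A₃ G) :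
    Differentiable ℝ (fderiv ℝ G) :=
  hG.contDiff_fderiv.differentiable (by norm_num)

lemma continuous_fderiv_fderiv (hG : HasDerivBounds A₁ A₂ A₃ G) :
    Continuous (fderiv ℝ (fderiv ℝ G)) :=
  hG.contDiff_fderiv.continuous_fderiv (by norm_num)

lemma first_nonneg (hG : HasDerivBounds A₁ A₂ A₃ G) : 0 ≤ A₁ :=
  (norm_nonneg _).trans (hG.first 0)

lemma second_nonneg (hG : HasDerivBounds A₁ A₂ A₃ G) : 0 ≤ A₂ :=
  (norm_nonneg (fderiv ℝ (fderiv ℝ G) 0)).trans (hG.second 0)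

lemma norm_sub_le (hG : HasDerivBounds A₁ A₂ A₃ G) (x y : E) :
    ‖G x - G y‖ ≤ A₁ * ‖x - y‖ :=
  convex_univ.norm_image_sub_le_of_norm_fderiv_le (fun z _ => hG.differentiable z)
    (fun z _ => hG.first z) (Set.mem_univ y) (Set.mem_univ x)

lemma norm_fderiv_sub_le (hG : HasDerivBounds A₁ A₂ A₃ G) (x y : E) :
    ‖fderiv ℝ G x - fderiv ℝ G y‖ ≤ A₂ * ‖x - y‖ :=
  convex_univ.norm_image_sub_le_of_norm_fderiv_le (fun z _ => hG.differentiable_fderiv z)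
    (fun z _ => hG.second z) (Set.mem_univ y) (Set.mem_univ x)

lemma mono (hG : HasDerivBounds A₁ A₂ A₃ G) {B₁ B₂ B₃ : ℝ} (h₁ : A₁ ≤ B₁) (h₂ : A₂ ≤ B₂)
    (h₃ : A₃ ≤ B₃) : HasDerivBounds B₁ B₂ B₃ G where
  contDiff := hG.contDiff
  first x := (hG.first x).trans h₁
  second x := (hG.second x).trans h₂
  lip x y := (hG.lip x y).trans (by gcongr)

/-- Convex combinations preserve derivative bounds. -/
lemma sum {ι : Type*} [Fintype ι] {w : ι → ℝ} (hw : ∀ j, 0 ≤ w j) (hw1 : ∑ j, w j = 1)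
    {H : ι → E → F} (hH : ∀ j, HasDerivBounds A₁ A₂ A₃ (H j)) :
    HasDerivBounds A₁ A₂ A₃ (fun x => ∑ j, w j • H j x) := by
  have h1 : fderiv ℝ (fun x => ∑ j, w j • H j x) = fun x => ∑ j, w j • fderiv ℝ (H j) x := by
    ext1 x
    rw [fderiv_fun_sum (A := fun j x => w j • H j x)
      fun j _ => ((hH j).differentiable x).const_smul (w j)]
    exact Finset.sum_congr rfl fun j _ => fderiv_fun_const_smul ((hH j).differentiable x) _
  have h2 : fderiv ℝ (fderiv ℝ (fun x => ∑ j, w j • H j x)) =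
      fun x => ∑ j, w j • fderiv ℝ (fderiv ℝ (H j)) x := by
    rw [h1]
    ext1 x
    rw [fderiv_fun_sum (A := fun j x => w j • fderiv ℝ (H j) x)
      fun j _ => ((hH j).differentiable_fderiv x).const_smul (w j)]
    exact Finset.sum_congr rfl fun j _ => fderiv_fun_const_smul ((hH j).differentiable_fderiv x) _
  refine ⟨ContDiff.sum fun j _ => contDiff_const.smul (hH j).contDiff, fun x => ?_, fun x => ?_,
    fun x y => ?_⟩
  · rw [h1]
    exact norm_convex_combination_le hw hw1 fun j => (hH j).first x
  · rw [h2]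
    exact norm_convex_combination_le hw hw1 (v := fun j => fderiv ℝ (fderiv ℝ (H j)) x)
      fun j => (hH j).second x
  · rw [h2]
    have e : ∑ j, w j • fderiv ℝ (fderiv ℝ (H j)) x - ∑ j, w j • fderiv ℝ (fderiv ℝ (H j)) y =
        ∑ j, w j • (fderiv ℝ (fderiv ℝ (H j)) x - fderiv ℝ (fderiv ℝ (H j)) y) := by
      rw [← Finset.sum_sub_distrib]
      exact Finset.sum_congr rfl fun j _ => (smul_sub _ _ _).symm
    change ‖∑ j, w j • fderiv ℝ (fderiv ℝ (H j)) x -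
      ∑ j, w j • fderiv ℝ (fderiv ℝ (H j)) y‖ ≤ _
    rw [e]
    exact norm_convex_combination_le hw hw1
      (v := fun j => fderiv ℝ (fderiv ℝ (H j)) x - fderiv ℝ (fderiv ℝ (H j)) y)
      fun j => (hH j).lip x y

end General

/-- Derivative bounds of a composition with an almost affine contraction. -/
lemma comp {G : E → F} (hG : HasDerivBounds A₁ A₂ A₃ G) {a : ℝ} {T : E → E}
    (hT : HasDerivBounds 1 a a T) (ha3 : 0 ≤ A₃) :
    HasDerivBounds A₁ (A₂ + a * A₁) (A₃ + a * (3 * A₂ + A₁)) (fun x => G (T x)) := by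
  have ha : 0 ≤ a := hT.second_nonneg
  have hA1 := hG.first_nonneg
  have hA2 := hG.second_nonneg
  have h1 : fderiv ℝ (fun x => G (T x)) = fun x => (fderiv ℝ G (T x)).comp (fderiv ℝ T x) := by
    ext1 x
    exact fderiv_comp x (hG.differentiable _) (hT.differentiable x)
  have h2 : ∀ x v u, fderiv ℝ (fderiv ℝ (fun x => G (T x))) x v u =
      fderiv ℝ (fderiv ℝ G) (T x) (fderiv ℝ T x v) (fderiv ℝ T x u) +
        fderiv ℝ G (T x) (fderiv ℝ (fderiv ℝ T) x v u) := by
    intro x v u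
    have hc : HasFDerivAt (fun x => fderiv ℝ G (T x))
        ((fderiv ℝ (fderiv ℝ G) (T x)).comp (fderiv ℝ T x)) x :=
      (hG.differentiable_fderiv (T x)).hasFDerivAt.comp x (hT.differentiable x).hasFDerivAt
    have hd := (hT.differentiable_fderiv x).hasFDerivAt
    rw [h1, (hc.clm_comp hd).fderiv]
    simp [add_comm]
  have bT : ∀ x v, ‖fderiv ℝ T x v‖ ≤ ‖v‖ := fun x v => by
    simpa using (fderiv ℝ T x).le_of_opNorm_le (hT.first x) v
  have bT2 : ∀ x v u, ‖fderiv ℝ (fderiv ℝ T) x v u‖ ≤ a * ‖v‖ * ‖u‖ := fun x v u =>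
    (fderiv ℝ (fderiv ℝ T) x).le_of_opNorm₂_le_of_le (hT.second x) le_rfl le_rfl
  have bG2 : ∀ x v u, ‖fderiv ℝ (fderiv ℝ G) x v u‖ ≤ A₂ * ‖v‖ * ‖u‖ := fun x v u =>
    (fderiv ℝ (fderiv ℝ G) x).le_of_opNorm₂_le_of_le (hG.second x) le_rfl le_rfl
  have bG1 : ∀ x v, ‖fderiv ℝ G x v‖ ≤ A₁ * ‖v‖ := fun x v =>
    (fderiv ℝ G x).le_of_opNorm_le (hG.first x) v
  refine ⟨hG.contDiff.comp hT.contDiff, fun x => ?_, fun x => ?_, fun x y => ?_⟩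
  · rw [h1]
    calc _ ≤ ‖fderiv ℝ G (T x)‖ * ‖fderiv ℝ T x‖ := ContinuousLinearMap.opNorm_comp_le _ _
      _ ≤ A₁ * 1 := by gcongr; exacts [hG.first _, hT.first x]
      _ = A₁ := mul_one _
  · refine ContinuousLinearMap.opNorm_le_bound₂ _ (by positivity) fun v u => ?_
    rw [h2]
    calc _ ≤ A₂ * ‖fderiv ℝ T x v‖ * ‖fderiv ℝ T x u‖ +
            A₁ * ‖fderiv ℝ (fderiv ℝ T) x v u‖ := norm_add_le_of_le (bG2 _ _ _) (bG1 _ _)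
      _ ≤ A₂ * ‖v‖ * ‖u‖ + A₁ * (a * ‖v‖ * ‖u‖) := by gcongr <;> apply_rules
      _ = _ := by ring
  · refine ContinuousLinearMap.opNorm_le_bound₂ _ (by positivity) fun v u => ?_
    rw [sub_apply, sub_apply, h2, h2]
    have e : fderiv ℝ (fderiv ℝ G) (T x) (fderiv ℝ T x v) (fderiv ℝ T x u) +
          fderiv ℝ G (T x) (fderiv ℝ (fderiv ℝ T) x v u) -
        (fderiv ℝ (fderiv ℝ G) (T y) (fderiv ℝ T y v) (fderiv ℝ T y u) +
          fderiv ℝ G (T y) (fderiv ℝ (fderiv ℝ T) y v u)) =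
        (fderiv ℝ (fderiv ℝ G) (T x) - fderiv ℝ (fderiv ℝ G) (T y))
            (fderiv ℝ T x v) (fderiv ℝ T x u) +
        fderiv ℝ (fderiv ℝ G) (T y) ((fderiv ℝ T x - fderiv ℝ T y) v) (fderiv ℝ T x u) +
        fderiv ℝ (fderiv ℝ G) (T y) (fderiv ℝ T y v) ((fderiv ℝ T x - fderiv ℝ T y) u) +
        (fderiv ℝ G (T x) - fderiv ℝ G (T y)) (fderiv ℝ (fderiv ℝ T) x v u) +
        fderiv ℝ G (T y) ((fderiv ℝ (fderiv ℝ T) x - fderiv ℝ (fderiv ℝ T) y) v u) := by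
      simp only [sub_apply, map_sub]
      abel
    have hTT : ‖T x - T y‖ ≤ ‖x - y‖ := by simpa using hT.norm_sub_le x y
    have hDT : ∀ v, ‖(fderiv ℝ T x - fderiv ℝ T y) v‖ ≤ a * ‖x - y‖ * ‖v‖ := fun v =>
      ContinuousLinearMap.le_of_opNorm_le _ (hT.norm_fderiv_sub_le x y) v
    have hDDT : ‖(fderiv ℝ (fderiv ℝ T) x - fderiv ℝ (fderiv ℝ T) y) v u‖ ≤
        a * ‖x - y‖ * ‖v‖ * ‖u‖ :=
      ContinuousLinearMap.le_of_opNorm₂_le_of_le _ (hT.lip x y) le_rfl le_rfl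
    have hDG : ∀ z, ‖(fderiv ℝ G (T x) - fderiv ℝ G (T y)) z‖ ≤ A₂ * ‖x - y‖ * ‖z‖ := fun z =>
      ContinuousLinearMap.le_of_opNorm_le _
        ((hG.norm_fderiv_sub_le _ _).trans (by gcongr)) z
    have hDDG : ∀ v u, ‖(fderiv ℝ (fderiv ℝ G) (T x) - fderiv ℝ (fderiv ℝ G) (T y)) v u‖ ≤
        A₃ * ‖x - y‖ * ‖v‖ * ‖u‖ := fun v u =>
      ContinuousLinearMap.le_of_opNorm₂_le_of_le _
        ((hG.lip _ _).trans (by gcongr)) le_rfl le_rfl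
    rw [e]
    calc _ ≤ A₃ * ‖x - y‖ * ‖fderiv ℝ T x v‖ * ‖fderiv ℝ T x u‖ +
            A₂ * ‖(fderiv ℝ T x - fderiv ℝ T y) v‖ * ‖fderiv ℝ T x u‖ +
            A₂ * ‖fderiv ℝ T y v‖ * ‖(fderiv ℝ T x - fderiv ℝ T y) u‖ +
            A₂ * ‖x - y‖ * ‖fderiv ℝ (fderiv ℝ T) x v u‖ +
            A₁ * ‖(fderiv ℝ (fderiv ℝ T) x - fderiv ℝ (fderiv ℝ T) y) v u‖ := by
          refine norm_add_le_of_le (norm_add_le_of_le (norm_add_le_of_le (norm_add_le_of_le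
            ?_ ?_) ?_) ?_) ?_ <;> apply_rules
      _ ≤ A₃ * ‖x - y‖ * ‖v‖ * ‖u‖ + A₂ * (a * ‖x - y‖ * ‖v‖) * ‖u‖ +
            A₂ * ‖v‖ * (a * ‖x - y‖ * ‖u‖) + A₂ * ‖x - y‖ * (a * ‖v‖ * ‖u‖) +
            A₁ * (a * ‖x - y‖ * ‖v‖ * ‖u‖) := by gcongr <;> apply_rules
      _ = _ := by ring

/-- Second order Taylor expansion. -/
lemma taylor {G : E → F} (hG : HasDerivBounds A₁ A₂ A₃ G) (ha3 : 0 ≤ A₃) (x d : E) :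
    ‖G (x + d) - G x - fderiv ℝ G x d - (1 / 2 : ℝ) • fderiv ℝ (fderiv ℝ G) x d d‖ ≤
      A₃ * ‖d‖ ^ 3 := by
  have h1 : ∀ v : E, ‖v‖ ≤ ‖d‖ →
      ‖fderiv ℝ G (x + v) - fderiv ℝ G x - fderiv ℝ (fderiv ℝ G) x v‖ ≤ A₃ * ‖d‖ * ‖d‖ := by
    intro v hv
    have := (convex_closedBall x ‖d‖).norm_image_sub_le_of_norm_fderiv_le' (𝕜 := ℝ)
      (f := fderiv ℝ G) (φ := fderiv ℝ (fderiv ℝ G) x) (C := A₃ * ‖d‖) (x := x) (y := x + v)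
      (fun z _ => hG.differentiable_fderiv z)
      (fun z hz => (hG.lip z x).trans (by
        gcongr
        simpa [dist_eq_norm] using hz)) (by simp) (by simpa using hv)
    rw [add_sub_cancel_left] at this
    exact this.trans (by gcongr)
  have hline : ∀ t : ℝ, HasDerivAt (fun t : ℝ => x + t • d) d t := fun t => by
    simpa using ((hasDerivAt_id t).smul_const d).const_add x
  have hder : ∀ t : ℝ, HasDerivAt (fun t : ℝ => G (x + t • d) - t • fderiv ℝ G x d -
      (t ^ 2 / 2) • fderiv ℝ (fderiv ℝ G) x d d)
      ((fderiv ℝ G (x + t • d) - fderiv ℝ G x - fderiv ℝ (fderiv ℝ G) x (t • d)) d) t := by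
    intro t
    have e1 := (hG.differentiable (x + t • d)).hasFDerivAt.comp_hasDerivAt t (hline t)
    have e2 := (hasDerivAt_id t).smul_const (fderiv ℝ G x d)
    have e3 := (((hasDerivAt_id t).pow 2).div_const 2).smul_const (fderiv ℝ (fderiv ℝ G) x d d)
    have := (e1.sub e2).sub e3
    refine this.congr_deriv ?_
    simp
  have := norm_image_sub_le_of_norm_deriv_le_segment_01' (C := A₃ * ‖d‖ ^ 3)
    (fun t _ => (hder t).hasDerivWithinAt) (fun t ht => by
      refine (ContinuousLinearMap.le_of_opNorm_le _ (h1 (t • d) ?_) d).trans_eq (by ring)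
      rw [norm_smul, norm_of_nonneg ht.1]
      exact mul_le_of_le_one_left (norm_nonneg _) ht.2.le)
  refine le_trans (le_of_eq ?_) this
  congr 1
  simp
  abel

end HasDerivBounds

section Euler

variable {E : Type*} [NormedAddCommGroup E] [InnerProductSpace ℝ E]
  {κ ι : Type*} [Fintype κ] [Fintype ι]

/-- A finitely supported centred random vector with values `ζ j` of weight `w j`, bounded by `z`,
whose covariance is twice the identity. -/
structure IsNoise (e : OrthonormalBasis κ ℝ E) (w : ι → ℝ) (ζ : ι → E) (z : ℝ) : Prop where
  nonneg : ∀ j, 0 ≤ w j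
  sum_eq_one : ∑ j, w j = 1
  mean : ∑ j, w j • ζ j = 0
  cov : ∀ B : E →L[ℝ] E →L[ℝ] ℝ, ∑ j, w j * B (ζ j) (ζ j) = 2 * ∑ i, B (e i) (e i)
  bound : ∀ j, ‖ζ j‖ ≤ z

lemma exists_isNoise (e : OrthonormalBasis κ ℝ E) :
    ∃ (w : Option (κ × Bool) → ℝ) (ζ : Option (κ × Bool) → E) (z : ℝ), 0 ≤ z ∧
      IsNoise e w ζ z := by
  rcases isEmpty_or_nonempty κ with hκ | hκ
  · refine ⟨fun _ => 1, fun _ => 0, 0, le_rfl, fun _ => zero_le_one, ?_, by simp, ?_, by simp⟩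
    · simp
    · intro B
      simp
  · have hN : (0 : ℝ) < Fintype.card κ := by exact_mod_cast Fintype.card_pos
    refine ⟨fun o => o.elim 0 fun _ => 1 / (2 * Fintype.card κ),
      fun o => o.elim 0 fun s => (if s.2 then √(2 * Fintype.card κ) else -√(2 * Fintype.card κ)) •
        e s.1, √(2 * Fintype.card κ), sqrt_nonneg _, ?_, ?_, ?_, ?_, ?_⟩
    · rintro (_ | s) <;> simp
    · simp
      field_simp
    · simp [Fintype.sum_prod_type]
    · intro B
      simp only [Fintype.sum_option, Fintype.sum_prod_type, Option.elim_none, Option.elim_some,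
        Fintype.sum_bool, map_smul, smul_apply, smul_eq_mul, map_zero, Finset.mul_sum]
      have := Real.mul_self_sqrt (show (0 : ℝ) ≤ 2 * Fintype.card κ by positivity)
      simp only [mul_zero, zero_add]
      refine Finset.sum_congr rfl fun i _ => ?_
      simp only [if_true, Bool.false_eq_true, if_false]
      field_simp
      linear_combination (2 * B (e i) (e i)) * this
    · rintro (_ | ⟨i, s⟩)
      · simp
      · cases s <;> simp [norm_smul, abs_of_nonneg]

/-- A strongly monotone vector field with bounded derivatives. -/
structure IsDrift (R m : ℝ) (b : E → E) : Prop where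
  bounds : HasDerivBounds m m m b
  mono : ∀ x y, R * ‖x - y‖ ^ 2 ≤ inner ℝ (b x - b y) (x - y)
  le : R ≤ m

/-- One step of the Euler scheme for the diffusion with drift `-b`, acting on functions. -/
noncomputable def eulerStep (w : ι → ℝ) (ζ : ι → E) (b : E → E) (h : ℝ) (G : E → ℝ) (x : E) : ℝ :=
  ∑ j, w j • G (x - h • b x + √h • ζ j)

variable {e : OrthonormalBasis κ ℝ E} {w : ι → ℝ} {ζ : ι → E} {z : ℝ} {R m h : ℝ} {b : E → E}

lemma IsDrift.factor_nonneg (hb : IsDrift R m b) (hR : 0 ≤ R) :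
    0 ≤ 1 - 2 * h * R + h ^ 2 * m ^ 2 := by
  have : R ^ 2 ≤ m ^ 2 := pow_le_pow_left₀ hR hb.le 2
  nlinarith [sq_nonneg (1 - h * R), mul_le_mul_of_nonneg_left this (sq_nonneg h)]

lemma IsDrift.lipschitz_step (hb : IsDrift R m b) (hh : 0 ≤ h) (c x y : E) :
    ‖(x - h • b x + c) - (y - h • b y + c)‖ ≤ √(1 - 2 * h * R + h ^ 2 * m ^ 2) * ‖x - y‖ := by
  have e1 : (x - h • b x + c) - (y - h • b y + c) = (x - y) - h • (b x - b y) := by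
    rw [smul_sub]; abel
  rw [e1, ← Real.sqrt_sq (norm_nonneg (x - y)), ← Real.sqrt_mul' _ (sq_nonneg _)]
  apply Real.le_sqrt_of_sq_le
  rw [norm_sub_sq_real, real_inner_smul_right, real_inner_comm, norm_smul, norm_of_nonneg hh]
  have h1 := mul_le_mul_of_nonneg_left (hb.mono x y) hh
  have h2 := pow_le_pow_left₀ (norm_nonneg _) (hb.bounds.norm_sub_le x y) 2
  have h3 := mul_le_mul_of_nonneg_left h2 (sq_nonneg h)
  nlinarith

lemma IsDrift.norm_fderiv_step_le (hb : IsDrift R m b) (hh : 0 ≤ h) (c x : E) :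
    ‖fderiv ℝ (fun x => x - h • b x + c) x‖ ≤ √(1 - 2 * h * R + h ^ 2 * m ^ 2) := by
  have := norm_fderiv_le_of_lipschitz ℝ (f := fun x => x - h • b x + c) (x₀ := x)
    (C := ⟨√(1 - 2 * h * R + h ^ 2 * m ^ 2), sqrt_nonneg _⟩) (LipschitzWith.of_dist_le_mul
      fun x y => by
        rw [dist_eq_norm, dist_eq_norm]
        exact hb.lipschitz_step hh c x y)
  exact this

lemma IsDrift.hasDerivBounds_step (hb : IsDrift R m b) (hh : 0 ≤ h) (hm : h * m ^ 2 ≤ 2 * R)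
    (c : E) : HasDerivBounds 1 (h * m) (h * m) (fun x => x - h • b x + c) := by
  have h1 : fderiv ℝ (fun x => x - h • b x + c) =
      fun x => ContinuousLinearMap.id ℝ E - h • fderiv ℝ b x := by
    ext1 x
    have := ((hasFDerivAt_id x).sub
      ((hb.bounds.differentiable x).hasFDerivAt.const_smul h)).add_const c
    exact this.fderiv
  have h2 : fderiv ℝ (fderiv ℝ (fun x => x - h • b x + c)) =
      fun x => - (h • fderiv ℝ (fderiv ℝ b) x) := by
    rw [h1]
    ext1 x
    have := ((hb.bounds.differentiable_fderiv x).hasFDerivAt.const_smul h).const_sub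
      (ContinuousLinearMap.id ℝ E)
    exact this.fderiv
  have h3 : ∀ B : E →L[ℝ] E →L[ℝ] E, ‖-(h • B)‖ ≤ h * ‖B‖ := fun B =>
    (norm_neg (h • B)).trans_le ((ContinuousLinearMap.opNorm_smul_le h B).trans_eq
      (by rw [norm_of_nonneg hh]))
  refine ⟨?_, fun x => ?_, fun x => ?_, fun x y => ?_⟩
  · exact (contDiff_id.sub (contDiff_const.smul hb.bounds.contDiff)).add contDiff_const
  · refine (hb.norm_fderiv_step_le hh c x).trans ?_
    rw [Real.sqrt_le_one]
    nlinarith [mul_le_mul_of_nonneg_left hm hh]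
  · rw [h2]
    exact (h3 _).trans (mul_le_mul_of_nonneg_left (hb.bounds.second x) hh)
  · rw [h2]
    have e1 : -(h • fderiv ℝ (fderiv ℝ b) x) - -(h • fderiv ℝ (fderiv ℝ b) y) =
        -(h • (fderiv ℝ (fderiv ℝ b) x - fderiv ℝ (fderiv ℝ b) y)) := by
      rw [smul_sub]; abel
    dsimp only
    rw [e1, mul_assoc]
    refine (h3 _).trans ?_
    exact mul_le_mul_of_nonneg_left (hb.bounds.lip x y) hh

variable {A₁ A₂ A₃ : ℝ} {G H : E → ℝ}

lemma HasDerivBounds.eulerStep (hG : HasDerivBounds A₁ A₂ A₃ G) (hA : 0 ≤ A₃)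
    (hn : IsNoise e w ζ z) (hb : IsDrift R m b) (hh : 0 ≤ h) (hm : h * m ^ 2 ≤ 2 * R) :
    HasDerivBounds A₁ (A₂ + h * m * A₁) (A₃ + h * m * (3 * A₂ + A₁)) (eulerStep w ζ b h G) :=
  HasDerivBounds.sum hn.nonneg hn.sum_eq_one fun _ =>
    hG.comp (hb.hasDerivBounds_step hh hm _) hA

lemma HasDerivBounds.eulerStep_iterate (hG : HasDerivBounds A₁ A₂ A₃ G) (hA : 0 ≤ A₃)
    (hn : IsNoise e w ζ z) (hb : IsDrift R m b) (hh : 0 ≤ h) (hm : h * m ^ 2 ≤ 2 * R)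
    (k : ℕ) {T : ℝ} (hT : k * h ≤ T) :
    HasDerivBounds A₁ (A₂ + T * m * A₁) (A₃ + T * m * (3 * (A₂ + T * m * A₁) + A₁))
      ((_root_.eulerStep w ζ b h)^[k] G) := by
  have hm0 : 0 ≤ m := hb.bounds.first_nonneg
  have hA1 := hG.first_nonneg
  have hA2 := hG.second_nonneg
  have hT0 : 0 ≤ T := le_trans (by positivity) hT
  have key : ∀ i : ℕ, i ≤ k → HasDerivBounds A₁ (A₂ + i * h * m * A₁)
      (A₃ + i * h * m * (3 * (A₂ + T * m * A₁) + A₁)) ((_root_.eulerStep w ζ b h)^[i] G) := by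
    intro i
    induction i with
    | zero => intro _; simpa using hG
    | succ i ih =>
      intro hi
      rw [Function.iterate_succ_apply']
      have hik : (i : ℝ) * h ≤ T := le_trans (by gcongr; omega) hT
      refine ((ih (by omega)).eulerStep (by positivity) hn hb hh hm).mono le_rfl
        (by push_cast; linarith) ?_
      have : h * m * (3 * (A₂ + i * h * m * A₁) + A₁) ≤
          h * m * (3 * (A₂ + T * m * A₁) + A₁) := by gcongr
      push_cast
      linarith
  exact (key k le_rfl).mono le_rfl (by gcongr) (by gcongr)

lemma eulerStep_const_le (hn : IsNoise e w ζ z) {c : ℝ} (hG : ∀ x, c ≤ G x) (x : E) :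
    c ≤ eulerStep w ζ b h G x :=
  calc c = ∑ j, w j • c := by
        simp only [smul_eq_mul]; rw [← Finset.sum_mul, hn.sum_eq_one, one_mul]
    _ ≤ _ := Finset.sum_le_sum fun j _ => mul_le_mul_of_nonneg_left (hG _) (hn.nonneg j)

lemma eulerStep_le_const (hn : IsNoise e w ζ z) {c : ℝ} (hG : ∀ x, G x ≤ c) (x : E) :
    eulerStep w ζ b h G x ≤ c :=
  calc _ ≤ ∑ j, w j • c :=
        Finset.sum_le_sum fun j _ => mul_le_mul_of_nonneg_left (hG _) (hn.nonneg j)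
    _ = c := by simp only [smul_eq_mul]; rw [← Finset.sum_mul, hn.sum_eq_one, one_mul]

lemma eulerStep_iterate_mem_Icc (hn : IsNoise e w ζ z) {c d : ℝ} (hG : ∀ x, G x ∈ Set.Icc c d)
    (k : ℕ) (x : E) : (eulerStep w ζ b h)^[k] G x ∈ Set.Icc c d := by
  induction k generalizing x with
  | zero => exact hG x
  | succ k ih =>
    rw [Function.iterate_succ_apply']
    exact ⟨eulerStep_const_le hn (fun x => (ih x).1) x, eulerStep_le_const hn (fun x => (ih x).2) x⟩

lemma eulerStep_smul (c : ℝ) : eulerStep w ζ b h (fun x => c * G x) =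
    fun x => c * eulerStep w ζ b h G x := by
  ext x
  simp only [eulerStep, Finset.mul_sum, smul_eq_mul]
  exact Finset.sum_congr rfl fun j _ => by ring

lemma eulerStep_lipschitz (hn : IsNoise e w ζ z) (hb : IsDrift R m b) (hh : 0 ≤ h) {L : ℝ}
    (hL : 0 ≤ L) (hG : ∀ x y, |G x - G y| ≤ L * ‖x - y‖) (x y : E) :
    |eulerStep w ζ b h G x - eulerStep w ζ b h G y| ≤
      L * √(1 - 2 * h * R + h ^ 2 * m ^ 2) * ‖x - y‖ := by
  have e1 : eulerStep w ζ b h G x - eulerStep w ζ b h G y =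
      ∑ j, w j • (G (x - h • b x + √h • ζ j) - G (y - h • b y + √h • ζ j)) := by
    simp only [eulerStep, smul_sub, Finset.sum_sub_distrib]
  rw [e1]
  refine norm_convex_combination_le hn.nonneg hn.sum_eq_one fun j =>
    (Real.norm_eq_abs _).trans_le ((hG _ _).trans ?_)
  rw [mul_assoc]
  exact mul_le_mul_of_nonneg_left (hb.lipschitz_step hh _ x y) hL

lemma eulerStep_iterate_lipschitz (hn : IsNoise e w ζ z) (hb : IsDrift R m b) (hh : 0 ≤ h) {L : ℝ}
    (hL : 0 ≤ L) (hG : ∀ x y, |G x - G y| ≤ L * ‖x - y‖) (k : ℕ) (x y : E) :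
    |(eulerStep w ζ b h)^[k] G x - (eulerStep w ζ b h)^[k] G y| ≤
      L * √(1 - 2 * h * R + h ^ 2 * m ^ 2) ^ k * ‖x - y‖ := by
  induction k generalizing x y with
  | zero => simpa using hG x y
  | succ k ih =>
    rw [Function.iterate_succ_apply', pow_succ, ← mul_assoc]
    exact eulerStep_lipschitz hn hb hh (by positivity) ih x y

/-- The Euler step contracts a weighted squared gradient. -/
lemma norm_fderiv_eulerStep_sq_le (hn : IsNoise e w ζ z) (hb : IsDrift R m b) (hR : 0 ≤ R)
    (hh : 0 ≤ h) (hG : Differentiable ℝ G) {c α : ℝ} (hα : α ∈ Set.Icc (0 : ℝ) 1) (hc : 0 ≤ c)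
    (hG0 : ∀ x, 0 ≤ G x) (hH0 : ∀ x, 0 ≤ H x)
    (hGH : ∀ x, ‖fderiv ℝ G x‖ ^ 2 ≤ c * G x ^ α * H x) (x : E) :
    ‖fderiv ℝ (eulerStep w ζ b h G) x‖ ^ 2 ≤ c * eulerStep w ζ b h G x ^ α *
      ((1 - 2 * h * R + h ^ 2 * m ^ 2) * eulerStep w ζ b h H x) := by
  set Q := 1 - 2 * h * R + h ^ 2 * m ^ 2 with hQ
  have hQ0 : 0 ≤ Q := hb.factor_nonneg hR
  set T : ι → E → E := fun j x => x - h • b x + √h • ζ j with hT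
  have hTd : ∀ j, Differentiable ℝ (T j) := fun j =>
    (differentiable_id.sub (hb.bounds.differentiable.const_smul h)).add_const _
  have h1 : fderiv ℝ (eulerStep w ζ b h G) x =
      ∑ j, w j • ((fderiv ℝ G (T j x)).comp (fderiv ℝ (T j) x)) := by
    change fderiv ℝ (fun x => ∑ j, w j • G (T j x)) x = _
    rw [fderiv_fun_sum (A := fun j x => w j • G (T j x))
      fun j _ => ((hG _).comp x (hTd j x)).const_smul (w j)]
    refine Finset.sum_congr rfl fun j _ => ?_
    have := ((hG (T j x)).hasFDerivAt.comp x (hTd j x).hasFDerivAt).const_smul (w j)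
    exact this.fderiv
  have h2 : ‖fderiv ℝ (eulerStep w ζ b h G) x‖ ≤ √Q * ∑ j, w j * ‖fderiv ℝ G (T j x)‖ := by
    rw [h1, Finset.mul_sum]
    refine norm_sum_le_of_le _ fun j _ => ?_
    rw [norm_smul, norm_of_nonneg (hn.nonneg j)]
    calc _ ≤ w j * (‖fderiv ℝ G (T j x)‖ * ‖fderiv ℝ (T j) x‖) :=
          mul_le_mul_of_nonneg_left (ContinuousLinearMap.opNorm_comp_le _ _) (hn.nonneg j)
      _ ≤ w j * (‖fderiv ℝ G (T j x)‖ * √Q) := by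
          have := hb.norm_fderiv_step_le hh (√h • ζ j) x
          have := hn.nonneg j
          gcongr
      _ = _ := by ring
  have h3 : (∑ j, w j * ‖fderiv ℝ G (T j x)‖) ^ 2 ≤
      (∑ j, w j * (c * G (T j x) ^ α)) * ∑ j, w j * H (T j x) := by
    refine Finset.sum_sq_le_sum_mul_sum_of_sq_le_mul _ (fun j _ => ?_) (fun j _ => ?_)
      fun j _ => ?_
    · exact mul_nonneg (hn.nonneg j) (mul_nonneg hc (rpow_nonneg (hG0 _) _))
    · exact mul_nonneg (hn.nonneg j) (hH0 _)
    · have := mul_le_mul_of_nonneg_left (hGH (T j x)) (sq_nonneg (w j))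
      linarith
  have h4 : ∑ j, w j * G (T j x) ^ α ≤ (∑ j, w j * G (T j x)) ^ α := by
    have := (Real.concaveOn_rpow hα.1 hα.2).le_map_sum (t := Finset.univ) (w := w)
      (p := fun j => G (T j x)) (fun j _ => hn.nonneg j) hn.sum_eq_one (fun j _ => hG0 _)
    simpa using this
  have hH1 : 0 ≤ ∑ j, w j * H (T j x) :=
    Finset.sum_nonneg fun j _ => mul_nonneg (hn.nonneg j) (hH0 _)
  calc ‖fderiv ℝ (eulerStep w ζ b h G) x‖ ^ 2
      ≤ (√Q * ∑ j, w j * ‖fderiv ℝ G (T j x)‖) ^ 2 := pow_le_pow_left₀ (norm_nonneg _) h2 2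
    _ = Q * (∑ j, w j * ‖fderiv ℝ G (T j x)‖) ^ 2 := by rw [mul_pow, sq_sqrt hQ0]
    _ ≤ Q * ((∑ j, w j * (c * G (T j x) ^ α)) * ∑ j, w j * H (T j x)) := by gcongr
    _ = Q * ((c * ∑ j, w j * G (T j x) ^ α) * ∑ j, w j * H (T j x)) := by
        have : ∀ j, w j * (c * G (T j x) ^ α) = c * (w j * G (T j x) ^ α) := fun j => by ring
        simp only [this, ← Finset.mul_sum]
    _ ≤ Q * ((c * (∑ j, w j * G (T j x)) ^ α) * ∑ j, w j * H (T j x)) := by gcongr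
    _ = _ := by simp only [eulerStep, smul_eq_mul, hT]; ring

lemma norm_fderiv_eulerStep_iterate_sq_le (hn : IsNoise e w ζ z) (hb : IsDrift R m b)
    (hR : 0 ≤ R) (hh : 0 ≤ h) (hm : h * m ^ 2 ≤ 2 * R) (hG : HasDerivBounds A₁ A₂ A₃ G)
    (hA : 0 ≤ A₃) {c α : ℝ}
    (hα : α ∈ Set.Icc (0 : ℝ) 1) (hc : 0 ≤ c) (hG0 : ∀ x, 0 ≤ G x) (hH0 : ∀ x, 0 ≤ H x)
    (hGH : ∀ x, ‖fderiv ℝ G x‖ ^ 2 ≤ c * G x ^ α * H x) (k : ℕ) (x : E) :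
    ‖fderiv ℝ ((eulerStep w ζ b h)^[k] G) x‖ ^ 2 ≤ c * (eulerStep w ζ b h)^[k] G x ^ α *
      ((1 - 2 * h * R + h ^ 2 * m ^ 2) ^ k * (eulerStep w ζ b h)^[k] H x) := by
  have hQ0 : 0 ≤ 1 - 2 * h * R + h ^ 2 * m ^ 2 := hb.factor_nonneg hR
  induction k generalizing x with
  | zero => simpa using hGH x
  | succ k ih =>
    have key : ∀ {G : E → ℝ}, (∀ x, 0 ≤ G x) → ∀ k x, 0 ≤ (eulerStep w ζ b h)^[k] G x := by
      intro G hG k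
      induction k with
      | zero => exact hG
      | succ k ih =>
        intro x
        rw [Function.iterate_succ_apply']
        exact eulerStep_const_le hn ih x
    have := norm_fderiv_eulerStep_sq_le (h := h) (x := x) hn hb hR hh
      (hG.eulerStep_iterate hA hn hb hh hm k le_rfl).differentiable hα hc (key hG0 k)
      (fun x => mul_nonneg (pow_nonneg hQ0 k) (key hH0 k x)) ih
    rw [eulerStep_smul] at this
    simp only [Function.iterate_succ_apply']
    refine this.trans_eq ?_
    ring

/-- The generator of the diffusion with drift `-b`. -/
noncomputable def generator (e : OrthonormalBasis κ ℝ E) (b : E → E) (G : E → ℝ) (x : E) : ℝ :=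
  ∑ i, fderiv ℝ (fderiv ℝ G) x (e i) (e i) - fderiv ℝ G x (b x)

/-- The Euler step agrees with the generator to first order. -/
lemma abs_eulerStep_sub_generator_le (hn : IsNoise e w ζ z) (hz : 0 ≤ z) {β : ℝ} (hβ : 0 ≤ β)
    (hbβ : ∀ x, ‖b x‖ ≤ β * (1 + ‖x‖)) (hh : 0 ≤ h) (hh1 : h ≤ 1)
    (hG : HasDerivBounds A₁ A₂ A₃ G) (hA : 0 ≤ A₃) (x : E) :
    |eulerStep w ζ b h G x - G x - h * generator e b G x| ≤
      (A₂ + A₃) * (1 + β + z) ^ 3 * (h * √h) * (1 + ‖x‖) ^ 3 := by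
  have hA2 := hG.second_nonneg
  have hs : √h * √h = h := Real.mul_self_sqrt hh
  have hs0 : 0 ≤ √h := sqrt_nonneg h
  have hs1 : √h ≤ 1 := Real.sqrt_le_one.2 hh1
  have hhs : h ≤ √h := by nlinarith
  set X := 1 + ‖x‖ with hX
  have hX1 : 1 ≤ X := by have := norm_nonneg x; linarith
  set B := fderiv ℝ (fderiv ℝ G) x with hB
  set d : ι → E := fun j => -(h • b x) + √h • ζ j with hd
  have hdn : ∀ j, ‖d j‖ ≤ √h * ((1 + β + z) * X) := fun j =>
    calc ‖d j‖ ≤ h * (β * X) + √h * z := by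
          refine norm_add_le_of_le ?_ ?_
          · rw [norm_neg, norm_smul, norm_of_nonneg hh]
            gcongr
            exact hbβ x
          · rw [norm_smul, norm_of_nonneg hs0]
            gcongr
            exact hn.bound j
      _ ≤ √h * (β * X) + √h * (z * X) := by
          gcongr
          exact le_mul_of_one_le_right hz hX1
      _ ≤ _ := by nlinarith [mul_nonneg hs0 (zero_le_one.trans hX1)]
  set r : ι → ℝ := fun j => G (x + d j) - G x - fderiv ℝ G x (d j) - (1 / 2 : ℝ) * B (d j) (d j)
    with hr
  have hrj : ∀ j, ‖r j‖ ≤ A₃ * (√h * ((1 + β + z) * X)) ^ 3 := fun j =>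
    (hG.taylor hA x (d j)).trans (by gcongr; exact hdn j)
  have hsum : eulerStep w ζ b h G x - G x - h * generator e b G x =
      ∑ j, w j • r j + h ^ 2 / 2 * B (b x) (b x) := by
    have e1 : eulerStep w ζ b h G x = ∑ j, w j * G (x + d j) := by
      simp only [eulerStep, hd, smul_eq_mul]
      refine Finset.sum_congr rfl fun j _ => ?_
      congr 2
      abel
    have e2 : ∑ j, w j * fderiv ℝ G x (d j) = - (h * fderiv ℝ G x (b x)) := by
      have : ∑ j, w j • d j = -(h • b x) := by
        simp only [hd, smul_add, Finset.sum_add_distrib]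
        rw [← Finset.sum_smul, hn.sum_eq_one, one_smul]
        simp only [smul_comm _ (√h)]
        rw [← Finset.smul_sum, hn.mean, smul_zero, add_zero]
      have h' := congrArg (fderiv ℝ G x) this
      simpa [map_sum] using h'
    have e3 : ∑ j, w j * B (d j) (d j) = h ^ 2 * B (b x) (b x) + 2 * h * ∑ i, B (e i) (e i) := by
      have m1 : ∑ j, w j * B (b x) (ζ j) = 0 := by
        have h' := congrArg (B (b x)) hn.mean
        simpa [map_sum] using h'
      have m2 : ∑ j, w j * B (ζ j) (b x) = 0 := by
        have h' := congrArg (fun v => B v (b x)) hn.mean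
        simpa [map_sum] using h'
      have c := hn.cov B
      have ex : ∀ j, w j * B (d j) (d j) = w j * (h ^ 2 * B (b x) (b x)) -
          h * √h * (w j * B (b x) (ζ j)) - h * √h * (w j * B (ζ j) (b x)) +
          h * (w j * B (ζ j) (ζ j)) := by
        intro j
        simp only [hd, map_add, map_neg, map_smul, add_apply, neg_apply, smul_apply, smul_eq_mul]
        linear_combination (w j * B (ζ j) (ζ j)) * hs
      simp only [ex, Finset.sum_add_distrib, Finset.sum_sub_distrib, ← Finset.mul_sum,
        ← Finset.sum_mul, m1, m2, c, hn.sum_eq_one]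
      ring
    have e4 : ∑ j, w j • r j = ∑ j, w j * G (x + d j) - G x - ∑ j, w j * fderiv ℝ G x (d j) -
        1 / 2 * ∑ j, w j * B (d j) (d j) := by
      have ex : ∀ j, w j • r j = w j * G (x + d j) - w j * G x - w j * fderiv ℝ G x (d j) -
          1 / 2 * (w j * B (d j) (d j)) := fun j => by
        simp only [hr, smul_eq_mul]; ring
      simp only [ex, Finset.sum_sub_distrib, ← Finset.mul_sum, ← Finset.sum_mul, hn.sum_eq_one,
        one_mul]
    rw [e4, e3, e2, e1, generator]
    ring
  have hBb : |B (b x) (b x)| ≤ A₂ * (β * X) * (β * X) :=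
    B.le_of_opNorm₂_le_of_le (hG.second x) (hbβ x) (hbβ x)
  have hw := norm_convex_combination_le hn.nonneg hn.sum_eq_one hrj
  rw [hsum]
  have hs3 : √h ^ 3 = h * √h := by rw [pow_succ, sq, hs]
  calc _ ≤ A₃ * (√h * ((1 + β + z) * X)) ^ 3 + h ^ 2 / 2 * (A₂ * (β * X) * (β * X)) := by
        refine (abs_add_le _ _).trans (add_le_add hw ?_)
        rw [abs_mul, abs_of_nonneg (by positivity)]
        gcongr
    _ ≤ A₃ * (√h * ((1 + β + z) * X)) ^ 3 + (h * √h) * (A₂ * ((1 + β + z) * X) ^ 3) := by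
        have k1 : h ^ 2 / 2 ≤ h * √h := by nlinarith
        have k2 : β * X ≤ (1 + β + z) * X := by gcongr; linarith
        have k3 : 1 ≤ (1 + β + z) * X := by nlinarith
        have k4 : A₂ * (β * X) * (β * X) ≤ A₂ * ((1 + β + z) * X) ^ 3 := by
          rw [mul_assoc]
          gcongr
          have k5 : (β * X) * (β * X) ≤ ((1 + β + z) * X) ^ 2 := by
            rw [sq]; gcongr
          exact k5.trans (pow_le_pow_right₀ k3 (by norm_num))
        gcongr
    _ = _ := by rw [mul_pow, hs3, mul_pow]; ring

end Euler

lemma rpow_tangent_le {u v s : ℝ} (hu : 0 < u) (hv : 0 ≤ v) (hs : 1 ≤ s) :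
    u ^ s + s * u ^ (s - 1) * (v - u) ≤ v ^ s := by
  have h := one_add_mul_self_le_rpow_one_add (s := v / u - 1) (p := s)
    (by have := div_nonneg hv hu.le; linarith) hs
  have e : 1 + (v / u - 1) = v / u := by ring
  rw [e, div_rpow hv hu.le, le_div_iff₀ (rpow_pos_of_pos hu s)] at h
  have e2 : u ^ s = u ^ (s - 1) * u := by
    rw [← rpow_add_one hu.ne', sub_add_cancel]
  refine le_trans (le_of_eq ?_) h
  have : v / u * u = v := div_mul_cancel₀ v hu.ne'
  rw [e2]
  linear_combination (-s * u ^ (s - 1)) * this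

section Invariant

variable {E : Type*} [NormedAddCommGroup E] [InnerProductSpace ℝ E] [FiniteDimensional ℝ E]
  [MeasurableSpace E] [BorelSpace E]
  {κ ι : Type*} [Fintype κ] [Fintype ι]

/-- A measure with third moments which is reversible for the diffusion with
drift `-b`. -/
structure IsReversibleDrift (e : OrthonormalBasis κ ℝ E) (b : E → E) (μ : Measure E) : Prop where
  moment : Integrable (fun x => (1 + ‖x‖) ^ 3) μ
  ibp : ∀ {A₁ A₂ A₃ C C' : ℝ} {G ψ : E → ℝ}, HasDerivBounds A₁ A₂ A₃ G → ContDiff ℝ 1 ψ →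
    (∀ x, |ψ x| ≤ C) → (∀ x, ‖fderiv ℝ ψ x‖ ≤ C') →
    ∫ x, ψ x * generator e b G x ∂μ =
      -∫ x, ∑ i, fderiv ℝ ψ x (e i) * fderiv ℝ G x (e i) ∂μ

variable {e : OrthonormalBasis κ ℝ E} {w : ι → ℝ} {ζ : ι → E} {z : ℝ} {R m h : ℝ} {b : E → E}
  {μ : Measure E} {A₁ A₂ A₃ : ℝ} {F G H ψ : E → ℝ}

omit [FiniteDimensional ℝ E] in
lemma IsReversibleDrift.integrable (hμ : IsReversibleDrift e b μ) (hG : Continuous G) {C : ℝ}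
    (hC : ∀ x, |G x| ≤ C * (1 + ‖x‖) ^ 3) : Integrable G μ :=
  (hμ.moment.const_mul C).mono' hG.aestronglyMeasurable (Filter.Eventually.of_forall hC)

omit [InnerProductSpace ℝ E] [FiniteDimensional ℝ E] [MeasurableSpace E] [BorelSpace E] in
lemma one_add_norm_le_cube (x : E) : 1 + ‖x‖ ≤ (1 + ‖x‖) ^ 3 :=
  le_self_pow₀ (by have := norm_nonneg x; linarith) (by norm_num)

omit [InnerProductSpace ℝ E] [FiniteDimensional ℝ E] [MeasurableSpace E] [BorelSpace E] in
lemma one_le_one_add_norm_cube (x : E) : 1 ≤ (1 + ‖x‖) ^ 3 :=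
  one_le_pow₀ (by have := norm_nonneg x; linarith)

omit [FiniteDimensional ℝ E] [MeasurableSpace E] [BorelSpace E] in
lemma HasDerivBounds.abs_le (hG : HasDerivBounds A₁ A₂ A₃ G) (x : E) :
    |G x| ≤ (|G 0| + A₁) * (1 + ‖x‖) ^ 3 := by
  have h1 := hG.norm_sub_le x 0
  rw [sub_zero, Real.norm_eq_abs] at h1
  have h2 : |G x| ≤ |G 0| + |G x - G 0| := by
    simpa using abs_add_le (G 0) (G x - G 0)
  have := one_add_norm_le_cube x
  have := one_le_one_add_norm_cube x
  have := hG.first_nonneg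
  nlinarith [abs_nonneg (G 0), norm_nonneg x]

omit [FiniteDimensional ℝ E] in
lemma IsReversibleDrift.integrable_mul (hμ : IsReversibleDrift e b μ) (hG : HasDerivBounds A₁ A₂ A₃ G)
    (hψ : Continuous ψ) {C : ℝ} (hC : ∀ x, |ψ x| ≤ C) : Integrable (fun x => ψ x * G x) μ := by
  refine hμ.integrable (hψ.mul hG.differentiable.continuous) (C := C * (|G 0| + A₁)) fun x => ?_
  rw [abs_mul, mul_assoc]
  exact mul_le_mul (hC x) (hG.abs_le x) (abs_nonneg _) ((abs_nonneg _).trans (hC x))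

omit [FiniteDimensional ℝ E] [MeasurableSpace E] [BorelSpace E] in
lemma HasDerivBounds.continuous_generator (hG : HasDerivBounds A₁ A₂ A₃ G) (hb : Continuous b) :
    Continuous (generator e b G) := by
  have h1 := hG.continuous_fderiv_fderiv
  have h2 := hG.contDiff_fderiv.continuous
  unfold generator
  fun_prop

omit [FiniteDimensional ℝ E] [MeasurableSpace E] [BorelSpace E] in
lemma HasDerivBounds.abs_generator_le (hG : HasDerivBounds A₁ A₂ A₃ G) {β : ℝ} (hβ : 0 ≤ β)
    (hbβ : ∀ x, ‖b x‖ ≤ β * (1 + ‖x‖)) (x : E) :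
    |generator e b G x| ≤ (Fintype.card κ * A₂ + A₁ * β) * (1 + ‖x‖) ^ 3 := by
  have h1 : |∑ i, fderiv ℝ (fderiv ℝ G) x (e i) (e i)| ≤ Fintype.card κ * A₂ := by
    refine (Finset.abs_sum_le_sum_abs _ _).trans ?_
    calc _ ≤ ∑ _i : κ, A₂ := Finset.sum_le_sum fun i _ => by
          simpa using (fderiv ℝ (fderiv ℝ G) x).le_of_opNorm₂_le_of_le (hG.second x)
            (e.norm_eq_one i).le (e.norm_eq_one i).le
      _ = _ := by simp
  have h2 : |fderiv ℝ G x (b x)| ≤ A₁ * (β * (1 + ‖x‖)) :=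
    (fderiv ℝ G x).le_of_opNorm_le_of_le (hG.first x) (hbβ x)
  have := one_add_norm_le_cube x
  have h3 := one_le_one_add_norm_cube x
  have := hG.first_nonneg
  have := hG.second_nonneg
  calc _ ≤ Fintype.card κ * A₂ + A₁ * (β * (1 + ‖x‖)) := (abs_sub _ _).trans (add_le_add h1 h2)
    _ ≤ Fintype.card κ * A₂ * (1 + ‖x‖) ^ 3 + A₁ * (β * (1 + ‖x‖) ^ 3) := by
        refine add_le_add (le_mul_of_one_le_right (by positivity) h3) ?_
        gcongr
    _ = _ := by ring

omit [FiniteDimensional ℝ E] [MeasurableSpace E] [BorelSpace E] in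
lemma IsDrift.norm_le (hb : IsDrift R m b) (x : E) : ‖b x‖ ≤ (‖b 0‖ + m) * (1 + ‖x‖) := by
  have h1 := hb.bounds.norm_sub_le x 0
  rw [sub_zero] at h1
  have h2 : ‖b x‖ ≤ ‖b 0‖ + ‖b x - b 0‖ := by
    simpa using norm_add_le (b 0) (b x - b 0)
  have := hb.bounds.first_nonneg
  nlinarith [norm_nonneg (b 0), norm_nonneg x]

/-- The constant in the local error of the Euler scheme. -/
noncomputable def eulerConst (b : E → E) (m z A₂ A₃ : ℝ) (μ : Measure E) : ℝ :=
  (A₂ + A₃) * (1 + (‖b 0‖ + m) + z) ^ 3 * ∫ x, (1 + ‖x‖) ^ 3 ∂μ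

omit [FiniteDimensional ℝ E] [BorelSpace E] in
lemma eulerConst_nonneg (hb : IsDrift R m b) (hz : 0 ≤ z) (h2 : 0 ≤ A₂) (h3 : 0 ≤ A₃) :
    0 ≤ eulerConst b m z A₂ A₃ μ := by
  have := hb.bounds.first_nonneg
  have : 0 ≤ ∫ x, (1 + ‖x‖) ^ 3 ∂μ := integral_nonneg fun x => by positivity
  unfold eulerConst
  positivity

omit [FiniteDimensional ℝ E] in
lemma abs_integral_mul_eulerStep_sub_le (hμ : IsReversibleDrift e b μ) (hn : IsNoise e w ζ z)
    (hz : 0 ≤ z) (hb : IsDrift R m b) (hh : 0 ≤ h) (hh1 : h ≤ 1) (hm : h * m ^ 2 ≤ 2 * R)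
    (hG : HasDerivBounds A₁ A₂ A₃ G) (hA : 0 ≤ A₃) (hψ : Continuous ψ) {C : ℝ}
    (hC : ∀ x, |ψ x| ≤ C) :
    |∫ x, ψ x * eulerStep w ζ b h G x ∂μ - ∫ x, ψ x * G x ∂μ -
      h * ∫ x, ψ x * generator e b G x ∂μ| ≤ C * (eulerConst b m z A₂ A₃ μ * (h * √h)) := by
  have hβ : 0 ≤ ‖b 0‖ + m := add_nonneg (norm_nonneg _) hb.bounds.first_nonneg
  have hC0 : 0 ≤ C := (abs_nonneg _).trans (hC 0)
  have i1 := hμ.integrable_mul (hG.eulerStep hA hn hb hh hm) hψ hC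
  have i2 := hμ.integrable_mul hG hψ hC
  have i3 : Integrable (fun x => ψ x * generator e b G x) μ := by
    refine hμ.integrable (hψ.mul (hG.continuous_generator hb.bounds.differentiable.continuous))
      (C := C * (Fintype.card κ * A₂ + A₁ * (‖b 0‖ + m))) fun x => ?_
    rw [abs_mul, mul_assoc]
    exact mul_le_mul (hC x) (hG.abs_generator_le hβ hb.norm_le x) (abs_nonneg _) hC0
  have i4 : Integrable (fun x => ψ x * eulerStep w ζ b h G x - ψ x * G x) μ := i1.sub i2
  rw [← integral_sub i1 i2, ← integral_const_mul, ← integral_sub i4 (i3.const_mul h)]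
  have hle : ∀ x, |ψ x * eulerStep w ζ b h G x - ψ x * G x - h * (ψ x * generator e b G x)| ≤
      C * ((A₂ + A₃) * (1 + (‖b 0‖ + m) + z) ^ 3 * (h * √h)) * (1 + ‖x‖) ^ 3 := by
    intro x
    have e1 : ψ x * eulerStep w ζ b h G x - ψ x * G x - h * (ψ x * generator e b G x) =
        ψ x * (eulerStep w ζ b h G x - G x - h * generator e b G x) := by ring
    rw [e1, abs_mul, mul_assoc]
    exact mul_le_mul (hC x) (abs_eulerStep_sub_generator_le hn hz hβ hb.norm_le hh hh1 hG hA x)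
      (abs_nonneg _) hC0
  refine (norm_integral_le_of_norm_le
    (f := fun x => ψ x * eulerStep w ζ b h G x - ψ x * G x - h * (ψ x * generator e b G x))
    (hμ.moment.const_mul _) (Filter.Eventually.of_forall hle)).trans_eq ?_
  rw [integral_const_mul, eulerConst]
  ring

omit [FiniteDimensional ℝ E] in
lemma abs_integral_eulerStep_sub_le (hμ : IsReversibleDrift e b μ) (hn : IsNoise e w ζ z)
    (hz : 0 ≤ z) (hb : IsDrift R m b) (hh : 0 ≤ h) (hh1 : h ≤ 1) (hm : h * m ^ 2 ≤ 2 * R)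
    (hG : HasDerivBounds A₁ A₂ A₃ G) (hA : 0 ≤ A₃) :
    |∫ x, eulerStep w ζ b h G x ∂μ - ∫ x, G x ∂μ| ≤ eulerConst b m z A₂ A₃ μ * (h * √h) := by
  have h1 := abs_integral_mul_eulerStep_sub_le (ψ := fun _ => 1) (C := 1) hμ hn hz hb hh hh1 hm hG
    hA continuous_const (by simp)
  have h2 := hμ.ibp (ψ := fun _ => 1) (C := 1) (C' := 0) hG contDiff_const (by simp) (by simp)
  rw [h2] at h1
  simpa using h1

omit [FiniteDimensional ℝ E] in
lemma abs_integral_eulerStep_iterate_sub_le (hμ : IsReversibleDrift e b μ) (hn : IsNoise e w ζ z)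
    (hz : 0 ≤ z) (hb : IsDrift R m b) (hh : 0 ≤ h) (hh1 : h ≤ 1) (hm : h * m ^ 2 ≤ 2 * R)
    {T B₂ B₃ : ℝ}
    (hB : ∀ k : ℕ, k * h ≤ T → HasDerivBounds A₁ B₂ B₃ ((eulerStep w ζ b h)^[k] G)) (hB3 : 0 ≤ B₃)
    (k : ℕ) (hk : k * h ≤ T) :
    |∫ x, (eulerStep w ζ b h)^[k] G x ∂μ - ∫ x, G x ∂μ| ≤
      T * (eulerConst b m z B₂ B₃ μ * √h) := by
  have hT : 0 ≤ T := le_trans (by positivity) hk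
  have hE : 0 ≤ eulerConst b m z B₂ B₃ μ :=
    eulerConst_nonneg hb hz (hB 0 (by simpa)).second_nonneg hB3
  have key : ∀ i : ℕ, i ≤ k → |∫ x, (eulerStep w ζ b h)^[i] G x ∂μ - ∫ x, G x ∂μ| ≤
      i * (eulerConst b m z B₂ B₃ μ * (h * √h)) := by
    intro i
    induction i with
    | zero => intro _; simp
    | succ i ih =>
      intro hi
      rw [Function.iterate_succ_apply']
      have hik : (i : ℝ) * h ≤ T := le_trans (by gcongr; omega) hk
      have h1 := abs_integral_eulerStep_sub_le hμ hn hz hb hh hh1 hm (hB i hik) hB3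
      have h2 := abs_sub_le (∫ x, eulerStep w ζ b h ((eulerStep w ζ b h)^[i] G) x ∂μ)
        (∫ x, (eulerStep w ζ b h)^[i] G x ∂μ) (∫ x, G x ∂μ)
      have h3 := ih (by omega)
      push_cast
      linarith
  calc _ ≤ _ := key k le_rfl
    _ = k * h * (eulerConst b m z B₂ B₃ μ * √h) := by ring
    _ ≤ _ := by gcongr

omit [MeasurableSpace E] [BorelSpace E] in
lemma sum_clm_apply_sq (e : OrthonormalBasis κ ℝ E) (l : E →L[ℝ] ℝ) :
    ∑ i, l (e i) * l (e i) = ‖l‖ ^ 2 := by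
  set v := (InnerProductSpace.toDual ℝ E).symm l with hv
  have e1 : ∀ y, l y = inner ℝ v y := fun y => by simp [hv]
  have e2 : ‖l‖ = ‖v‖ := by rw [hv, LinearIsometryEquiv.norm_map]
  rw [e2, ← real_inner_self_eq_norm_sq, ← e.sum_inner_mul_inner v v]
  exact Finset.sum_congr rfl fun i _ => by rw [e1, real_inner_comm v (e i)]

/-- Decay of the integral of a power along one Euler step. -/
lemma integral_rpow_sub_integral_eulerStep_rpow_le [IsProbabilityMeasure μ]
    (hμ : IsReversibleDrift e b μ) (hn : IsNoise e w ζ z)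
    (hz : 0 ≤ z) (hb : IsDrift R m b) (hh : 0 ≤ h) (hh1 : h ≤ 1) (hm : h * m ^ 2 ≤ 2 * R)
    (hG : HasDerivBounds A₁ A₂ A₃ G) (hA : 0 ≤ A₃) {c d : ℝ} (hc : 0 < c)
    (hGcd : ∀ x, G x ∈ Set.Icc c d) {s : ℝ} (hs1 : 1 ≤ s) {D : ℝ} (hHi : Integrable H μ)
    (hGH : ∀ x, ‖fderiv ℝ G x‖ ^ 2 ≤ D * G x ^ (2 - s) * H x) :
    ∫ x, G x ^ s ∂μ - ∫ x, eulerStep w ζ b h G x ^ s ∂μ ≤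
      h * (s * (s - 1) * D * ∫ x, H x ∂μ) +
        s * d ^ (s - 1) * (eulerConst b m z A₂ A₃ μ * (h * √h)) := by
  have hG0 : ∀ x, 0 < G x := fun x => hc.trans_le (hGcd x).1
  have hK := hG.eulerStep hA hn hb hh hm
  have hKcd : ∀ x, eulerStep w ζ b h G x ∈ Set.Icc c d := eulerStep_iterate_mem_Icc hn hGcd 1
  have hK0 : ∀ x, 0 < eulerStep w ζ b h G x := fun x => hc.trans_le (hKcd x).1
  have hd : 0 < d := (hG0 0).trans_le (hGcd 0).2
  set ψ : E → ℝ := fun x => s * G x ^ (s - 1) with hψ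
  have hψd : ContDiff ℝ 1 ψ := contDiff_const.mul
    ((hG.contDiff.of_le (by norm_num)).rpow_const_of_ne fun x => (hG0 x).ne')
  have hψ0 : ∀ x, 0 ≤ ψ x := fun x => mul_nonneg (by linarith) (rpow_nonneg (hG0 x).le _)
  have hψC : ∀ x, |ψ x| ≤ s * d ^ (s - 1) := fun x => by
    rw [abs_of_nonneg (hψ0 x)]
    have := rpow_le_rpow (hG0 x).le (hGcd x).2 (show 0 ≤ s - 1 by linarith)
    exact mul_le_mul_of_nonneg_left this (by linarith)
  have hψf : ∀ x, fderiv ℝ ψ x = (s * (s - 1) * G x ^ (s - 2)) • fderiv ℝ G x := by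
    intro x
    have h1 := ((hG.differentiable x).hasFDerivAt.rpow_const (p := s - 1)
      (Or.inl (hG0 x).ne')).const_mul s
    rw [h1.fderiv, smul_smul]
    congr 1
    rw [show s - 1 - 1 = s - 2 by ring]
    ring
  have hss : 0 ≤ s * (s - 1) := mul_nonneg (by linarith) (by linarith)
  obtain ⟨C₂, hC₂⟩ : ∃ C₂, ∀ x, G x ^ (s - 2) ≤ C₂ := by
    obtain ⟨C₂, h⟩ := (isCompact_Icc (a := c) (b := d)).exists_bound_of_continuousOn
      (f := fun u : ℝ => u ^ (s - 2)) (ContinuousOn.rpow_const continuousOn_id fun u hu =>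
        Or.inl (hc.trans_le hu.1).ne')
    exact ⟨C₂, fun x => (le_abs_self _).trans (h _ (hGcd x))⟩
  have hψC' : ∀ x, ‖fderiv ℝ ψ x‖ ≤ s * (s - 1) * C₂ * A₁ := by
    intro x
    have := rpow_nonneg (hG0 x).le (s - 2)
    rw [hψf, norm_smul, norm_of_nonneg (mul_nonneg hss this)]
    have := hC₂ x
    have := hG.first x
    gcongr
    exact mul_nonneg hss (by linarith)
  have hstep := abs_integral_mul_eulerStep_sub_le hμ hn hz hb hh hh1 hm hG hA hψd.continuous hψC
  have hibp := hμ.ibp hG hψd hψC hψC'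
  have hpt : ∀ x, ∑ i, fderiv ℝ ψ x (e i) * fderiv ℝ G x (e i) ≤ s * (s - 1) * D * H x := by
    intro x
    have h1 := sum_clm_apply_sq e (fderiv ℝ G x)
    have h2 : ∑ i, fderiv ℝ ψ x (e i) * fderiv ℝ G x (e i) =
        s * (s - 1) * G x ^ (s - 2) * ‖fderiv ℝ G x‖ ^ 2 := by
      rw [← h1, Finset.mul_sum, hψf]
      exact Finset.sum_congr rfl fun i _ => by simp [mul_assoc]
    have h3 : G x ^ (s - 2) * G x ^ (2 - s) = 1 := by
      rw [← rpow_add (hG0 x)]; simp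
    rw [h2]
    calc _ ≤ s * (s - 1) * G x ^ (s - 2) * (D * G x ^ (2 - s) * H x) :=
          mul_le_mul_of_nonneg_left (hGH x) (mul_nonneg hss (rpow_nonneg (hG0 x).le _))
      _ = _ := by linear_combination (s * (s - 1) * D * H x) * h3
  have hcont : Continuous fun x => ∑ i, fderiv ℝ ψ x (e i) * fderiv ℝ G x (e i) := by
    have h1 := hψd.continuous_fderiv (by norm_num)
    have h2 := hG.contDiff_fderiv.continuous
    fun_prop
  have hint : Integrable (fun x => ∑ i, fderiv ℝ ψ x (e i) * fderiv ℝ G x (e i)) μ := by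
    refine integrable_finsetSum _ fun i _ => ?_
    have h1 := hψd.continuous_fderiv (by norm_num)
    have h2 := hG.contDiff_fderiv.continuous
    refine Integrable.of_bound (C := s * (s - 1) * C₂ * A₁ * A₁)
      (by fun_prop : Continuous _).aestronglyMeasurable (Filter.Eventually.of_forall fun x => ?_)
    rw [norm_mul]
    have k1 := (fderiv ℝ ψ x).le_of_opNorm_le_of_le (hψC' x) (e.norm_eq_one i).le
    have k2 := (fderiv ℝ G x).le_of_opNorm_le_of_le (hG.first x) (e.norm_eq_one i).le
    rw [mul_one] at k1 k2
    exact mul_le_mul k1 k2 (norm_nonneg _) ((norm_nonneg _).trans k1)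
  have hmono := integral_mono hint (hHi.const_mul (s * (s - 1) * D)) hpt
  rw [integral_const_mul] at hmono
  have hi : ∀ {g : E → ℝ}, Continuous g → (∀ x, g x ∈ Set.Icc c d) →
      Integrable (fun x => g x ^ s) μ := by
    intro g hg hgcd
    refine Integrable.of_bound (C := d ^ s)
      (hg.rpow_const fun x => Or.inr (by linarith)).aestronglyMeasurable
      (Filter.Eventually.of_forall fun x => ?_)
    have hg0 : 0 ≤ g x := hc.le.trans (hgcd x).1
    rw [norm_of_nonneg (rpow_nonneg hg0 _)]
    exact rpow_le_rpow hg0 (hgcd x).2 (by linarith)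
  have hψG := hμ.integrable_mul hG hψd.continuous hψC
  have hψK := hμ.integrable_mul hK hψd.continuous hψC
  have htan := integral_mono ((hi hG.differentiable.continuous hGcd).sub
    (hi hK.differentiable.continuous hKcd)) (hψG.sub hψK) (fun x => by
      have := rpow_tangent_le (hG0 x) (hK0 x).le hs1
      simp only [Pi.sub_apply, hψ]
      linarith)
  simp only [Pi.sub_apply] at htan
  rw [integral_sub (hi hG.differentiable.continuous hGcd) (hi hK.differentiable.continuous hKcd),
    integral_sub hψG hψK] at htan
  rw [hibp] at hstep
  have := (abs_le.1 hstep).1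
  have := mul_le_mul_of_nonneg_left hmono hh
  linarith

end Invariant

section Beckner

variable {E : Type*} [NormedAddCommGroup E] [InnerProductSpace ℝ E] [FiniteDimensional ℝ E]
  [MeasurableSpace E] [BorelSpace E]
  {κ ι : Type*} [Fintype κ] [Fintype ι]
  {e : OrthonormalBasis κ ℝ E} {w : ι → ℝ} {ζ : ι → E} {z : ℝ} {R m h : ℝ} {b : E → E}
  {μ : Measure E} {A₁ A₂ A₃ B₁ B₂ B₃ c d s D T : ℝ} {F G H ψ : E → ℝ}

lemma mul_geom_sum_factor_le {h R m : ℝ} (hQ : 0 ≤ 1 - 2 * h * R + h ^ 2 * m ^ 2)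
    (hR : 0 < 2 * R - h * m ^ 2) (N : ℕ) :
    h * ∑ k ∈ Finset.range N, (1 - 2 * h * R + h ^ 2 * m ^ 2) ^ k ≤ 1 / (2 * R - h * m ^ 2) := by
  rw [le_div_iff₀ hR]
  have h1 := mul_neg_geom_sum (1 - 2 * h * R + h ^ 2 * m ^ 2) N
  have h2 := pow_nonneg hQ N
  nlinarith

lemma sqrt_factor_pow_le {h R m : ℝ} (hh : 0 ≤ h) (hm : h * m ^ 2 ≤ R) (N : ℕ) :
    √(1 - 2 * h * R + h ^ 2 * m ^ 2) ^ N ≤ exp (-(N * h * R / 2)) := by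
  have h1 : 1 - 2 * h * R + h ^ 2 * m ^ 2 ≤ exp (-(h * R)) := by
    have := add_one_le_exp (-(h * R))
    nlinarith
  have h2 : √(1 - 2 * h * R + h ^ 2 * m ^ 2) ≤ exp (-(h * R) / 2) := by
    rw [exp_half]
    exact sqrt_le_sqrt h1
  calc _ ≤ exp (-(h * R) / 2) ^ N := pow_le_pow_left₀ (sqrt_nonneg _) h2 N
    _ = _ := by rw [← exp_nat_mul]; congr 1; ring

omit [InnerProductSpace ℝ E] [FiniteDimensional ℝ E] in
/-- If `F` is close to its mean then the Jensen gap of a power is small. -/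
lemma integral_rpow_sub_rpow_le [IsProbabilityMeasure μ] (hG : Continuous G) (hc : 0 < c)
    (hGcd : ∀ x, G x ∈ Set.Icc c d) (hs : 1 ≤ s) {a : ℝ} (ha : 0 ≤ a) :
    ∫ x, G x ^ s ∂μ - a ^ s ≤ s * d ^ (s - 1) * ∫ x, |G x - a| ∂μ := by
  have hG0 : ∀ x, 0 < G x := fun x => hc.trans_le (hGcd x).1
  have i1 : Integrable (fun x => |G x - a|) μ := by
    refine Integrable.of_bound (C := d + a) (by fun_prop : Continuous _).aestronglyMeasurable
      (Filter.Eventually.of_forall fun x => ?_)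
    rw [norm_eq_abs, abs_abs]
    have := (hGcd x).2
    exact abs_le.2 ⟨by linarith [hG0 x], by linarith⟩
  have i2 : Integrable (fun x => G x ^ s) μ := by
    refine Integrable.of_bound (C := d ^ s)
      (hG.rpow_const fun x => Or.inr (by linarith)).aestronglyMeasurable
      (Filter.Eventually.of_forall fun x => ?_)
    rw [norm_of_nonneg (rpow_nonneg (hG0 x).le _)]
    exact rpow_le_rpow (hG0 x).le (hGcd x).2 (by linarith)
  have h1 := integral_mono i2 ((integrable_const (a ^ s)).add (i1.const_mul (s * d ^ (s - 1))))
    (fun x => by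
      have h1 := rpow_tangent_le (hG0 x) ha hs
      have h2 := rpow_le_rpow (hG0 x).le (hGcd x).2 (show 0 ≤ s - 1 by linarith)
      have h3 := rpow_nonneg (hG0 x).le (s - 1)
      have h4 : s * G x ^ (s - 1) * (G x - a) ≤ s * d ^ (s - 1) * |G x - a| :=
        (mul_le_mul_of_nonneg_left (le_abs_self _) (by positivity)).trans (by gcongr)
      simp only [Pi.add_apply]
      linarith)
  rw [integral_add' (integrable_const _) (i1.const_mul _), integral_const_mul] at h1
  simp at h1
  linarith

omit [InnerProductSpace ℝ E] [FiniteDimensional ℝ E] in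
lemma integral_abs_sub_le [IsProbabilityMeasure μ] (hm3 : Integrable (fun x => (1 + ‖x‖) ^ 3) μ)
    (hG : Continuous G) {L : ℝ} (hL : 0 ≤ L) (hGL : ∀ x y, |G x - G y| ≤ L * ‖x - y‖) (a : ℝ) :
    ∫ x, |G x - a| ∂μ ≤ 2 * L * ∫ x, (1 + ‖x‖) ^ 3 ∂μ + |∫ x, G x ∂μ - a| := by
  have hle : ∀ x, |G x - G 0| ≤ L * (1 + ‖x‖) ^ 3 := fun x => by
    have h1 := hGL x 0
    rw [sub_zero] at h1
    refine h1.trans (mul_le_mul_of_nonneg_left ?_ hL)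
    have := one_add_norm_le_cube x
    linarith
  have i1 : Integrable (fun x => G x - G 0) μ :=
    (hm3.const_mul L).mono' (by fun_prop : Continuous _).aestronglyMeasurable
      (Filter.Eventually.of_forall hle)
  have i2 : Integrable G μ := by
    have := i1.add (integrable_const (G 0))
    simpa [Function.comp_def, Pi.add_def] using this
  have h1 : ∫ x, |G x - G 0| ∂μ ≤ L * ∫ x, (1 + ‖x‖) ^ 3 ∂μ := by
    rw [← integral_const_mul]
    exact integral_mono i1.abs (hm3.const_mul L) hle
  have h2 : |∫ x, G x ∂μ - G 0| ≤ ∫ x, |G x - G 0| ∂μ := by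
    have h := abs_integral_le_integral_abs (f := fun x => G x - G 0) (μ := μ)
    rw [integral_sub i2 (integrable_const _)] at h
    simpa using h
  have h3 := integral_mono (i2.sub (integrable_const a)).abs
    (i1.abs.add (integrable_const (|∫ x, G x ∂μ - G 0| + |∫ x, G x ∂μ - a|))) (fun x => by
      simp only [Pi.sub_apply, Pi.add_apply]
      have k1 := abs_sub_le (G x) (G 0) a
      have k2 := abs_sub_le (G 0) (∫ x, G x ∂μ) a
      rw [abs_sub_comm (G 0) (∫ x, G x ∂μ)] at k2
      linarith)
  rw [integral_add' i1.abs (integrable_const _)] at h3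
  simp at h3
  linarith

/-- The Beckner inequality with the error terms of the Euler scheme. -/
lemma beckner_eulerStep [IsProbabilityMeasure μ]
    (hμ : IsReversibleDrift e b μ) (hn : IsNoise e w ζ z)
    (hz : 0 ≤ z) (hb : IsDrift R m b) (hR : 0 < R) (hh : 0 < h) (hh1 : h ≤ 1) (hm : h * m ^ 2 ≤ R)
    (hF : HasDerivBounds A₁ A₂ A₃ F) (hA : 0 ≤ A₃) (hH : HasDerivBounds B₁ B₂ B₃ H) (hB : 0 ≤ B₃)
    (hc : 0 < c) (hFcd : ∀ x, F x ∈ Set.Icc c d) (hs1 : 1 ≤ s) (hs2 : s ≤ 2) (hD : 0 ≤ D)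
    (hH0 : ∀ x, 0 ≤ H x) (hFH : ∀ x, ‖fderiv ℝ F x‖ ^ 2 ≤ D * F x ^ (2 - s) * H x)
    {N : ℕ} (hT : N * h = T) :
    ∫ x, F x ^ s ∂μ - (∫ x, F x ∂μ) ^ s ≤
      s * (s - 1) * D * (∫ x, H x ∂μ + T * (eulerConst b m z (B₂ + T * m * B₁)
        (B₃ + T * m * (3 * (B₂ + T * m * B₁) + B₁)) μ * √h)) * (1 / (2 * R - h * m ^ 2)) +
      s * d ^ (s - 1) * (2 * (A₁ * exp (-(T * R / 2))) * ∫ x, (1 + ‖x‖) ^ 3 ∂μ +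
        2 * (T * (eulerConst b m z (A₂ + T * m * A₁)
        (A₃ + T * m * (3 * (A₂ + T * m * A₁) + A₁)) μ * √h))) := by
  have hm' : h * m ^ 2 ≤ 2 * R := by linarith
  have hm0 : 0 ≤ m := hb.bounds.first_nonneg
  have hT0 : 0 ≤ T := hT ▸ by positivity
  have hA1 := hF.first_nonneg
  have hA2 := hF.second_nonneg
  have hB1 := hH.first_nonneg
  have hB2 := hH.second_nonneg
  set Q := 1 - 2 * h * R + h ^ 2 * m ^ 2 with hQ
  have hQ0 : 0 ≤ Q := hb.factor_nonneg hR.le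
  set K := eulerStep w ζ b h with hK
  have hkT : ∀ k ≤ N, (k : ℝ) * h ≤ T := fun k hk => by rw [← hT]; gcongr
  have bF : ∀ k : ℕ, k * h ≤ T → HasDerivBounds A₁ (A₂ + T * m * A₁)
      (A₃ + T * m * (3 * (A₂ + T * m * A₁) + A₁)) (K^[k] F) :=
    fun k hk => hF.eulerStep_iterate hA hn hb hh.le hm' k hk
  have bH : ∀ k : ℕ, k * h ≤ T → HasDerivBounds B₁ (B₂ + T * m * B₁)
      (B₃ + T * m * (3 * (B₂ + T * m * B₁) + B₁)) (K^[k] H) :=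
    fun k hk => hH.eulerStep_iterate hB hn hb hh.le hm' k hk
  have hA3' : 0 ≤ A₃ + T * m * (3 * (A₂ + T * m * A₁) + A₁) := by positivity
  have hB3' : 0 ≤ B₃ + T * m * (3 * (B₂ + T * m * B₁) + B₁) := by positivity
  set εF := eulerConst b m z (A₂ + T * m * A₁)
    (A₃ + T * m * (3 * (A₂ + T * m * A₁) + A₁)) μ with hεF
  set εH := eulerConst b m z (B₂ + T * m * B₁)
    (B₃ + T * m * (3 * (B₂ + T * m * B₁) + B₁)) μ with hεH
  have hd : 0 < d := hc.trans_le ((hFcd 0).1.trans (hFcd 0).2)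
  have hmem : ∀ k x, K^[k] F x ∈ Set.Icc c d := eulerStep_iterate_mem_Icc hn hFcd
  have hss : 0 ≤ s * (s - 1) * D :=
    mul_nonneg (mul_nonneg (by linarith) (by linarith)) hD
  have hint : ∀ {k : ℕ}, k ≤ N → Integrable (K^[k] H) μ := fun {k} hk => by
    simpa using hμ.integrable_mul (bH k (hkT k hk)) (ψ := fun _ => 1) continuous_const
      (C := 1) (by simp)
  have hstep : ∀ k ∈ Finset.range N, ∫ x, K^[k] F x ^ s ∂μ - ∫ x, K^[k + 1] F x ^ s ∂μ ≤
      s * (s - 1) * D * (∫ x, H x ∂μ + T * (εH * √h)) * (h * Q ^ k) +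
        s * d ^ (s - 1) * (εF * (h * √h)) := by
    intro k hk
    have hkN : k ≤ N := (Finset.mem_range.1 hk).le
    have h1 := integral_rpow_sub_integral_eulerStep_rpow_le hμ hn hz hb hh.le hh1 hm'
      (bF k (hkT k hkN)) hA3' hc (hmem k) hs1 ((hint hkN).const_mul (Q ^ k))
      (norm_fderiv_eulerStep_iterate_sq_le hn hb hR.le hh.le hm' hF hA (α := 2 - s)
        ⟨by linarith, by linarith⟩ hD (fun x => hc.le.trans (hFcd x).1) hH0 hFH k)
    rw [← hK, ← hεF] at h1
    rw [Function.iterate_succ_apply']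
    refine h1.trans (add_le_add_left ?_ _)
    have h2 := (abs_le.1 (abs_integral_eulerStep_iterate_sub_le hμ hn hz hb hh.le hh1 hm' bH hB3'
      k (hkT k hkN))).2
    rw [← hεH, ← hK] at h2
    rw [integral_const_mul]
    calc _ = s * (s - 1) * D * (h * Q ^ k) * ∫ x, K^[k] H x ∂μ := by ring
      _ ≤ s * (s - 1) * D * (h * Q ^ k) * (∫ x, H x ∂μ + T * (εH * √h)) := by
          gcongr
          linarith
      _ = _ := by ring
  have htel := Finset.sum_le_sum hstep
  rw [Finset.sum_range_sub' (fun k => ∫ x, K^[k] F x ^ s ∂μ), Finset.sum_add_distrib,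
    ← Finset.mul_sum, ← Finset.mul_sum, Finset.sum_const, Finset.card_range, nsmul_eq_mul] at htel
  have hJ : 0 ≤ ∫ x, H x ∂μ + T * (εH * √h) := by
    have := eulerConst_nonneg (μ := μ) hb hz (bH 0 (by simpa)).second_nonneg hB3'
    have : 0 ≤ ∫ x, H x ∂μ := integral_nonneg hH0
    positivity
  have hgeom := mul_le_mul_of_nonneg_left
    (mul_geom_sum_factor_le hQ0 (by linarith : 0 < 2 * R - h * m ^ 2) N) (mul_nonneg hss hJ)
  have ha : 0 ≤ ∫ x, F x ∂μ := integral_nonneg fun x => hc.le.trans (hFcd x).1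
  have hend := integral_rpow_sub_rpow_le (μ := μ) (bF N (hkT N le_rfl)).differentiable.continuous
    hc (hmem N) hs1 ha
  have hlip := eulerStep_iterate_lipschitz hn hb hh.le hA1 hF.norm_sub_le N
  have habs := integral_abs_sub_le hμ.moment (bF N (hkT N le_rfl)).differentiable.continuous
    (by positivity) hlip (∫ x, F x ∂μ)
  have hmean := abs_integral_eulerStep_iterate_sub_le hμ hn hz hb hh.le hh1 hm' bF hA3'
    N (hkT N le_rfl)
  rw [← hεF, ← hK] at hmean
  have hexp : 2 * (A₁ * √Q ^ N) * ∫ x, (1 + ‖x‖) ^ 3 ∂μ ≤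
      2 * (A₁ * exp (-(T * R / 2))) * ∫ x, (1 + ‖x‖) ^ 3 ∂μ := by
    have := sqrt_factor_pow_le hh.le hm N
    rw [hT] at this
    have : 0 ≤ ∫ x, (1 + ‖x‖) ^ 3 ∂μ := integral_nonneg fun x => by positivity
    gcongr
  have hlast : ∫ x, |K^[N] F x - ∫ x, F x ∂μ| ∂μ ≤
      2 * (A₁ * exp (-(T * R / 2))) * ∫ x, (1 + ‖x‖) ^ 3 ∂μ + T * (εF * √h) := by
    linarith
  have hsd : 0 ≤ s * d ^ (s - 1) := mul_nonneg (by linarith) (rpow_nonneg hd.le _)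
  have hlast' := mul_le_mul_of_nonneg_left hlast hsd
  have e1 : (N : ℝ) * (s * d ^ (s - 1) * (εF * (h * √h))) =
      s * d ^ (s - 1) * (T * (εF * √h)) := by rw [← hT]; ring
  rw [e1] at htel
  simp only [Function.iterate_zero, id_eq] at htel
  linarith

/-- The Beckner inequality for a function which is bounded away from `0` and whose gradient is
controlled by `H`. -/
lemma beckner_of_isReversibleDrift [IsProbabilityMeasure μ]
    (hμ : IsReversibleDrift e b μ) (hb : IsDrift R m b) (hR : 0 < R)
    (hF : HasDerivBounds A₁ A₂ A₃ F) (hA : 0 ≤ A₃) (hH : HasDerivBounds B₁ B₂ B₃ H) (hB : 0 ≤ B₃)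
    (hc : 0 < c) (hFcd : ∀ x, F x ∈ Set.Icc c d) (hs1 : 1 ≤ s) (hs2 : s ≤ 2) (hD : 0 ≤ D)
    (hH0 : ∀ x, 0 ≤ H x) (hFH : ∀ x, ‖fderiv ℝ F x‖ ^ 2 ≤ D * F x ^ (2 - s) * H x) :
    ∫ x, F x ^ s ∂μ - (∫ x, F x ∂μ) ^ s ≤ s * (s - 1) * D * (∫ x, H x ∂μ) * (1 / (2 * R)) := by
  obtain ⟨w, ζ, z, hz, hn⟩ := exists_isNoise e
  have hfix : ∀ T : ℝ, 0 < T → ∫ x, F x ^ s ∂μ - (∫ x, F x ∂μ) ^ s ≤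
      s * (s - 1) * D * (∫ x, H x ∂μ) * (1 / (2 * R)) +
        s * d ^ (s - 1) * (2 * (A₁ * exp (-(T * R / 2))) * ∫ x, (1 + ‖x‖) ^ 3 ∂μ) := by
    intro T hT
    set Φ : ℝ → ℝ := fun h => s * (s - 1) * D * (∫ x, H x ∂μ + T * (eulerConst b m z (B₂ + T * m * B₁)
        (B₃ + T * m * (3 * (B₂ + T * m * B₁) + B₁)) μ * √h)) * (1 / (2 * R - h * m ^ 2)) +
      s * d ^ (s - 1) * (2 * (A₁ * exp (-(T * R / 2))) * ∫ x, (1 + ‖x‖) ^ 3 ∂μ +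
        2 * (T * (eulerConst b m z (A₂ + T * m * A₁)
        (A₃ + T * m * (3 * (A₂ + T * m * A₁) + A₁)) μ * √h))) with hΦ
    have hΦc : ContinuousAt Φ 0 := by
      have : 2 * R - 0 * m ^ 2 ≠ 0 := by simpa using hR.ne'
      fun_prop (disch := assumption)
    have hseq : Filter.Tendsto (fun N : ℕ => T / N) Filter.atTop (nhds 0) :=
      tendsto_const_div_atTop_nhds_zero_nat T
    have hlim := hΦc.tendsto.comp hseq
    have h0 : Φ 0 = s * (s - 1) * D * (∫ x, H x ∂μ) * (1 / (2 * R)) +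
        s * d ^ (s - 1) * (2 * (A₁ * exp (-(T * R / 2))) * ∫ x, (1 + ‖x‖) ^ 3 ∂μ) := by
      simp [hΦ]
    rw [h0] at hlim
    refine ge_of_tendsto hlim ?_
    have ev1 := hseq.eventually (ge_mem_nhds (show (0 : ℝ) < 1 by norm_num))
    have hseq2 : Filter.Tendsto (fun N : ℕ => T / N * m ^ 2) Filter.atTop (nhds 0) := by
      simpa using hseq.mul_const (m ^ 2)
    have ev2 := hseq2.eventually (ge_mem_nhds hR)
    filter_upwards [ev1, ev2, Filter.eventually_gt_atTop 0] with N h1 h2 hN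
    have hN' : (0 : ℝ) < N := by exact_mod_cast hN
    exact beckner_eulerStep hμ hn hz hb hR (div_pos hT hN') h1 h2 hF hA hH hB hc hFcd hs1 hs2 hD
      hH0 hFH (mul_div_cancel₀ T hN'.ne')
  have hexp : Filter.Tendsto (fun T : ℝ => exp (-(T * R / 2))) Filter.atTop (nhds 0) := by
    refine tendsto_exp_neg_atTop_nhds_zero.comp ?_
    exact (Filter.tendsto_id.atTop_mul_const hR).atTop_div_const (by norm_num)
  have hlim : Filter.Tendsto (fun T : ℝ => s * (s - 1) * D * (∫ x, H x ∂μ) * (1 / (2 * R)) +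
      s * d ^ (s - 1) * (2 * (A₁ * exp (-(T * R / 2))) * ∫ x, (1 + ‖x‖) ^ 3 ∂μ)) Filter.atTop
      (nhds (s * (s - 1) * D * (∫ x, H x ∂μ) * (1 / (2 * R)) +
      s * d ^ (s - 1) * (2 * (A₁ * 0) * ∫ x, (1 + ‖x‖) ^ 3 ∂μ))) :=
    ((((hexp.const_mul A₁).const_mul 2).mul_const _).const_mul _).const_add _
  have := ge_of_tendsto hlim ((Filter.eventually_gt_atTop 0).mono hfix)
  simpa using this

end Beckner

section Gibbs

variable {E : Type*} [NormedAddCommGroup E] [InnerProductSpace ℝ E] [FiniteDimensional ℝ E]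
  [MeasurableSpace E] [BorelSpace E] {ν : Measure E} [ν.IsAddHaarMeasure]
  {κ : Type*} [Fintype κ] {e : OrthonormalBasis κ ℝ E} {R L C m : ℝ} {V : E → ℝ}

/-- A function growing at least quadratically has an integrable Gibbs weight, with all moments. -/
lemma integrable_pow_mul_exp_neg (hR : 0 < R) (hV : Continuous V)
    (hq : ∀ x, R / 2 * ‖x‖ ^ 2 - L * ‖x‖ - C ≤ V x) (k : ℕ) :
    Integrable (fun x => (1 + ‖x‖) ^ k * exp (-V x)) ν := by
  set r : ℕ := Module.finrank ℝ E + 1 with hr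
  have hi : Integrable (fun x : E => (1 + ‖x‖) ^ (-(r : ℝ))) ν :=
    integrable_one_add_norm (by rw [hr]; push_cast; linarith)
  refine (hi.const_mul ((k + r).factorial * exp (1 + C + (L + 1) ^ 2 / (2 * R)))).mono'
    (by fun_prop : Continuous _).aestronglyMeasurable (Filter.Eventually.of_forall fun x => ?_)
  have h0 : 0 < 1 + ‖x‖ := by positivity
  have h1 := pow_div_factorial_le_exp (1 + ‖x‖) h0.le (k + r)
  rw [div_le_iff₀ (by positivity)] at h1
  have h2 : 1 + ‖x‖ + -V x ≤ 1 + C + (L + 1) ^ 2 / (2 * R) := by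
    have h3 : 2 * R * (‖x‖ + (L * ‖x‖ - R / 2 * ‖x‖ ^ 2)) ≤ (L + 1) ^ 2 := by
      nlinarith [sq_nonneg (R * ‖x‖ - (L + 1))]
    have h4 : ‖x‖ + (L * ‖x‖ - R / 2 * ‖x‖ ^ 2) ≤ (L + 1) ^ 2 / (2 * R) := by
      rw [le_div_iff₀ (by positivity)]; linarith
    linarith [hq x]
  rw [norm_of_nonneg (by positivity), rpow_neg h0.le, rpow_natCast, ← div_eq_mul_inv,
    le_div_iff₀ (by positivity)]
  calc (1 + ‖x‖) ^ k * exp (-V x) * (1 + ‖x‖) ^ r = (1 + ‖x‖) ^ (k + r) * exp (-V x) := by ring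
    _ ≤ exp (1 + ‖x‖) * (k + r).factorial * exp (-V x) := by gcongr
    _ = (k + r).factorial * exp (1 + ‖x‖ + -V x) := by rw [exp_add (1 + ‖x‖)]; ring
    _ ≤ _ := by gcongr

omit [InnerProductSpace ℝ E] [FiniteDimensional ℝ E] [ν.IsAddHaarMeasure] in
lemma integral_withDensity_exp_neg (hV : Continuous V) (g : E → ℝ) :
    ∫ x, g x ∂(ν.withDensity fun x => ENNReal.ofReal (exp (-V x))) = ∫ x, exp (-V x) * g x ∂ν := by
  rw [integral_withDensity_eq_integral_toReal_smul (by fun_prop) (by simp)]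
  simp [ENNReal.toReal_ofReal (exp_nonneg _)]

omit [InnerProductSpace ℝ E] [FiniteDimensional ℝ E] [ν.IsAddHaarMeasure] in
lemma integrable_withDensity_exp_neg (hV : Continuous V) {g : E → ℝ} :
    Integrable g (ν.withDensity fun x => ENNReal.ofReal (exp (-V x))) ↔
      Integrable (fun x => exp (-V x) * g x) ν := by
  rw [integrable_withDensity_iff_integrable_smul' (by fun_prop) (by simp)]
  simp [ENNReal.toReal_ofReal (exp_nonneg _)]

/-- The Gibbs measure of a potential is reversible for the drift given by its gradient. -/
lemma isReversibleDrift_withDensity (hR : 0 < R) (hV : ContDiff ℝ 1 V)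
    (hq : ∀ x, R / 2 * ‖x‖ ^ 2 - L * ‖x‖ - C ≤ V x) {b : E → E}
    (hbV : ∀ x v, fderiv ℝ V x v = inner ℝ (b x) v) (hb : IsDrift R m b) :
    IsReversibleDrift e b (ν.withDensity fun x => ENNReal.ofReal (exp (-V x))) where
  moment := by
    rw [integrable_withDensity_exp_neg hV.continuous]
    exact (integrable_pow_mul_exp_neg hR hV.continuous hq 3).congr
      (Filter.Eventually.of_forall fun x => mul_comm _ _)
  ibp := by
    intro A₁ A₂ A₃ C₀ C₁ G ψ hG hψ hψC hψC'
    have hVc := hV.continuous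
    have hbc : Continuous b := hb.bounds.differentiable.continuous
    have cψ := hψ.continuous_fderiv (by norm_num)
    have cψ0 := hψ.continuous
    have cG := hG.contDiff_fderiv.continuous
    have cG2 := hG.continuous_fderiv_fderiv
    have hA1 := hG.first_nonneg
    have hA2 := hG.second_nonneg
    have hC0 : 0 ≤ C₀ := (abs_nonneg _).trans (hψC 0)
    have hC1 : 0 ≤ C₁ := (norm_nonneg _).trans (hψC' 0)
    have hdom : ∀ {g : E → ℝ} (M : ℝ), Continuous g → (∀ x, |g x| ≤ M * (1 + ‖x‖)) →
        Integrable (fun x => exp (-V x) * g x) ν := by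
      intro g M hg hM
      refine ((integrable_pow_mul_exp_neg (ν := ν) hR hVc hq 1).const_mul M).mono'
        (by fun_prop : Continuous _).aestronglyMeasurable (Filter.Eventually.of_forall fun x => ?_)
      rw [norm_mul, norm_of_nonneg (exp_nonneg _), norm_eq_abs]
      calc _ ≤ exp (-V x) * (M * (1 + ‖x‖)) := by gcongr; exact hM x
        _ = _ := by ring
    have k1 : ∀ i x, |fderiv ℝ ψ x (e i)| ≤ C₁ := fun i x => by
      simpa using (fderiv ℝ ψ x).le_of_opNorm_le_of_le (hψC' x) (e.norm_eq_one i).le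
    have k2 : ∀ i x, |fderiv ℝ G x (e i)| ≤ A₁ := fun i x => by
      simpa using (fderiv ℝ G x).le_of_opNorm_le_of_le (hG.first x) (e.norm_eq_one i).le
    have k3 : ∀ i x, |fderiv ℝ (fderiv ℝ G) x (e i) (e i)| ≤ A₂ := fun i x => by
      simpa using (fderiv ℝ (fderiv ℝ G) x).le_of_opNorm₂_le_of_le (hG.second x)
        (e.norm_eq_one i).le (e.norm_eq_one i).le
    have k4 : ∀ i x, |inner ℝ (b x) (e i)| ≤ (‖b 0‖ + m) * (1 + ‖x‖) := fun i x => by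
      have := abs_real_inner_le_norm (b x) (e i)
      rw [e.norm_eq_one, mul_one] at this
      exact this.trans (hb.norm_le x)
    have hβ : 0 ≤ ‖b 0‖ + m := add_nonneg (norm_nonneg _) hb.bounds.first_nonneg
    have i1 : ∀ i, Integrable (fun x => exp (-V x) * (fderiv ℝ ψ x (e i) * fderiv ℝ G x (e i))) ν :=
      fun i => hdom (C₁ * A₁) (by fun_prop) fun x => by
        rw [abs_mul]
        exact (mul_le_mul (k1 i x) (k2 i x) (abs_nonneg _) hC1).trans
          (le_mul_of_one_le_right (by positivity) (by linarith [norm_nonneg x]))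
    have i2 : ∀ i, Integrable
        (fun x => exp (-V x) * (ψ x * fderiv ℝ (fderiv ℝ G) x (e i) (e i))) ν :=
      fun i => hdom (C₀ * A₂) (by fun_prop) fun x => by
        rw [abs_mul]
        exact (mul_le_mul (hψC x) (k3 i x) (abs_nonneg _) hC0).trans
          (le_mul_of_one_le_right (by positivity) (by linarith [norm_nonneg x]))
    have i3 : ∀ i, Integrable
        (fun x => exp (-V x) * (ψ x * (inner ℝ (b x) (e i) * fderiv ℝ G x (e i)))) ν :=
      fun i => hdom (C₀ * ((‖b 0‖ + m) * A₁)) (by fun_prop) fun x => by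
        rw [abs_mul, abs_mul]
        calc _ ≤ C₀ * (((‖b 0‖ + m) * (1 + ‖x‖)) * A₁) := by
              gcongr
              exacts [hψC x, k4 i x, k2 i x]
          _ = _ := by ring
    have hVf : ∀ i x, fderiv ℝ (fun x => exp (-V x)) x (e i) =
        -(exp (-V x) * inner ℝ (b x) (e i)) := fun i x => by
      have h : HasFDerivAt (fun x => exp (-V x)) (exp (-V x) • -fderiv ℝ V x) x :=
        (hV.differentiable (by norm_num) x).hasFDerivAt.neg.exp
      rw [h.fderiv]
      simp [hbV]
    have hgf : ∀ i x, fderiv ℝ (fun x => ψ x * fderiv ℝ G x (e i)) x (e i) =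
        fderiv ℝ ψ x (e i) * fderiv ℝ G x (e i) +
          ψ x * fderiv ℝ (fderiv ℝ G) x (e i) (e i) := fun i x => by
      have h1 := (hG.differentiable_fderiv x).hasFDerivAt.clm_apply (hasFDerivAt_const (e i) x)
      have h2 : HasFDerivAt (fun x => ψ x * fderiv ℝ G x (e i)) _ x :=
        (hψ.differentiable (by norm_num) x).hasFDerivAt.mul h1
      rw [h2.fderiv]
      simp
      ring
    have hi : ∀ i, ∫ x, exp (-V x) * (fderiv ℝ ψ x (e i) * fderiv ℝ G x (e i)) ∂ν +
        ∫ x, exp (-V x) * (ψ x * fderiv ℝ (fderiv ℝ G) x (e i) (e i)) ∂ν =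
        ∫ x, exp (-V x) * (ψ x * (inner ℝ (b x) (e i) * fderiv ℝ G x (e i))) ∂ν := by
      intro i
      have h := integral_mul_fderiv_eq_neg_fderiv_mul_of_integrable (μ := ν) (v := e i)
        (f := fun x => exp (-V x)) (g := fun x => ψ x * fderiv ℝ G x (e i)) ?_ ?_ ?_
        (fun x _ => ((hV.differentiable (by norm_num) x).neg.exp))
        (fun x _ => (hψ.differentiable (by norm_num) x).mul
          ((hG.differentiable_fderiv x).clm_apply (differentiableAt_const _)))
      · simp only [hVf, hgf, mul_add] at h
        rw [integral_add (i1 i) (i2 i), ← integral_neg] at h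
        rw [h]
        congr 1
        ext x
        ring
      · simp only [hVf]
        exact (i3 i).neg.congr (Filter.Eventually.of_forall fun x => by simp; ring)
      · simp only [hgf, mul_add]
        exact (i1 i).add (i2 i)
      · refine hdom (C₀ * A₁) (by fun_prop) fun x => ?_
        rw [abs_mul]
        exact (mul_le_mul (hψC x) (k2 i x) (abs_nonneg _) hC0).trans
          (le_mul_of_one_le_right (by positivity) (by linarith [norm_nonneg x]))
    have hsum : ∀ x, fderiv ℝ G x (b x) = ∑ i, inner ℝ (b x) (e i) * fderiv ℝ G x (e i) := by
      intro x
      conv_lhs => rw [← e.sum_repr' (b x)]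
      simp [real_inner_comm]
    rw [integral_withDensity_exp_neg hVc, integral_withDensity_exp_neg hVc]
    have e1 : ∀ x, exp (-V x) * (ψ x * generator e b G x) =
        ∑ i, (exp (-V x) * (ψ x * fderiv ℝ (fderiv ℝ G) x (e i) (e i)) -
          exp (-V x) * (ψ x * (inner ℝ (b x) (e i) * fderiv ℝ G x (e i)))) := by
      intro x
      rw [generator, hsum, ← Finset.sum_sub_distrib, Finset.mul_sum, Finset.mul_sum]
      exact Finset.sum_congr rfl fun i _ => by ring
    simp only [e1, Finset.mul_sum]
    have i5 : ∀ i, Integrable (fun x => exp (-V x) * (ψ x * fderiv ℝ (fderiv ℝ G) x (e i) (e i)) -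
        exp (-V x) * (ψ x * (inner ℝ (b x) (e i) * fderiv ℝ G x (e i)))) ν :=
      fun i => (i2 i).sub (i3 i)
    rw [integral_finsetSum _ fun i _ => i5 i, integral_finsetSum _ fun i _ => i1 i,
      ← Finset.sum_neg_distrib]
    refine Finset.sum_congr rfl fun i _ => ?_
    rw [integral_sub (i2 i) (i3 i), ← hi i]
    ring

end Gibbs

section BoundedDerivatives

variable {E F F' : Type*} [NormedAddCommGroup E] [NormedSpace ℝ E]
  [NormedAddCommGroup F] [NormedSpace ℝ F] [NormedAddCommGroup F'] [NormedSpace ℝ F']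

lemma exists_hasDerivBounds {G : E → F} (hG : ContDiff ℝ (⊤ : ℕ∞) G)
    (hb : ∀ i : ℕ, ∃ C : ℝ, ∀ x, ‖iteratedFDeriv ℝ i G x‖ ≤ C) :
    ∃ A₁ A₂ A₃, 0 ≤ A₃ ∧ HasDerivBounds A₁ A₂ A₃ G := by
  obtain ⟨A₁, h1⟩ := hb 1
  obtain ⟨A₂, h2⟩ := hb 2
  obtain ⟨A₃, h3⟩ := hb 3
  refine ⟨A₁, A₂, A₃, (norm_nonneg _).trans (h3 0), mod_cast contDiff_infty.1 hG 3,
    fun x => ?_, fun x => ?_, fun x y => ?_⟩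
  · rw [← norm_iteratedFDeriv_one]; exact h1 x
  · rw [← norm_iteratedFDeriv_one, norm_iteratedFDeriv_fderiv]; exact h2 x
  · refine convex_univ.norm_image_sub_le_of_norm_fderiv_le (𝕜 := ℝ)
      (f := fderiv ℝ (fderiv ℝ G)) (fun z _ => ?_) (fun z _ => ?_)
      (Set.mem_univ y) (Set.mem_univ x)
    · have h : ContDiff ℝ 1 (fderiv ℝ (fderiv ℝ G)) :=
        ((contDiff_infty.1 hG 3).fderiv_right (m := 2) (by norm_num)).fderiv_right (by norm_num)
      exact h.differentiable (by norm_num) z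
    · rw [← norm_iteratedFDeriv_one, norm_iteratedFDeriv_fderiv, norm_iteratedFDeriv_fderiv]
      exact h3 z

/-- Postcomposition with a smooth function preserves boundedness of all derivatives. -/
lemma exists_norm_iteratedFDeriv_comp_le [FiniteDimensional ℝ F] {G : E → F} {g : F → F'}
    (hg : ContDiff ℝ (⊤ : ℕ∞) g) (hG : ContDiff ℝ (⊤ : ℕ∞) G)
    (hb : ∀ i : ℕ, ∃ C : ℝ, ∀ x, ‖iteratedFDeriv ℝ i G x‖ ≤ C) (i : ℕ) :
    ∃ C : ℝ, ∀ x, ‖iteratedFDeriv ℝ i (g ∘ G) x‖ ≤ C := by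
  have := FiniteDimensional.proper ℝ F
  choose B hB using hb
  have hgb : ∀ j : ℕ, ∃ C : ℝ, ∀ x, ‖iteratedFDeriv ℝ j g (G x)‖ ≤ C := by
    intro j
    obtain ⟨C, hC⟩ := (isCompact_closedBall (0 : F) (B 0)).exists_bound_of_continuousOn
      (hg.continuous_iteratedFDeriv (m := j) (by exact_mod_cast le_top)).continuousOn
    refine ⟨C, fun x => hC _ ?_⟩
    have := hB 0 x
    rwa [norm_iteratedFDeriv_zero, ← mem_closedBall_zero_iff] at this
  choose K hK using hgb
  have hB0 : ∀ j, 0 ≤ B j := fun j => (norm_nonneg _).trans (hB j 0)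
  have hK0 : ∀ j, 0 ≤ K j := fun j => (norm_nonneg _).trans (hK j 0)
  set M := 1 + ∑ j ∈ Finset.range (i + 1), B j with hM
  have hM1 : 1 ≤ M := by
    have := Finset.sum_nonneg fun j (_ : j ∈ Finset.range (i + 1)) => hB0 j
    linarith
  refine ⟨i.factorial * (∑ j ∈ Finset.range (i + 1), K j) * M ^ i, fun x => ?_⟩
  refine norm_iteratedFDeriv_comp_le (N := (⊤ : ℕ∞)) hg hG (by exact_mod_cast le_top) x
    (fun j hj => (hK j x).trans ?_) (fun j hj hji => (hB j x).trans ?_)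
  · exact Finset.single_le_sum (fun j _ => hK0 j) (Finset.mem_range.2 (by omega))
  · have h1 : B j ≤ M := by
      have := Finset.single_le_sum (fun j _ => hB0 j) (Finset.mem_range.2 (by omega : j < i + 1))
      linarith
    exact h1.trans (le_self_pow₀ hM1 (by omega))

end BoundedDerivatives

section Beckner

variable {E : Type*} [NormedAddCommGroup E] [InnerProductSpace ℝ E] [FiniteDimensional ℝ E]
  [MeasurableSpace E] [BorelSpace E]
  {κ : Type*} [Fintype κ] {e : OrthonormalBasis κ ℝ E} {R m : ℝ} {b : E → E}
  {μ : Measure E}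

/-- The Beckner inequality, regularised at the zeros of `f`. -/
lemma beckner_regularized [IsProbabilityMeasure μ] (hμ : IsReversibleDrift e b μ)
    (hb : IsDrift R m b) (hR : 0 < R) {p : ℝ} (hp1 : 1 ≤ p) (hp2 : p ≤ 2) {f : E → ℝ}
    (hf : ContDiff ℝ (⊤ : ℕ∞) f)
    (hfd : ∀ i : ℕ, ∃ C : ℝ, ∀ x, ‖iteratedFDeriv ℝ i f x‖ ≤ C) {δ : ℝ} (hδ : 0 < δ) :
    ∫ x, (f x ^ 2 + δ ^ 2) ∂μ - (∫ x, (f x ^ 2 + δ ^ 2) ^ (p / 2) ∂μ) ^ (2 / p) ≤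
      (2 - p) / R * ∫ x, ‖fderiv ℝ f x‖ ^ 2 ∂μ := by
  have hp0 : 0 < p := by linarith
  have hpos : ∀ u : ℝ, 0 < u ^ 2 + δ ^ 2 := fun u => by positivity
  have hg : ContDiff ℝ (⊤ : ℕ∞) fun u : ℝ => (u ^ 2 + δ ^ 2) ^ (p / 2) :=
    ContDiff.rpow_const_of_ne (by fun_prop) fun u => (hpos u).ne'
  obtain ⟨A₁, A₂, A₃, hA, hF⟩ := exists_hasDerivBounds (hg.comp hf)
    (exists_norm_iteratedFDeriv_comp_le hg hf hfd)
  have hq : ContDiff ℝ (⊤ : ℕ∞) fun l : E →L[ℝ] ℝ => ∑ i, l (e i) * l (e i) := by fun_prop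
  have hf' : ContDiff ℝ (⊤ : ℕ∞) (fderiv ℝ f) := hf.fderiv_right (by exact_mod_cast le_top)
  obtain ⟨B₁, B₂, B₃, hB, hH⟩ := exists_hasDerivBounds (hq.comp hf')
    (exists_norm_iteratedFDeriv_comp_le hq hf' fun i => by
      simpa only [norm_iteratedFDeriv_fderiv] using hfd (i + 1))
  obtain ⟨M, hM⟩ := hfd 0
  simp only [norm_iteratedFDeriv_zero, norm_eq_abs] at hM
  have key := beckner_of_isReversibleDrift hμ hb hR hF hA hH hB
    (c := (δ ^ 2) ^ (p / 2)) (d := (M ^ 2 + δ ^ 2) ^ (p / 2)) (s := 2 / p) (D := p ^ 2)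
    (by positivity) (fun x => ⟨?_, ?_⟩) (by rw [le_div_iff₀ hp0]; linarith)
    (by rw [div_le_iff₀ hp0]; linarith) (by positivity) (fun x => ?_) (fun x => ?_)
  · simp only [Function.comp_def, sum_clm_apply_sq] at key
    have e1 : ∀ x, ((f x ^ 2 + δ ^ 2) ^ (p / 2)) ^ (2 / p) = f x ^ 2 + δ ^ 2 := fun x => by
      rw [← rpow_mul (hpos _).le, show p / 2 * (2 / p) = 1 by field_simp, rpow_one]
    simp only [e1] at key
    refine key.trans_eq ?_
    field_simp
  · exact rpow_le_rpow (by positivity) (by nlinarith) (by positivity)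
  · have := sq_le_sq' (abs_le.1 (hM x)).1 (abs_le.1 (hM x)).2
    exact rpow_le_rpow (hpos _).le (by linarith) (by positivity)
  · exact Finset.sum_nonneg fun i _ => mul_self_nonneg _
  · have h1 : HasFDerivAt ((fun u : ℝ => (u ^ 2 + δ ^ 2) ^ (p / 2)) ∘ f)
        ((p * f x * (f x ^ 2 + δ ^ 2) ^ (p / 2 - 1)) • fderiv ℝ f x) x := by
      have h2 : HasDerivAt (fun u : ℝ => (u ^ 2 + δ ^ 2) ^ (p / 2))
          (p * f x * (f x ^ 2 + δ ^ 2) ^ (p / 2 - 1)) (f x) := by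
        have h3 : HasDerivAt (fun u : ℝ => u ^ 2 + δ ^ 2) (2 * f x) (f x) := by
          simpa using (hasDerivAt_pow 2 (f x)).add_const (δ ^ 2)
        convert h3.rpow_const (p := p / 2) (Or.inl (hpos _).ne') using 1
        ring
      exact h2.comp_hasFDerivAt x (hf.differentiable (by simp) x).hasFDerivAt
    rw [h1.fderiv, norm_smul]
    simp only [Function.comp_apply, sum_clm_apply_sq]
    set u := f x ^ 2 + δ ^ 2 with hu
    have hu0 : 0 < u := hpos _
    have e2 : (u ^ (p / 2)) ^ (2 - 2 / p) = u ^ (p - 1) := by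
      rw [← rpow_mul hu0.le]
      congr 1
      field_simp
    have e3 : (u ^ (p / 2 - 1)) ^ 2 * u = u ^ (p - 1) := by
      rw [← rpow_natCast, ← rpow_mul hu0.le, ← rpow_add_one hu0.ne']
      congr 1
      push_cast
      ring
    rw [e2, mul_pow, norm_eq_abs, sq_abs, ← e3]
    have h4 : f x ^ 2 ≤ u := by rw [hu]; nlinarith
    calc _ = p ^ 2 * ((u ^ (p / 2 - 1)) ^ 2 * f x ^ 2) * ‖fderiv ℝ f x‖ ^ 2 := by ring
      _ ≤ _ := by gcongr

end Beckner

section Beckner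

variable {E : Type*} [NormedAddCommGroup E] [InnerProductSpace ℝ E] [FiniteDimensional ℝ E]
  [MeasurableSpace E] [BorelSpace E]
  {κ : Type*} [Fintype κ] {e : OrthonormalBasis κ ℝ E} {R m : ℝ} {b : E → E}
  {μ : Measure E}

lemma beckner_of_isReversibleDrift_of_contDiff [IsProbabilityMeasure μ]
    (hμ : IsReversibleDrift e b μ)
    (hb : IsDrift R m b) (hR : 0 < R) {p : ℝ} (hp1 : 1 ≤ p) (hp2 : p ≤ 2) {f : E → ℝ}
    (hf : ContDiff ℝ (⊤ : ℕ∞) f)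
    (hfd : ∀ i : ℕ, ∃ C : ℝ, ∀ x, ‖iteratedFDeriv ℝ i f x‖ ≤ C) :
    ∫ x, |f x| ^ 2 ∂μ - (∫ x, |f x| ^ p ∂μ) ^ (2 / p) ≤
      (2 - p) / R * ∫ x, ‖fderiv ℝ f x‖ ^ 2 ∂μ := by
  have hp0 : 0 < p := by linarith
  obtain ⟨M, hM⟩ := hfd 0
  simp only [norm_iteratedFDeriv_zero, norm_eq_abs] at hM
  have hfc := hf.continuous
  have hlim : ∀ {q : ℝ}, 0 < q →
      Filter.Tendsto (fun δ : ℝ => ∫ x, (f x ^ 2 + δ ^ 2) ^ q ∂μ) (nhdsWithin 0 (Set.Ioi 0))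
        (nhds (∫ x, (f x ^ 2) ^ q ∂μ)) := by
    intro q hq
    have hcont : ∀ δ : ℝ, Continuous fun x => (f x ^ 2 + δ ^ 2) ^ q := fun δ =>
      Continuous.rpow_const (by fun_prop) fun x => Or.inr hq.le
    refine tendsto_integral_filter_of_dominated_convergence (fun _ => (M ^ 2 + 1) ^ q)
      (Filter.Eventually.of_forall fun δ => (hcont δ).aestronglyMeasurable) ?_
      (integrable_const _) (Filter.Eventually.of_forall fun x => ?_)
    · filter_upwards [Ioc_mem_nhdsGT (show (0 : ℝ) < 1 by norm_num)] with δ hδ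
      refine Filter.Eventually.of_forall fun x => ?_
      have h0 : 0 ≤ f x ^ 2 + δ ^ 2 := by positivity
      have h1 := sq_le_sq' (abs_le.1 (hM x)).1 (abs_le.1 (hM x)).2
      have h2 : δ ^ 2 ≤ 1 := pow_le_one₀ hδ.1.le hδ.2
      rw [norm_of_nonneg (rpow_nonneg h0 _)]
      exact rpow_le_rpow h0 (by linarith) hq.le
    · have h : ContinuousAt (fun δ : ℝ => (f x ^ 2 + δ ^ 2) ^ q) 0 :=
        ContinuousAt.rpow_const (by fun_prop) (Or.inr hq.le)
      have := h.tendsto.mono_left (nhdsWithin_le_nhds (s := Set.Ioi 0))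
      simpa using this
  have e1 : ∀ x, (f x ^ 2) ^ (p / 2) = |f x| ^ p := fun x => by
    rw [← sq_abs, ← rpow_natCast, ← rpow_mul (abs_nonneg _)]
    congr 1
    push_cast
    ring
  have l1 := hlim one_pos
  have l2 := (hlim (half_pos hp0)).rpow_const (p := 2 / p) (Or.inr (by positivity))
  simp only [rpow_one, e1] at l1 l2
  simp only [sq_abs]
  refine le_of_tendsto (l1.sub l2) ?_
  filter_upwards [self_mem_nhdsWithin] with δ hδ
  exact beckner_regularized hμ hb hR hp1 hp2 hf hfd hδ

/-- The Beckner inequality for an unnormalised Gibbs weight. -/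
lemma beckner_exp_neg {ν : Measure E} [ν.IsAddHaarMeasure] (hR : 0 < R) {V : E → ℝ}
    (hV : ContDiff ℝ 1 V) {L C : ℝ} (hq : ∀ x, R / 2 * ‖x‖ ^ 2 - L * ‖x‖ - C ≤ V x)
    (hbV : ∀ x v, fderiv ℝ V x v = inner ℝ (b x) v) (hb : IsDrift R m b)
    {p : ℝ} (hp1 : 1 ≤ p) (hp2 : p ≤ 2) {f : E → ℝ} (hf : ContDiff ℝ (⊤ : ℕ∞) f)
    (hfd : ∀ i : ℕ, ∃ C : ℝ, ∀ x, ‖iteratedFDeriv ℝ i f x‖ ≤ C) :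
    (∫ x, exp (-V x) * |f x| ^ 2 ∂ν) / (∫ x, exp (-V x) ∂ν) -
      ((∫ x, exp (-V x) * |f x| ^ p ∂ν) / (∫ x, exp (-V x) ∂ν)) ^ (2 / p) ≤
      (2 - p) / R * ((∫ x, exp (-V x) * ‖fderiv ℝ f x‖ ^ 2 ∂ν) / (∫ x, exp (-V x) ∂ν)) := by
  have hi : Integrable (fun x => exp (-V x)) ν := by
    simpa using integrable_pow_mul_exp_neg (ν := ν) hR hV.continuous hq 0
  set Z := ∫ x, exp (-V x) ∂ν with hZ
  have hZ0 : 0 < Z := integral_exp_pos hi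
  have hV' : ContDiff ℝ 1 fun x => V x + log Z := hV.add contDiff_const
  have he : ∀ x, exp (-(V x + log Z)) = exp (-V x) / Z := fun x => by
    rw [neg_add, exp_add, exp_neg (log Z), exp_log hZ0, div_eq_mul_inv]
  have hr := isReversibleDrift_withDensity (ν := ν) (V := fun x => V x + log Z)
    (e := stdOrthonormalBasis ℝ E) (C := C - log Z) (L := L) hR hV'
    (fun x => by linarith [hq x]) (fun x v => by rw [fderiv_add_const, hbV]) hb
  have : IsProbabilityMeasure
      (ν.withDensity fun x => ENNReal.ofReal (exp (-(V x + log Z)))) := by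
    constructor
    rw [withDensity_apply _ MeasurableSet.univ, Measure.restrict_univ,
      ← ofReal_integral_eq_lintegral_ofReal (by simpa only [he] using hi.div_const Z)
        (Filter.Eventually.of_forall fun x => exp_nonneg _)]
    simp only [he]
    rw [integral_div, ← hZ, div_self hZ0.ne', ENNReal.ofReal_one]
  have key := beckner_of_isReversibleDrift_of_contDiff hr hb hR hp1 hp2 hf hfd
  have he' : ∀ x y, exp (-V x) / Z * y = exp (-V x) * y / Z := fun _ _ =>
    div_mul_eq_mul_div _ _ _
  simp only [integral_withDensity_exp_neg hV'.continuous] at key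
  simp only [he, he', integral_div] at key
  exact key

end Beckner

section Mollification

open scoped Convolution
open ContinuousLinearMap

variable {E : Type*} [NormedAddCommGroup E] [NormedSpace ℝ E] [FiniteDimensional ℝ E]
  [MeasurableSpace E] [BorelSpace E] {ν : Measure E} [ν.IsAddHaarMeasure]

lemma exists_lipschitzWith_convolution {F F' : Type*} [NormedAddCommGroup F] [NormedSpace ℝ F]
    [NormedAddCommGroup F'] [NormedSpace ℝ F'] (L : F →L[ℝ] ℝ →L[ℝ] F') {φ : E → F}
    (hφ : HasCompactSupport φ) (hφc : Continuous φ) {V : E → ℝ} {K : NNReal}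
    (hV : LipschitzWith K V) : ∃ K', LipschitzWith K' (φ ⋆[L, ν] V) := by
  have hi : ∀ x, Integrable (fun t => L (φ t) (V (x - t))) ν :=
    hφ.convolutionExists_left L hφc hV.continuous.locallyIntegrable
  have hni : Integrable (fun t => ‖φ t‖) ν := (hφc.integrable_of_hasCompactSupport hφ).norm
  refine ⟨Real.toNNReal (‖L‖ * (∫ t, ‖φ t‖ ∂ν) * K), LipschitzWith.of_dist_le_mul fun x y => ?_⟩
  rw [Real.coe_toNNReal _ (by positivity), dist_eq_norm, dist_eq_norm, convolution_def,
    convolution_def, ← integral_sub (hi x) (hi y)]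
  calc ‖∫ t, (L (φ t) (V (x - t)) - L (φ t) (V (y - t))) ∂ν‖
      ≤ ∫ t, ‖L‖ * ‖φ t‖ * (K * ‖x - y‖) ∂ν := by
        refine norm_integral_le_of_norm_le ((hni.const_mul _).mul_const _)
          (Filter.Eventually.of_forall fun t => ?_)
        rw [← map_sub]
        refine (L.le_opNorm₂ _ _).trans ?_
        gcongr
        simpa [dist_eq_norm] using hV.dist_le_mul (x - t) (y - t)
    _ = ‖L‖ * (∫ t, ‖φ t‖ ∂ν) * K * ‖x - y‖ := by
        rw [integral_mul_const, integral_const_mul]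
        ring

section Derivative

variable {F F' : Type*} [NormedAddCommGroup F] [NormedSpace ℝ F]
    [NormedAddCommGroup F'] [NormedSpace ℝ F'] (L : F →L[ℝ] ℝ →L[ℝ] F')
    {φ : E → F} {V : E → ℝ} {K : NNReal}

lemma fderiv_convolution_left (hφ : HasCompactSupport φ) (hφs : ContDiff ℝ (⊤ : ℕ∞) φ)
    (hV : LipschitzWith K V) :
    fderiv ℝ (φ ⋆[L, ν] V) = fderiv ℝ φ ⋆[L.precompL E, ν] V := funext fun x =>
  (hφ.hasFDerivAt_convolution_left L (hφs.of_le (by simp)) hV.continuous.locallyIntegrable x).fderiv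

lemma exists_lipschitzWith_fderiv_convolution (hφ : HasCompactSupport φ)
    (hφs : ContDiff ℝ (⊤ : ℕ∞) φ) (hV : LipschitzWith K V) :
    ∃ K', LipschitzWith K' (fderiv ℝ (φ ⋆[L, ν] V)) := by
  rw [fderiv_convolution_left L hφ hφs hV]
  exact exists_lipschitzWith_convolution (L.precompL E) (hφ.fderiv ℝ)
    (hφs.continuous_fderiv (by simp)) hV

lemma exists_hasDerivBounds_convolution (hφ : HasCompactSupport φ)
    (hφs : ContDiff ℝ (⊤ : ℕ∞) φ) (hV : LipschitzWith K V) :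
    ∃ A₁ A₂ A₃, HasDerivBounds A₁ A₂ A₃ (φ ⋆[L, ν] V) := by
  have hs : ContDiff ℝ 3 (φ ⋆[L, ν] V) :=
    hφ.contDiff_convolution_left (n := 3) L (mod_cast contDiff_infty.1 hφs 3)
      hV.continuous.locallyIntegrable
  obtain ⟨K₁, h1⟩ := exists_lipschitzWith_convolution (ν := ν) L hφ hφs.continuous hV
  obtain ⟨K₂, h2⟩ := exists_lipschitzWith_fderiv_convolution (ν := ν) L hφ hφs hV
  obtain ⟨K₃, h3⟩ := exists_lipschitzWith_fderiv_convolution (ν := ν) (L.precompL E)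
    (hφ.fderiv ℝ) (hφs.fderiv_right (by exact_mod_cast le_top)) hV
  rw [← fderiv_convolution_left L hφ hφs hV] at h3
  exact ⟨K₁, K₂, K₃, hs, fun x => norm_fderiv_le_of_lipschitz ℝ h1,
    fun x => norm_fderiv_le_of_lipschitz ℝ h2,
    fun x y => by simpa only [dist_eq_norm] using h3.dist_le_mul x y⟩

end Derivative

/-- A Lipschitz convex function is uniformly close to a smooth convex function whose derivatives
of all orders needed here are bounded. -/
lemma exists_convex_hasDerivBounds_near {V : E → ℝ} {K : NNReal} (hV : LipschitzWith K V)
    (hconv : ConvexOn ℝ Set.univ V) {ε : ℝ} (hε : 0 < ε) :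
    ∃ (W : E → ℝ) (A₁ A₂ A₃ : ℝ), ContDiff ℝ (⊤ : ℕ∞) W ∧ HasDerivBounds A₁ A₂ A₃ (fderiv ℝ W) ∧
      ConvexOn ℝ Set.univ W ∧ ∀ x, |W x - V x| ≤ ε := by
  let ν : Measure E := Measure.addHaar
  set δ : ℝ := ε / (K + 1) with hδ
  have hδ0 : 0 < δ := by positivity
  let ψ : ContDiffBump (0 : E) := ⟨δ / 2, δ, by positivity, by linarith⟩
  set φ : E → ℝ := ψ.normed ν with hφdef
  have hφ : HasCompactSupport φ := ψ.hasCompactSupport_normed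
  have hφs : ContDiff ℝ (⊤ : ℕ∞) φ := ψ.contDiff_normed
  have hφ0 : ∀ t, 0 ≤ φ t := ψ.nonneg_normed
  have hφ1 : ∫ t, φ t ∂ν = 1 := ψ.integral_normed
  have hloc : LocallyIntegrable V ν := hV.continuous.locallyIntegrable
  set L := lsmul ℝ ℝ (E := ℝ) with hL
  have hW : ContDiff ℝ (⊤ : ℕ∞) (φ ⋆[L, ν] V) := hφ.contDiff_convolution_left L hφs hloc
  have hφs1 : ContDiff ℝ (⊤ : ℕ∞) (fderiv ℝ φ) := hφs.fderiv_right (by exact_mod_cast le_top)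
  obtain ⟨A₁, A₂, A₃, hA⟩ := exists_hasDerivBounds_convolution (ν := ν) (L.precompL E)
    (hφ.fderiv ℝ) hφs1 hV
  rw [← fderiv_convolution_left L hφ hφs hV] at hA
  have hi : ∀ x, Integrable (fun t => φ t * V (x - t)) ν :=
    hφ.convolutionExists_left L hφs.continuous hloc
  have hφi : Integrable φ ν := hφs.continuous.integrable_of_hasCompactSupport hφ
  refine ⟨φ ⋆[L, ν] V, A₁, A₂, A₃, hW, hA, ⟨convex_univ, ?_⟩, fun x => ?_⟩
  · intro x _ y _ a b ha hb hab
    simp only [convolution_def, hL, lsmul_apply, smul_eq_mul]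
    rw [← integral_const_mul, ← integral_const_mul,
      ← integral_add ((hi x).const_mul a) ((hi y).const_mul b)]
    refine integral_mono (hi _) (((hi x).const_mul a).add ((hi y).const_mul b)) fun t => ?_
    have h := hconv.2 (Set.mem_univ (x - t)) (Set.mem_univ (y - t)) ha hb hab
    rw [show a • (x - t) + b • (y - t) = a • x + b • y - t by
      rw [smul_sub, smul_sub, sub_add_sub_comm, ← add_smul, hab, one_smul]] at h
    simp only [smul_eq_mul] at h
    nlinarith [mul_le_mul_of_nonneg_left h (hφ0 t)]
  · have hVx : V x = ∫ t, φ t * V x ∂ν := by rw [integral_mul_const, hφ1, one_mul]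
    simp only [convolution_def, hL, lsmul_apply, smul_eq_mul]
    rw [hVx, ← integral_sub (hi x) (hφi.mul_const _), ← Real.norm_eq_abs]
    calc ‖∫ t, (φ t * V (x - t) - φ t * V x) ∂ν‖ ≤ ∫ t, φ t * ε ∂ν := by
          refine norm_integral_le_of_norm_le (hφi.mul_const _)
            (Filter.Eventually.of_forall fun t => ?_)
          rw [← mul_sub, norm_mul, norm_of_nonneg (hφ0 t)]
          by_cases ht : t ∈ Function.support φ
          · refine mul_le_mul_of_nonneg_left ?_ (hφ0 t)
            rw [hφdef, ψ.support_normed_eq, mem_ball_zero_iff] at ht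
            have h := hV.dist_le_mul (x - t) x
            simp only [dist_eq_norm, sub_sub_cancel_left, norm_neg] at h
            have ht' : ‖t‖ ≤ δ := ht.le
            refine h.trans ((mul_le_mul_of_nonneg_left ht' K.2).trans ?_)
            rw [hδ, NNReal.val_eq_coe, ← mul_div_assoc, div_le_iff₀ (by positivity)]
            nlinarith [K.2]
          · rw [Function.notMem_support.1 ht, zero_mul, zero_mul]
      _ = ε := by rw [integral_mul_const, hφ1, one_mul]

end Mollification

section Convex

variable {E : Type*} [NormedAddCommGroup E] [NormedSpace ℝ E]

lemma ConvexOn.add_fderiv_le {W : E → ℝ} (hW : ConvexOn ℝ Set.univ W) (hd : Differentiable ℝ W)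
    (x y : E) : W y + fderiv ℝ W y (x - y) ≤ W x := by
  have hc : ConvexOn ℝ Set.univ (W ∘ AffineMap.lineMap (k := ℝ) y x) :=
    hW.comp_affineMap (AffineMap.lineMap y x)
  have h : HasDerivAt (W ∘ AffineMap.lineMap (k := ℝ) y x) (fderiv ℝ W y (x - y)) 0 := by
    have h1 : HasFDerivAt W (fderiv ℝ W y) (AffineMap.lineMap y x (0 : ℝ)) := by
      rw [AffineMap.lineMap_apply_zero]; exact (hd y).hasFDerivAt
    exact h1.comp_hasDerivAt 0 AffineMap.hasDerivAt_lineMap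
  have := hc.le_slope_of_hasDerivAt (Set.mem_univ 0) (Set.mem_univ 1) one_pos h
  rw [slope_def_field] at this
  simp only [Function.comp_apply, AffineMap.lineMap_apply_zero, AffineMap.lineMap_apply_one,
    sub_zero, div_one] at this
  linarith

/-- A function with continuously varying supporting affine functions agrees on any given ball with
a globally Lipschitz convex function. -/
lemma exists_lipschitzWith_convexOn_eq [ProperSpace E] {V : E → ℝ} {ℓ : E → E →L[ℝ] ℝ}
    (hℓ : Continuous ℓ)
    (hV : ∀ x y, V y + ℓ y (x - y) ≤ V x) {N : ℝ} (hN : 0 ≤ N) :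
    ∃ (W : E → ℝ) (K : NNReal), LipschitzWith K W ∧ ConvexOn ℝ Set.univ W ∧
      (∀ x, ‖x‖ ≤ N → W x = V x) ∧ ∀ x, V 0 + ℓ 0 x ≤ W x := by
  obtain ⟨K, hK⟩ := (isCompact_closedBall (0 : E) N).exists_bound_of_continuousOn hℓ.continuousOn
  let B := Metric.closedBall (0 : E) N
  have hB0 : (0 : E) ∈ B := by simpa [B] using hN
  have : Nonempty B := ⟨⟨0, hB0⟩⟩
  let W : E → ℝ := fun x => ⨆ y : B, V y + ℓ y (x - y)
  have hbdd : ∀ x, BddAbove (Set.range fun y : B => V y + ℓ y (x - y)) := fun x =>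
    ⟨V x, by rintro _ ⟨y, rfl⟩; exact hV x y⟩
  have hle : ∀ x, ∀ y ∈ B, V y + ℓ y (x - y) ≤ W x := fun x y hy => le_ciSup (hbdd x) ⟨y, hy⟩
  have hK0 : 0 ≤ K := (norm_nonneg _).trans (hK 0 hB0)
  have hlip : ∀ x z, W x ≤ W z + K * ‖x - z‖ := fun x z => ciSup_le fun y => by
    have h1 := (le_abs_self _).trans (((ℓ y).le_opNorm (x - z)).trans
      (mul_le_mul_of_nonneg_right (hK y y.2) (norm_nonneg _)))
    have h2 := hle z y y.2
    have h3 : ℓ y (x - y) = ℓ y (x - z) + ℓ y (z - y) := by rw [← map_add, sub_add_sub_cancel]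
    linarith
  refine ⟨W, K.toNNReal, LipschitzWith.of_dist_le_mul fun x z => ?_, ⟨convex_univ, ?_⟩,
    fun x hx => le_antisymm (ciSup_le fun y => hV x y) ?_, fun x => ?_⟩
  · rw [Real.coe_toNNReal _ hK0, Real.dist_eq, dist_eq_norm, abs_sub_le_iff]
    have := hlip z x
    rw [norm_sub_rev] at this
    constructor <;> linarith [hlip x z]
  · intro x _ z _ a b ha hb hab
    refine ciSup_le fun y => ?_
    have h1 := mul_le_mul_of_nonneg_left (hle x y y.2) ha
    have h2 := mul_le_mul_of_nonneg_left (hle z y y.2) hb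
    have h3 : ℓ y (a • x + b • z - y) = a * ℓ y (x - y) + b * ℓ y (z - y) := by
      simp only [map_sub, map_add, map_smul, smul_eq_mul]
      linear_combination ℓ y (y : E) * hab
    simp only [smul_eq_mul]
    rw [h3]
    have h4 : V y = a * V y + b * V y := by rw [← add_mul, hab, one_mul]
    linarith
  · simpa using hle x x (by simpa [B] using hx)
  · simpa using hle x 0 hB0

end Convex

section Approximation

variable {E : Type*} [NormedAddCommGroup E] [InnerProductSpace ℝ E] [FiniteDimensional ℝ E]

omit [FiniteDimensional ℝ E] in
lemma HasDerivBounds.smul_id_add_clm {F : Type*} [NormedAddCommGroup F] [NormedSpace ℝ F]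
    {A₁ A₂ A₃ : ℝ} {G : E → F} (hG : HasDerivBounds A₁ A₂ A₃ G) {R : ℝ} (hR : 0 ≤ R)
    (Λ : F →L[ℝ] E) :
    HasDerivBounds (R + ‖Λ‖ * A₁) (‖Λ‖ * A₂) (‖Λ‖ * A₃) fun x => R • x + Λ (G x) := by
  have d1 : fderiv ℝ (fun x => R • x + Λ (G x)) =
      fun x => R • ContinuousLinearMap.id ℝ E + ContinuousLinearMap.compL ℝ E F E Λ (fderiv ℝ G x) :=
    funext fun x => (((hasFDerivAt_id x).const_smul R).add
      (Λ.hasFDerivAt.comp x (hG.differentiable x).hasFDerivAt)).fderiv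
  have d2 : ∀ x, fderiv ℝ (fderiv ℝ fun x => R • x + Λ (G x)) x =
      (ContinuousLinearMap.compL ℝ E F E Λ).comp (fderiv ℝ (fderiv ℝ G) x) := fun x => by
    rw [d1, fderiv_const_add]
    exact ((ContinuousLinearMap.compL ℝ E F E Λ).hasFDerivAt.comp x
      (hG.differentiable_fderiv x).hasFDerivAt).fderiv
  have hΛ : ‖ContinuousLinearMap.compL ℝ E F E Λ‖ ≤ ‖Λ‖ :=
    ContinuousLinearMap.opNorm_le_bound _ (norm_nonneg _) fun T => Λ.opNorm_comp_le T
  refine ⟨?_, fun x => ?_, fun x => ?_, fun x y => ?_⟩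
  · exact (contDiff_const.smul contDiff_id).add (Λ.contDiff.comp hG.contDiff)
  · rw [d1]
    refine (norm_add_le _ _).trans (add_le_add ?_ ?_)
    · rw [norm_smul, norm_of_nonneg hR]
      exact mul_le_of_le_one_right hR ContinuousLinearMap.norm_id_le
    · exact (Λ.opNorm_comp_le _).trans (mul_le_mul_of_nonneg_left (hG.first x) (norm_nonneg _))
  · rw [d2]
    exact (ContinuousLinearMap.opNorm_comp_le _ _).trans
      (mul_le_mul hΛ (hG.second x) (norm_nonneg (fderiv ℝ (fderiv ℝ G) x)) (norm_nonneg _))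
  · rw [d2, d2, ← ContinuousLinearMap.comp_sub, mul_assoc]
    exact (ContinuousLinearMap.opNorm_comp_le _ _).trans
      (mul_le_mul hΛ (hG.lip x y) (norm_nonneg (fderiv ℝ (fderiv ℝ G) x - _)) (norm_nonneg _))

lemma exists_inner_eq_apply : ∃ Λ : (E →L[ℝ] ℝ) →L[ℝ] E, ∀ ℓ v, inner ℝ (Λ ℓ) v = ℓ v := by
  let e := stdOrthonormalBasis ℝ E
  refine ⟨∑ i, (ContinuousLinearMap.apply ℝ ℝ (e i)).smulRight (e i), fun ℓ v => ?_⟩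
  conv_rhs => rw [← e.sum_repr' v, map_sum]
  simp [sum_inner, inner_smul_left, mul_comm]

/-- A smooth convex function with bounded higher derivatives gives, after adding a quadratic, a
strongly monotone gradient field. -/
lemma exists_isDrift_of_convexOn {R : ℝ} (hR : 0 ≤ R) {W : E → ℝ} {A₁ A₂ A₃ : ℝ}
    (hd : Differentiable ℝ W)
    (hW : HasDerivBounds A₁ A₂ A₃ (fderiv ℝ W)) (hconv : ConvexOn ℝ Set.univ W) :
    ∃ (m : ℝ) (b : E → E), IsDrift R m b ∧
      ∀ x v, fderiv ℝ (fun x => R / 2 * ‖x‖ ^ 2 + W x) x v = inner ℝ (b x) v := by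
  obtain ⟨Λ, hΛ⟩ := exists_inner_eq_apply (E := E)
  refine ⟨max (R + ‖Λ‖ * A₁) (max (‖Λ‖ * A₂) (‖Λ‖ * A₃)), fun x => R • x + Λ (fderiv ℝ W x),
    ⟨(hW.smul_id_add_clm hR Λ).mono (le_max_left _ _) ((le_max_left _ _).trans (le_max_right _ _))
      ((le_max_right _ _).trans (le_max_right _ _)), fun x y => ?_, ?_⟩, fun x v => ?_⟩
  · have h1 := hconv.add_fderiv_le hd x y
    have h2 := hconv.add_fderiv_le hd y x
    rw [show R • x + Λ (fderiv ℝ W x) - (R • y + Λ (fderiv ℝ W y)) =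
      R • (x - y) + (Λ (fderiv ℝ W x) - Λ (fderiv ℝ W y)) by rw [smul_sub]; abel,
      inner_add_left, inner_sub_left, hΛ, hΛ, real_inner_smul_left, real_inner_self_eq_norm_sq]
    rw [map_sub] at h1 h2 ⊢
    rw [map_sub]
    linarith
  · exact (le_add_of_nonneg_right (mul_nonneg (norm_nonneg Λ) hW.first_nonneg)).trans
      (le_max_left _ _)
  · have h : HasFDerivAt (fun x : E => R / 2 * ‖x‖ ^ 2 + W x)
        ((R / 2) • (2 • innerSL ℝ x) + fderiv ℝ W x) x :=
      ((hasStrictFDerivAt_norm_sq x).hasFDerivAt.const_mul (R / 2)).add (hd x).hasFDerivAt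
    rw [h.fderiv, inner_add_left, hΛ, real_inner_smul_left]
    simp
    ring

/-- Approximation of a strongly convex potential by potentials with regular drift. -/
lemma exists_isDrift_near {R : ℝ} (hR : 0 ≤ R) {U : E → ℝ} {ℓ : E → E →L[ℝ] ℝ}
    (hℓ : Continuous ℓ) (hU : ∀ x y, U y + ℓ y (x - y) + R / 2 * ‖x - y‖ ^ 2 ≤ U x)
    {N ε : ℝ} (hN : 0 ≤ N) (hε : 0 < ε) :
    ∃ (V : E → ℝ) (m : ℝ) (b : E → E), ContDiff ℝ 1 V ∧ IsDrift R m b ∧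
      (∀ x v, fderiv ℝ V x v = inner ℝ (b x) v) ∧
      (∀ x, R / 2 * ‖x‖ ^ 2 - ‖ℓ 0‖ * ‖x‖ - (ε - U 0) ≤ V x) ∧
      ∀ x, ‖x‖ ≤ N → |V x - U x| ≤ ε := by
  borelize E
  have htan : ∀ x y, (U y - R / 2 * ‖y‖ ^ 2) + (ℓ y - R • innerSL ℝ y) (x - y) ≤
      U x - R / 2 * ‖x‖ ^ 2 := fun x y => by
    have h1 := hU x y
    have h2 : (ℓ y - R • innerSL ℝ y) (x - y) = ℓ y (x - y) - R * (inner ℝ y x - ‖y‖ ^ 2) := by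
      rw [← real_inner_self_eq_norm_sq, ← inner_sub_right]
      simp
    rw [norm_sub_sq_real, real_inner_comm] at h1
    rw [h2]
    linarith
  obtain ⟨W₀, K, hlip, hconv, heq, hlow⟩ := exists_lipschitzWith_convexOn_eq
    (V := fun x => U x - R / 2 * ‖x‖ ^ 2) (hℓ.sub ((innerSL ℝ).continuous.const_smul R)) htan hN
  obtain ⟨W, A₁, A₂, A₃, hWs, hW, hWc, hnear⟩ := exists_convex_hasDerivBounds_near hlip hconv hε
  obtain ⟨m, b, hb, hbV⟩ := exists_isDrift_of_convexOn hR (hWs.differentiable (by simp)) hW hWc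
  refine ⟨fun x => R / 2 * ‖x‖ ^ 2 + W x, m, b, ?_, hb, hbV, fun x => ?_, fun x hx => ?_⟩
  · exact (contDiff_const.mul (contDiff_norm_sq ℝ)).add (hWs.of_le (by simp))
  · have h1 := hlow x
    have h2 := (abs_le.1 (hnear x)).1
    have h3 := (neg_abs_le _).trans' (neg_le_neg ((ℓ 0).le_opNorm x))
    simp at h1
    linarith
  · have := hnear x
    rw [heq x hx] at this
    convert this using 2
    ring

end Approximation

section Potential

variable {E : Type*} [NormedAddCommGroup E] [InnerProductSpace ℝ E]

lemma add_fderiv_add_norm_sq_le {R : ℝ} {U : E → ℝ} (hU : ContDiff ℝ 2 U)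
    (hHess : ∀ x v : E, R * ‖v‖ ^ 2 ≤ fderiv ℝ (fderiv ℝ U) x v v) (x y : E) :
    U y + fderiv ℝ U y (x - y) + R / 2 * ‖x - y‖ ^ 2 ≤ U x := by
  set d := x - y with hd
  have hline : ∀ t : ℝ, HasDerivAt (fun t : ℝ => y + t • d) d t := fun t => by
    simpa using ((hasDerivAt_id t).smul_const d).const_add y
  have hU' : Differentiable ℝ (fderiv ℝ U) :=
    (hU.fderiv_right (m := 1) (by norm_num)).differentiable (by norm_num)
  have h1 : ∀ t : ℝ, HasDerivAt (fun t : ℝ => U (y + t • d) - R / 2 * ‖d‖ ^ 2 * t ^ 2)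
      (fderiv ℝ U (y + t • d) d - R * ‖d‖ ^ 2 * t) t := fun t => by
    have ha : HasDerivAt (fun t : ℝ => U (y + t • d)) (fderiv ℝ U (y + t • d) d) t :=
      ((hU.differentiable (by norm_num)) _).hasFDerivAt.comp_hasDerivAt t (hline t)
    refine (ha.sub ((hasDerivAt_pow 2 t).const_mul (R / 2 * ‖d‖ ^ 2))).congr_deriv ?_
    simp
    ring
  have h2 : ∀ t : ℝ, HasDerivAt (fun t : ℝ => fderiv ℝ U (y + t • d) d - R * ‖d‖ ^ 2 * t)
      (fderiv ℝ (fderiv ℝ U) (y + t • d) d d - R * ‖d‖ ^ 2) t := fun t => by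
    have ha : HasDerivAt (fun t : ℝ => fderiv ℝ U (y + t • d))
        (fderiv ℝ (fderiv ℝ U) (y + t • d) d) t :=
      (hU' _).hasFDerivAt.comp_hasDerivAt t (hline t)
    have hb : HasDerivAt (fun t : ℝ => fderiv ℝ U (y + t • d) d)
        (fderiv ℝ (fderiv ℝ U) (y + t • d) d d) t :=
      (ContinuousLinearMap.apply ℝ ℝ d).hasFDerivAt.comp_hasDerivAt t ha
    exact (hb.sub ((hasDerivAt_id t).const_mul (R * ‖d‖ ^ 2))).congr_deriv (by simp)
  have e1 : deriv (fun t : ℝ => U (y + t • d) - R / 2 * ‖d‖ ^ 2 * t ^ 2) =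
      fun t : ℝ => fderiv ℝ U (y + t • d) d - R * ‖d‖ ^ 2 * t := funext fun t => (h1 t).deriv
  have hc : ConvexOn ℝ Set.univ (fun t : ℝ => U (y + t • d) - R / 2 * ‖d‖ ^ 2 * t ^ 2) := by
    refine convexOn_of_deriv2_nonneg' convex_univ
      (fun t _ => (h1 t).differentiableAt.differentiableWithinAt) ?_ fun t _ => ?_
    · rw [e1]
      exact fun t _ => (h2 t).differentiableAt.differentiableWithinAt
    · rw [Function.iterate_succ, Function.iterate_one, Function.comp_apply, e1, (h2 t).deriv]
      linarith [hHess (y + t • d) d]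
  have h := hc.le_slope_of_hasDerivAt (Set.mem_univ 0) (Set.mem_univ 1) one_pos (h1 0)
  rw [slope_def_field] at h
  simp only [zero_smul, one_smul, add_zero, mul_zero, sub_zero, one_pow, mul_one, div_one] at h
  rw [hd, add_sub_cancel, ← hd] at h
  norm_num at h
  linarith

variable [FiniteDimensional ℝ E] [MeasurableSpace E] [BorelSpace E]

lemma tendsto_integral_exp_neg_mul {ν : Measure E} [ν.IsAddHaarMeasure] {R L C M : ℝ} (hR : 0 < R)
    {V : ℕ → E → ℝ} {U g : E → ℝ} (hV : ∀ k, Continuous (V k))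
    (hq : ∀ k x, R / 2 * ‖x‖ ^ 2 - L * ‖x‖ - C ≤ V k x)
    (hVU : ∀ x, Filter.Tendsto (fun k => V k x) Filter.atTop (nhds (U x))) (hg : Continuous g)
    (hM : ∀ x, |g x| ≤ M) :
    Filter.Tendsto (fun k => ∫ x, exp (-V k x) * g x ∂ν) Filter.atTop
      (nhds (∫ x, exp (-U x) * g x ∂ν)) := by
  have hi : Integrable (fun x => exp (-(R / 2 * ‖x‖ ^ 2 - L * ‖x‖ - C))) ν := by
    simpa using integrable_pow_mul_exp_neg (ν := ν) (V := fun x => R / 2 * ‖x‖ ^ 2 - L * ‖x‖ - C)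
      hR (by fun_prop) (fun x => le_rfl) 0
  refine tendsto_integral_of_dominated_convergence
    (fun x => exp (-(R / 2 * ‖x‖ ^ 2 - L * ‖x‖ - C)) * M)
    (fun k => ((hV k).neg.rexp.mul hg).aestronglyMeasurable) (hi.mul_const M)
    (fun k => Filter.Eventually.of_forall fun x => ?_)
    (Filter.Eventually.of_forall fun x =>
      ((continuous_exp.tendsto _).comp (hVU x).neg).mul_const (g x))
  rw [norm_mul, norm_of_nonneg (exp_nonneg _), norm_eq_abs]
  exact mul_le_mul (exp_le_exp.2 (neg_le_neg (hq k x))) (hM x) (abs_nonneg _) (exp_nonneg _)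

end Potential

/-- Beckner–Sobolev inequality for uniformly log-concave measures:
for `1 ≤ p ≤ 2` and `dμ = e^{-U} dx` with `Hess U ≥ R·Id`,
`∫ |f|² dμ − (∫ |f|^p dμ)^{2/p} ≤ ((2−p)/R) ∫ ‖∇f‖² dμ`. -/
theorem stmt_11 (n : ℕ) (R : ℝ) (hR : 0 < R)
    (U : EuclideanSpace ℝ (Fin n) → ℝ) (hU : ContDiff ℝ (⊤ : ℕ∞) U)
    (hHess : ∀ x v : EuclideanSpace ℝ (Fin n), R * ‖v‖ ^ 2 ≤ fderiv ℝ (fderiv ℝ U) x v v)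
    (μ : Measure (EuclideanSpace ℝ (Fin n)))
    (hμ : μ = volume.withDensity (fun x => ENNReal.ofReal (Real.exp (-U x))))
    (hprob : IsProbabilityMeasure μ)
    (p : ℝ) (hp1 : 1 ≤ p) (hp2 : p ≤ 2)
    (f : EuclideanSpace ℝ (Fin n) → ℝ)
    (hf : ContDiff ℝ (⊤ : ℕ∞) f)
    (hfd : ∀ i : ℕ, ∃ C : ℝ, ∀ x, ‖iteratedFDeriv ℝ i f x‖ ≤ C) :
    ∫ x, |f x| ^ 2 ∂μ - (∫ x, |f x| ^ p ∂μ) ^ ((2 : ℝ) / p)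
      ≤ ((2 - p) / R) * ∫ x, ‖fderiv ℝ f x‖ ^ 2 ∂μ := by
  have hp0 : 0 < p := by linarith
  have hUc := hU.continuous
  have htan := add_fderiv_add_norm_sq_le (mod_cast contDiff_infty.1 hU 2) hHess
  have hε : ∀ k : ℕ, (0 : ℝ) < 1 / (k + 1) := fun k => by positivity
  choose V m b hV hb hbV hq hnear using fun k : ℕ => exists_isDrift_near hR.le
    (hU.continuous_fderiv (by simp)) htan (N := k) (Nat.cast_nonneg k) (hε k)
  have hq' : ∀ k x, R / 2 * ‖x‖ ^ 2 - ‖fderiv ℝ U 0‖ * ‖x‖ - (1 - U 0) ≤ V k x := fun k x => by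
    have h : (1 : ℝ) / (k + 1) ≤ 1 := by
      rw [div_le_one (by positivity)]
      linarith [Nat.cast_nonneg (α := ℝ) k]
    linarith [hq k x]
  have hVU : ∀ x, Filter.Tendsto (fun k => V k x) Filter.atTop (nhds (U x)) := fun x => by
    rw [tendsto_iff_norm_sub_tendsto_zero]
    refine squeeze_zero' (Filter.Eventually.of_forall fun k => norm_nonneg _) ?_
      (tendsto_one_div_add_atTop_nhds_zero_nat (𝕜 := ℝ))
    filter_upwards [Filter.eventually_ge_atTop ⌈‖x‖⌉₊] with k hk
    exact hnear k x (Nat.ceil_le.1 hk)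
  obtain ⟨M, hM⟩ := hfd 0
  obtain ⟨M', hM'⟩ := hfd 1
  simp only [norm_iteratedFDeriv_zero, norm_iteratedFDeriv_one, norm_eq_abs] at hM hM'
  have hfc := hf.continuous
  have hfc' : Continuous (fderiv ℝ f) := hf.continuous_fderiv (by simp)
  have lim := fun {g : EuclideanSpace ℝ (Fin n) → ℝ} {M : ℝ} (hg : Continuous g)
    (hM : ∀ x, |g x| ≤ M) =>
    tendsto_integral_exp_neg_mul (ν := volume) hR (fun k => (hV k).continuous) hq' hVU hg hM
  have l0 := lim (g := fun _ => 1) (M := 1) continuous_const (by simp)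
  have l1 := lim (g := fun x => |f x| ^ 2) (M := M ^ 2) (by fun_prop) fun x => by
    rw [abs_of_nonneg (by positivity)]
    exact pow_le_pow_left₀ (abs_nonneg _) (hM x) 2
  have l2 := lim (g := fun x => |f x| ^ p) (M := M ^ p)
    (hfc.abs.rpow_const fun _ => Or.inr hp0.le) fun x => by
      rw [abs_of_nonneg (by positivity)]
      exact rpow_le_rpow (abs_nonneg _) (hM x) hp0.le
  have l3 := lim (g := fun x => ‖fderiv ℝ f x‖ ^ 2) (M := M' ^ 2) (by fun_prop) fun x => by
    rw [abs_of_nonneg (by positivity)]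
    exact pow_le_pow_left₀ (norm_nonneg _) (hM' x) 2
  subst hμ
  simp only [← integral_withDensity_exp_neg hUc] at l0 l1 l2 l3
  rw [integral_const, probReal_univ, one_smul] at l0
  simp only [mul_one] at l0
  have r := le_of_tendsto_of_tendsto' ((l1.div l0 one_ne_zero).sub
    ((l2.div l0 one_ne_zero).rpow_const (p := 2 / p) (Or.inr (by positivity))))
    ((l3.div l0 one_ne_zero).const_mul ((2 - p) / R))
    fun k => beckner_exp_neg hR (hV k) (hq' k) (hbV k) (hb k) hp1 hp2 hf hfd
  simpa only [div_one] using r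
end

section
/- For all real numbers x > 0 and y ≥ 0, the pointwise inequality x^{3/2} − (1/√2)·(2x − √(x² + y²))·√(x + √(x² + y²)) ≤ (3/8)·x^{−1/2}·y² holds, with equality if and only if y = 0. -/
open Real

/-- The integrand gap in the variables `s = √x` and `u = √((x + √(x² + y²)) / 2)`. -/
lemma beckner_gap_eq {s : ℝ} (hs : s ≠ 0) (u : ℝ) :
    3 / 8 * s⁻¹ * (4 * u ^ 2 * (u ^ 2 - s ^ 2)) - (s ^ 3 - (3 * s ^ 2 - 2 * u ^ 2) * u)
      = (u - s) ^ 2 * ((3 / 2 * u ^ 2 + u * s - s ^ 2) / s) := by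
  field_simp
  ring

/-- pointwise inequality
`x^{3/2} − (1/√2)(2x − √(x²+y²))√(x + √(x²+y²)) ≤ (3/8) x^{−1/2} y²`
for `x > 0`, `y ≥ 0`, with equality if and only if `y = 0`. -/
theorem stmt_12 (x y : ℝ) (hx : 0 < x) (hy : 0 ≤ y) :
    x ^ ((3 : ℝ) / 2)
        - 1 / Real.sqrt 2 * (2 * x - Real.sqrt (x ^ 2 + y ^ 2))
          * Real.sqrt (x + Real.sqrt (x ^ 2 + y ^ 2))
      ≤ 3 / 8 * x ^ (-(1 : ℝ) / 2) * y ^ 2 ∧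
    (x ^ ((3 : ℝ) / 2)
        - 1 / Real.sqrt 2 * (2 * x - Real.sqrt (x ^ 2 + y ^ 2))
          * Real.sqrt (x + Real.sqrt (x ^ 2 + y ^ 2))
      = 3 / 8 * x ^ (-(1 : ℝ) / 2) * y ^ 2 ↔ y = 0) := by
  set r := √(x ^ 2 + y ^ 2) with hr
  set s := √x with hs
  set u := √((x + r) / 2) with hu
  have hs0 : 0 < s := Real.sqrt_pos.2 hx
  have hs2 : s ^ 2 = x := Real.sq_sqrt hx.le
  have hr2 : r ^ 2 = x ^ 2 + y ^ 2 := Real.sq_sqrt (by positivity)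
  have hxr : x ≤ r := Real.le_sqrt_of_sq_le (by nlinarith [sq_nonneg y])
  have hu2 : u ^ 2 = (x + r) / 2 := Real.sq_sqrt (by linarith)
  have hsu : s ≤ u := Real.sqrt_le_sqrt (by linarith)
  have hpow : x ^ ((3 : ℝ) / 2) = s ^ 3 := by
    rw [hs, Real.sqrt_eq_rpow, ← Real.rpow_mul_natCast hx.le]
    norm_num
  have hinv : x ^ (-(1 : ℝ) / 2) = s⁻¹ := by
    rw [hs, Real.sqrt_eq_rpow, ← Real.rpow_neg hx.le]
    norm_num
  have hroot : √(x + r) = √2 * u := by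
    rw [hu, ← Real.sqrt_mul (by norm_num)]
    congr 1
    ring
  have hprod : 1 / √2 * (2 * x - r) * √(x + r) = (3 * s ^ 2 - 2 * u ^ 2) * u := by
    rw [hroot, hs2, hu2]
    field_simp
    ring
  have hy2 : y ^ 2 = 4 * u ^ 2 * (u ^ 2 - s ^ 2) := by
    rw [hu2, hs2]
    linarith
  have hgap := beckner_gap_eq hs0.ne' u
  have hpos : 0 < (3 / 2 * u ^ 2 + u * s - s ^ 2) / s :=
    div_pos (by nlinarith) hs0
  rw [hpow, hinv, hprod]
  refine ⟨?_, fun h => ?_, fun h => ?_⟩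
  · rw [hy2]
    linarith [mul_nonneg (sq_nonneg (u - s)) hpos.le]
  · rw [hy2] at h
    have hus : u - s = 0 := pow_eq_zero_iff two_ne_zero |>.1 <|
      (mul_eq_zero.1 (hgap.symm.trans (by linarith))).resolve_right hpos.ne'
    rw [sub_eq_zero.1 hus, sub_self, mul_zero] at hy2
    exact pow_eq_zero_iff two_ne_zero |>.1 hy2
  · have hrx : r = x := by rw [hr, h]; simp [Real.sqrt_sq hx.le]
    have hus : u = s := by rw [hu, hrx, hs]; congr 1; ring
    rw [h, hus]
    ring
end

section
/- Let M(x,y) = (1/√2)·(2x − √(x² + y²))·√(x + √(x² + y²)) for x ≥ 0, y ≥ 0. Then for all x > 0 and y > 0 the 2×2 matrix [[M_xx + M_y/y, M_xy], [M_xy, M_yy]] equals (3√2/(8·√(x²+y²))) · [[−y²/(x+√(x²+y²))^{3/2}, y/√(x+√(x²+y²))], [y/√(x+√(x²+y²)), −√(x+√(x²+y²))]], and this matrix is negative semidefinite with determinant zero. -/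
open MeasureTheory Real

/-- Negative semidefiniteness of a real matrix. -/
def Matrix.NegSemidef' {n : Type*} [Fintype n] (A : Matrix n n ℝ) : Prop :=
  (-A).PosSemidef

/-- Partial derivative `M_x`. -/
noncomputable def Mx (M : ℝ → ℝ → ℝ) (x y : ℝ) : ℝ := deriv (fun s => M s y) x

/-- Partial derivative `M_y`. -/
noncomputable def My (M : ℝ → ℝ → ℝ) (x y : ℝ) : ℝ := deriv (fun s => M x s) y

/-- Partial derivative `M_xx`. -/
noncomputable def Mxx (M : ℝ → ℝ → ℝ) (x y : ℝ) : ℝ := deriv (fun s => Mx M s y) x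

/-- Partial derivative `M_xy`. -/
noncomputable def Mxy (M : ℝ → ℝ → ℝ) (x y : ℝ) : ℝ := deriv (fun s => Mx M x s) y

/-- Partial derivative `M_yy`. -/
noncomputable def Myy (M : ℝ → ℝ → ℝ) (x y : ℝ) : ℝ := deriv (fun s => My M x s) y

/-- The matrix `[[M_xx + M_y/y, M_xy], [M_xy, M_yy]]`. -/
noncomputable def Mmat (M : ℝ → ℝ → ℝ) (x y : ℝ) : Matrix (Fin 2) (Fin 2) ℝ :=
  !![Mxx M x y + My M x y / y, Mxy M x y; Mxy M x y, Myy M x y]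

/-- The function `M(x, y) = (1/√2) (2x - √(x² + y²)) √(x + √(x² + y²))`. -/
noncomputable def radialFun (s t : ℝ) : ℝ :=
  1 / Real.sqrt 2 * (2 * s - Real.sqrt (s ^ 2 + t ^ 2)) * Real.sqrt (s + Real.sqrt (s ^ 2 + t ^ 2))

lemma radius_pos (x : ℝ) {y : ℝ} (hy : 0 < y) : 0 < √(x ^ 2 + y ^ 2) := by
  positivity

lemma add_radius_pos (x : ℝ) {y : ℝ} (hy : 0 < y) : 0 < x + √(x ^ 2 + y ^ 2) := by
  have h : |x| < √(x ^ 2 + y ^ 2) := by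
    rw [← Real.sqrt_sq_eq_abs]
    exact Real.sqrt_lt_sqrt (by positivity) (by nlinarith)
  linarith [neg_abs_le x]

lemma hasDerivAt_radius_fst (x : ℝ) {y : ℝ} (hy : 0 < y) :
    HasDerivAt (fun s => √(s ^ 2 + y ^ 2)) (x / √(x ^ 2 + y ^ 2)) x := by
  refine (((hasDerivAt_pow 2 x).add_const (y ^ 2)).sqrt (by positivity)).congr_deriv ?_
  have := radius_pos x hy
  norm_num
  field_simp

lemma hasDerivAt_radius_snd (x : ℝ) {y : ℝ} (hy : 0 < y) :
    HasDerivAt (fun t => √(x ^ 2 + t ^ 2)) (y / √(x ^ 2 + y ^ 2)) y := by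
  refine (((hasDerivAt_pow 2 y).const_add (x ^ 2)).sqrt (by positivity)).congr_deriv ?_
  have := radius_pos x hy
  norm_num
  field_simp

lemma hasDerivAt_sqrt_add_radius_fst (x : ℝ) {y : ℝ} (hy : 0 < y) :
    HasDerivAt (fun s => √(s + √(s ^ 2 + y ^ 2)))
      (√(x + √(x ^ 2 + y ^ 2)) / (2 * √(x ^ 2 + y ^ 2))) x := by
  have hr := radius_pos x hy
  have hp := add_radius_pos x hy
  refine (((hasDerivAt_id x).add (hasDerivAt_radius_fst x hy)).sqrt hp.ne').congr_deriv ?_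
  have hq := Real.sqrt_pos.2 hp
  have hq2 := Real.sq_sqrt hp.le
  change (1 + x / √(x ^ 2 + y ^ 2)) / (2 * √(x + √(x ^ 2 + y ^ 2))) = _
  field_simp
  linarith

lemma hasDerivAt_sqrt_add_radius_snd (x : ℝ) {y : ℝ} (hy : 0 < y) :
    HasDerivAt (fun t => √(x + √(x ^ 2 + t ^ 2)))
      (y / (2 * √(x ^ 2 + y ^ 2) * √(x + √(x ^ 2 + y ^ 2)))) y := by
  have hr := radius_pos x hy
  have hp := add_radius_pos x hy
  convert ((hasDerivAt_radius_snd x hy).const_add x).sqrt hp.ne' using 1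
  have hq := Real.sqrt_pos.2 hp
  field_simp

lemma Mx_radialFun (x : ℝ) {y : ℝ} (hy : 0 < y) :
    Mx radialFun x y = 3 * √2 / 4 * √(x + √(x ^ 2 + y ^ 2)) := by
  have hr := radius_pos x hy
  have h := ((((hasDerivAt_id x).const_mul 2).sub (hasDerivAt_radius_fst x hy)).const_mul
    (1 / √2)).mul (hasDerivAt_sqrt_add_radius_fst x hy)
  refine h.deriv.trans ?_
  have h2 : √2 ^ 2 = (2 : ℝ) := Real.sq_sqrt (by norm_num)
  simp only [Pi.sub_apply, id_eq]
  field_simp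
  rw [h2]
  ring

lemma My_radialFun (x : ℝ) {y : ℝ} (hy : 0 < y) :
    My radialFun x y = -(3 * √2 / 4) * (y / √(x + √(x ^ 2 + y ^ 2))) := by
  have hr := radius_pos x hy
  have hp := add_radius_pos x hy
  have hq := Real.sqrt_pos.2 hp
  have hq2 := Real.sq_sqrt hp.le
  have h := (((hasDerivAt_radius_snd x hy).const_sub (2 * x)).const_mul
    (1 / √2)).mul (hasDerivAt_sqrt_add_radius_snd x hy)
  refine h.deriv.trans ?_
  have h2 : √2 ^ 2 = (2 : ℝ) := Real.sq_sqrt (by norm_num)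
  field_simp
  rw [h2, hq2]
  ring

lemma Mxx_radialFun (x : ℝ) {y : ℝ} (hy : 0 < y) :
    Mxx radialFun x y =
      3 * √2 / 4 * (√(x + √(x ^ 2 + y ^ 2)) / (2 * √(x ^ 2 + y ^ 2))) := by
  simp only [Mxx, Mx_radialFun _ hy]
  exact ((hasDerivAt_sqrt_add_radius_fst x hy).const_mul _).deriv

lemma Mxy_radialFun (x : ℝ) {y : ℝ} (hy : 0 < y) :
    Mxy radialFun x y =
      3 * √2 / 4 * (y / (2 * √(x ^ 2 + y ^ 2) * √(x + √(x ^ 2 + y ^ 2)))) := by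
  have h : (fun t => Mx radialFun x t) =ᶠ[nhds y]
      fun t => 3 * √2 / 4 * √(x + √(x ^ 2 + t ^ 2)) := by
    filter_upwards [lt_mem_nhds hy] with t ht using Mx_radialFun x ht
  rw [Mxy, h.deriv_eq]
  exact ((hasDerivAt_sqrt_add_radius_snd x hy).const_mul _).deriv

lemma sq_eq_of_radius (x y : ℝ) :
    y ^ 2 = (√(x ^ 2 + y ^ 2) - x) * (x + √(x ^ 2 + y ^ 2)) := by
  linear_combination -Real.sq_sqrt (show 0 ≤ x ^ 2 + y ^ 2 by positivity)

lemma Myy_radialFun (x : ℝ) {y : ℝ} (hy : 0 < y) :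
    Myy radialFun x y =
      -(3 * √2 / 4) * (√(x + √(x ^ 2 + y ^ 2)) / (2 * √(x ^ 2 + y ^ 2))) := by
  have h : (fun t => My radialFun x t) =ᶠ[nhds y]
      fun t => -(3 * √2 / 4) * (t / √(x + √(x ^ 2 + t ^ 2))) := by
    filter_upwards [lt_mem_nhds hy] with t ht using My_radialFun x ht
  have hr := radius_pos x hy
  have hp := add_radius_pos x hy
  have hq := Real.sqrt_pos.2 hp
  have hq2 := Real.sq_sqrt hp.le
  have hy2 := sq_eq_of_radius x y
  rw [Myy, h.deriv_eq]
  refine (((hasDerivAt_id y).div (hasDerivAt_sqrt_add_radius_snd x hy)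
    hq.ne').const_mul _).deriv.trans ?_
  simp only [id_eq]
  congr 1
  generalize √(x + √(x ^ 2 + y ^ 2)) = p at *
  generalize √(x ^ 2 + y ^ 2) = r at *
  field_simp
  rw [← hq2] at hy2
  have hx : x = p ^ 2 - r := by linarith
  subst hx
  linear_combination -hy2

lemma Mmat_radialFun (x : ℝ) {y : ℝ} (hy : 0 < y) :
    Mmat radialFun x y = (3 * √2 / (8 * √(x ^ 2 + y ^ 2))) •
      !![-(y ^ 2) / √(x + √(x ^ 2 + y ^ 2)) ^ 3, y / √(x + √(x ^ 2 + y ^ 2));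
         y / √(x + √(x ^ 2 + y ^ 2)), -√(x + √(x ^ 2 + y ^ 2))] := by
  have hr := radius_pos x hy
  have hp := add_radius_pos x hy
  have hq := Real.sqrt_pos.2 hp
  have hq2 := Real.sq_sqrt hp.le
  have hy2 := sq_eq_of_radius x y
  rw [Mmat, Mxx_radialFun x hy, Mxy_radialFun x hy, Myy_radialFun x hy, My_radialFun x hy]
  generalize √(x + √(x ^ 2 + y ^ 2)) = p at *
  generalize √(x ^ 2 + y ^ 2) = r at *
  rw [← hq2] at hy2
  have hx : x = p ^ 2 - r := by linarith
  subst hx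
  ext i j
  fin_cases i <;> fin_cases j <;> simp
  · field_simp
    linear_combination 8 * hy2
  · field_simp
    norm_num
  · field_simp
    norm_num
  · field_simp
    norm_num

lemma negSemidef_smul_rankOne {k p : ℝ} (hk : 0 ≤ k) (hp : 0 < p) (y : ℝ) :
    (k • !![-(y ^ 2) / p ^ 3, y / p; y / p, -p] : Matrix (Fin 2) (Fin 2) ℝ).NegSemidef' := by
  refine Matrix.PosSemidef.of_dotProduct_mulVec_nonneg ?_ fun v => ?_
  · ext i j
    fin_cases i <;> fin_cases j <;> simp
  · have h : 0 ≤ k / p ^ 3 * (y * v 0 - p ^ 2 * v 1) ^ 2 := by positivity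
    refine h.trans_eq ?_
    simp [dotProduct, Matrix.mulVec, Fin.sum_univ_two]
    field_simp
    ring

lemma det_smul_rankOne {p : ℝ} (hp : 0 < p) (k y : ℝ) :
    (k • !![-(y ^ 2) / p ^ 3, y / p; y / p, -p] : Matrix (Fin 2) (Fin 2) ℝ).det = 0 := by
  rw [Matrix.det_smul, Matrix.det_fin_two_of]
  field_simp
  ring

/-- for `M(x,y) = (1/√2)(2x − √(x²+y²))√(x+√(x²+y²))` the matrix
`[[M_xx + M_y/y, M_xy], [M_xy, M_yy]]` equals the displayed scalar multiple, is
negative semidefinite and has determinant zero, for `x > 0`, `y > 0`. -/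
theorem stmt_13 (x y : ℝ) (hx : 0 < x) (hy : 0 < y) :
    Mmat (fun s t => 1 / Real.sqrt 2 * (2 * s - Real.sqrt (s ^ 2 + t ^ 2))
          * Real.sqrt (s + Real.sqrt (s ^ 2 + t ^ 2))) x y
        = (3 * Real.sqrt 2 / (8 * Real.sqrt (x ^ 2 + y ^ 2))) •
          !![-(y ^ 2) / (x + Real.sqrt (x ^ 2 + y ^ 2)) ^ ((3 : ℝ) / 2),
             y / Real.sqrt (x + Real.sqrt (x ^ 2 + y ^ 2));
             y / Real.sqrt (x + Real.sqrt (x ^ 2 + y ^ 2)),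
             -Real.sqrt (x + Real.sqrt (x ^ 2 + y ^ 2))] ∧
      (Mmat (fun s t => 1 / Real.sqrt 2 * (2 * s - Real.sqrt (s ^ 2 + t ^ 2))
          * Real.sqrt (s + Real.sqrt (s ^ 2 + t ^ 2))) x y).NegSemidef' ∧
      (Mmat (fun s t => 1 / Real.sqrt 2 * (2 * s - Real.sqrt (s ^ 2 + t ^ 2))
          * Real.sqrt (s + Real.sqrt (s ^ 2 + t ^ 2))) x y).det = 0 := by
  change Mmat radialFun x y = _ ∧ (Mmat radialFun x y).NegSemidef' ∧ (Mmat radialFun x y).det = 0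
  have hp := add_radius_pos x hy
  have hq := Real.sqrt_pos.2 hp
  have hpow : (x + √(x ^ 2 + y ^ 2)) ^ ((3 : ℝ) / 2) = √(x + √(x ^ 2 + y ^ 2)) ^ 3 := by
    rw [Real.sqrt_eq_rpow (x + _), ← Real.rpow_mul_natCast hp.le]
    norm_num
  rw [hpow, Mmat_radialFun x hy]
  exact ⟨rfl, negSemidef_smul_rankOne (by positivity) hq y, det_smul_rankOne hq _ y⟩
end
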